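/- Let μ = μ₁ ⊗ ⋯ ⊗ μₙ be a product probability measure on ℝ^n where each μᵢ is a log-concave probability measure on ℝ with mean 0 and variance 1 (so μ is an isotropic log-concave product measure), and let f : ℝ^n → ℝ be a polynomial of degree d with coeff_d(f) = 1. Then there is a constant C_d > 0 depending only on d such that |∫_{ℝ^n} e^{itf(x)} dμ(x)| ≤ C_d |t|^{−1/d} for every t ≠ 0. -/

import Mathlib

open MeasureTheory

noncomputable section

/-- Variance of a real function with respect to a measure. -/
def mVar {α : Type*} [MeasurableSpace α] (μ : Measure α) (f : α → ℝ) : ℝ :=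
  (∫ x, f x ^ 2 ∂μ) - (∫ x, f x ∂μ) ^ 2

/-- A measure on ℝ is log-concave if it has a log-concave density w.r.t. Lebesgue measure. -/
def IsLogConcave1 (μ : Measure ℝ) : Prop :=
  ∃ ρ : ℝ → ℝ, (∀ x, 0 ≤ ρ x) ∧
    μ = volume.withDensity (fun x => ENNReal.ofReal (ρ x)) ∧
    ∀ x y : ℝ, ∀ l : ℝ, 0 ≤ l → l ≤ 1 →
      ρ x ^ l * ρ y ^ (1 - l) ≤ ρ (l * x + (1 - l) * y)

/-- `coeffNorm d f` is `coeff_d(f)`, the ℓ² norm of the coefficients of the degree-`d`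
homogeneous part of `f`. -/
def coeffNorm {n : ℕ} (d : ℕ) (f : MvPolynomial (Fin n) ℝ) : ℝ :=
  Real.sqrt (∑ I ∈ f.support.filter (fun I => (I.sum fun _ e => e) = d),
    (MvPolynomial.coeff I f) ^ 2)

/-! ### Top-degree coefficients of multivariate polynomials -/

/-- The exponents of total degree `d`. -/
abbrev topExp (n d : ℕ) : Finset (Fin n →₀ ℕ) := Finset.univ.finsuppAntidiag d

/-- The sum of the squares of the coefficients of degree `d`. -/
def topSq {n : ℕ} (d : ℕ) (f : MvPolynomial (Fin n) ℝ) : ℝ :=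
  ∑ I ∈ topExp n d, (MvPolynomial.coeff I f) ^ 2

lemma mem_topExp {n d : ℕ} {I : Fin n →₀ ℕ} : I ∈ topExp n d ↔ I.degree = d := by
  simp [Finset.mem_finsuppAntidiag, Finsupp.degree_eq_sum]

lemma topSq_nonneg {n : ℕ} (d : ℕ) (f : MvPolynomial (Fin n) ℝ) : 0 ≤ topSq d f :=
  Finset.sum_nonneg fun _ _ => sq_nonneg _

lemma topSq_C_mul {n : ℕ} (d : ℕ) (c : ℝ) (f : MvPolynomial (Fin n) ℝ) :
    topSq d (MvPolynomial.C c * f) = c ^ 2 * topSq d f := by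
  simp [topSq, MvPolynomial.coeff_C_mul, mul_pow, Finset.mul_sum]

/-- All coefficients of degree at least `k` vanish. -/
def DegLT {n : ℕ} (k : ℕ) (f : MvPolynomial (Fin n) ℝ) : Prop :=
  ∀ I : Fin n →₀ ℕ, k ≤ I.degree → MvPolynomial.coeff I f = 0

namespace DegLT

variable {n : ℕ} {k l : ℕ} {f g : MvPolynomial (Fin n) ℝ}

lemma mono (h : DegLT k f) (hkl : k ≤ l) : DegLT l f := fun I hI => h I (hkl.trans hI)

lemma zero : DegLT k (0 : MvPolynomial (Fin n) ℝ) := fun _ _ => by simp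

lemma add (hf : DegLT k f) (hg : DegLT k g) : DegLT k (f + g) := fun I hI => by
  simp [hf I hI, hg I hI]

lemma C_mul (c : ℝ) (hf : DegLT k f) : DegLT k (MvPolynomial.C c * f) := fun I hI => by
  simp [MvPolynomial.coeff_C_mul, hf I hI]

lemma sum {ι : Type*} (s : Finset ι) (F : ι → MvPolynomial (Fin n) ℝ)
    (h : ∀ i ∈ s, DegLT k (F i)) : DegLT k (∑ i ∈ s, F i) := fun I hI => by
  rw [MvPolynomial.coeff_sum]
  exact Finset.sum_eq_zero fun i hi => h i hi I hI

lemma mul (hf : DegLT (k + 1) f) (hg : DegLT l g) : DegLT (k + l) (f * g) := fun I hI => by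
  classical
  rw [MvPolynomial.coeff_mul]
  refine Finset.sum_eq_zero fun p hp => ?_
  rw [Finset.HasAntidiagonal.mem_antidiagonal] at hp
  have hdeg : p.1.degree + p.2.degree = I.degree := by rw [← hp, map_add]
  rcases le_or_gt (k + 1) p.1.degree with h | h
  · rw [hf _ h, zero_mul]
  · rw [hg _ (by omega), mul_zero]

lemma C (c : ℝ) : DegLT 1 (MvPolynomial.C c : MvPolynomial (Fin n) ℝ) := fun I hI => by
  classical
  rw [MvPolynomial.coeff_C, if_neg]
  rintro rfl
  simp at hI

lemma X (i : Fin n) : DegLT 2 (MvPolynomial.X i : MvPolynomial (Fin n) ℝ) := fun I hI => by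
  classical
  rw [MvPolynomial.coeff_X, if_neg]
  rintro rfl
  simp [Finsupp.degree_single] at hI

lemma iff_totalDegree : DegLT (k + 1) f ↔ f.totalDegree ≤ k := by
  constructor
  · intro h
    refine Finset.sup_le fun I hI => ?_
    by_contra! hlt
    exact (MvPolynomial.mem_support_iff.1 hI) (h I hlt)
  · intro h I hI
    exact MvPolynomial.coeff_eq_zero_of_totalDegree_lt (lt_of_le_of_lt h hI)

end DegLT

/-- The polynomial `x ↦ f (m + w x)`, with coordinatewise product. -/
def affSubst {n : ℕ} (m w : Fin n → ℝ) (f : MvPolynomial (Fin n) ℝ) : MvPolynomial (Fin n) ℝ :=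
  MvPolynomial.bind₁ (fun i => MvPolynomial.C (m i) + MvPolynomial.C (w i) * MvPolynomial.X i) f

section affSubst

variable {n : ℕ} (m w : Fin n → ℝ) (f : MvPolynomial (Fin n) ℝ)

lemma eval_affSubst (x : Fin n → ℝ) :
    MvPolynomial.eval x (affSubst m w f) = MvPolynomial.eval (fun i => m i + w i * x i) f := by
  have h := MvPolynomial.eval₂Hom_bind₁ (RingHom.id ℝ) x
    (fun i => MvPolynomial.C (m i) + MvPolynomial.C (w i) * MvPolynomial.X i) f
  rw [affSubst, MvPolynomial.eval, h]
  simp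

lemma coeff_affSubst_zero (I : Fin n →₀ ℕ) :
    MvPolynomial.coeff I (affSubst 0 w f) = (∏ i, w i ^ I i) * MvPolynomial.coeff I f := by
  classical
  induction f using MvPolynomial.induction_on' with
  | add p q hp hq =>
    have : affSubst 0 w (p + q) = affSubst 0 w p + affSubst 0 w q := map_add _ _ _
    simp [this, hp, hq, mul_add]
  | monomial J c =>
    have : affSubst 0 w (MvPolynomial.monomial J c)
        = MvPolynomial.monomial J (c * ∏ i, w i ^ J i) := by
      rw [affSubst, MvPolynomial.bind₁_monomial, MvPolynomial.monomial_eq (a := c * _),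
        MvPolynomial.C_mul, mul_assoc]
      congr 1
      rw [Finsupp.prod_fintype _ _ (by simp), map_prod, ← Finset.prod_mul_distrib]
      have hs : ∀ φ : Fin n → MvPolynomial (Fin n) ℝ,
          ∏ i ∈ J.support, φ i ^ J i = ∏ i, φ i ^ J i := fun φ =>
        Finset.prod_subset (Finset.subset_univ _) fun i _ hi => by
          simp [Finsupp.notMem_support_iff.1 hi]
      rw [hs]
      refine Finset.prod_congr rfl fun i _ => ?_
      simp [mul_pow]
    rw [this, MvPolynomial.coeff_monomial, MvPolynomial.coeff_monomial]
    split_ifs with h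
    · rw [h, mul_comm]
    · simp

lemma degLT_affSubst_aux (J : Fin n →₀ ℕ) :
    DegLT (J.degree + 1) (affSubst m w (MvPolynomial.monomial J 1)) ∧
    DegLT (J.degree + 1) (affSubst 0 w (MvPolynomial.monomial J 1)) ∧
    DegLT J.degree
      (affSubst m w (MvPolynomial.monomial J 1) - affSubst 0 w (MvPolynomial.monomial J 1)) := by
  induction J using Finsupp.induction_linear with
  | zero =>
    have h : ∀ m' : Fin n → ℝ, affSubst m' w (MvPolynomial.monomial 0 1) = 1 := fun m' =>
      map_one (MvPolynomial.bind₁ _)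
    rw [h, h, sub_self]
    exact ⟨by simpa using DegLT.C 1, by simpa using DegLT.C 1, DegLT.zero⟩
  | add I J hI hJ =>
    have h : ∀ m' : Fin n → ℝ, affSubst m' w (MvPolynomial.monomial (I + J) 1)
        = affSubst m' w (MvPolynomial.monomial I 1)
          * affSubst m' w (MvPolynomial.monomial J 1) := fun m' => by
      rw [affSubst, affSubst, affSubst, ← map_mul, MvPolynomial.monomial_mul, one_mul]
    rw [h, h, map_add]
    refine ⟨hI.1.mul hJ.1, hI.2.1.mul hJ.2.1, ?_⟩
    have : ∀ a a' b b' : MvPolynomial (Fin n) ℝ,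
        a * b - a' * b' = b * (a - a') + a' * (b - b') := fun a a' b b' => by ring
    rw [this]
    refine DegLT.add ?_ (hI.2.1.mul hJ.2.2)
    rw [add_comm I.degree]
    exact hJ.1.mul hI.2.2
  | single i a =>
    induction a with
    | zero =>
      have h : ∀ m' : Fin n → ℝ,
          affSubst m' w (MvPolynomial.monomial (Finsupp.single i 0) 1) = 1 := fun m' => by
        rw [Finsupp.single_zero]; exact map_one (MvPolynomial.bind₁ _)
      rw [h, h, sub_self]
      exact ⟨by simpa using DegLT.C 1, by simpa using DegLT.C 1, DegLT.zero⟩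
    | succ a ih =>
      have h : ∀ m' : Fin n → ℝ, affSubst m' w (MvPolynomial.monomial (Finsupp.single i (a + 1)) 1)
          = affSubst m' w (MvPolynomial.monomial (Finsupp.single i a) 1)
            * (MvPolynomial.C (m' i) + MvPolynomial.C (w i) * MvPolynomial.X i) := fun m' => by
        have hm : (MvPolynomial.monomial (Finsupp.single i (a + 1)) (1 : ℝ))
            = MvPolynomial.monomial (Finsupp.single i a) 1 * MvPolynomial.X i := by
          rw [MvPolynomial.X, MvPolynomial.monomial_mul, one_mul, Finsupp.single_add]
        rw [affSubst, affSubst, hm, map_mul, MvPolynomial.bind₁_X_right]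
      rw [Finsupp.degree_single] at ih
      rw [h, h, Finsupp.degree_single]
      have h2 : ∀ c : ℝ, DegLT (1 + 1) (MvPolynomial.C c
          + MvPolynomial.C (w i) * MvPolynomial.X i : MvPolynomial (Fin n) ℝ) := fun c =>
        ((DegLT.C c).mono (by norm_num)).add ((DegLT.X i).C_mul _)
      refine ⟨?_, ?_, ?_⟩
      · have := (h2 (m i)).mul ih.1
        rw [mul_comm, add_comm a 1]
        exact this
      · have := (h2 ((0 : Fin n → ℝ) i)).mul ih.2.1
        rw [mul_comm, add_comm a 1]
        exact this
      · have e : ∀ a a' b b' : MvPolynomial (Fin n) ℝ,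
            a * b - a' * b' = b * (a - a') + a' * (b - b') := fun a a' b b' => by ring
        rw [e]
        refine DegLT.add ?_ (ih.2.1.mul ?_)
        · rw [add_comm a 1]
          exact (h2 (m i)).mul ih.2.2
        · simpa using DegLT.C (n := n) (m i)

lemma affSubst_eq_sum : affSubst m w f = ∑ J ∈ f.support,
    MvPolynomial.C (MvPolynomial.coeff J f) * affSubst m w (MvPolynomial.monomial J 1) := by
  conv_lhs => rw [f.as_sum]
  rw [affSubst, map_sum]
  refine Finset.sum_congr rfl fun J _ => ?_
  rw [affSubst, ← MvPolynomial.bind₁_C_right (fun i =>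
    MvPolynomial.C (m i) + MvPolynomial.C (w i) * MvPolynomial.X i), ← map_mul,
    MvPolynomial.C_mul_monomial, mul_one]

variable {f}

lemma totalDegree_affSubst_le {d : ℕ} (hf : f.totalDegree ≤ d) :
    (affSubst m w f).totalDegree ≤ d := by
  rw [← DegLT.iff_totalDegree, affSubst_eq_sum]
  refine DegLT.sum _ _ fun J hJ => DegLT.C_mul _ ((degLT_affSubst_aux m w J).1.mono ?_)
  have : J.degree ≤ f.totalDegree := MvPolynomial.le_totalDegree hJ
  omega

lemma coeff_affSubst {d : ℕ} (hf : f.totalDegree ≤ d) {I : Fin n →₀ ℕ} (hI : I.degree = d) :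
    MvPolynomial.coeff I (affSubst m w f) = (∏ i, w i ^ I i) * MvPolynomial.coeff I f := by
  rw [← coeff_affSubst_zero, ← sub_eq_zero, ← MvPolynomial.coeff_sub]
  have : DegLT d (affSubst m w f - affSubst 0 w f) := by
    rw [affSubst_eq_sum m, affSubst_eq_sum 0, ← Finset.sum_sub_distrib]
    refine DegLT.sum _ _ fun J hJ => ?_
    rw [← mul_sub]
    refine DegLT.C_mul _ ((degLT_affSubst_aux m w J).2.2.mono ?_)
    have : J.degree ≤ f.totalDegree := MvPolynomial.le_totalDegree hJ
    omega
  exact this I hI.ge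

lemma topSq_affSubst {d : ℕ} (hf : f.totalDegree ≤ d) :
    topSq d (affSubst m w f)
      = ∑ I ∈ topExp n d, (∏ i, w i ^ I i) ^ 2 * (MvPolynomial.coeff I f) ^ 2 := by
  refine Finset.sum_congr rfl fun I hI => ?_
  rw [coeff_affSubst m w hf (mem_topExp.1 hI), mul_pow]

end affSubst

/-! ### Directional derivatives -/

/-- The polynomial `x ↦ ∑ i, b i * ∂ᵢ f (x)`. -/
def dirDeriv {n : ℕ} (b : Fin n → ℝ) (f : MvPolynomial (Fin n) ℝ) : MvPolynomial (Fin n) ℝ :=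
  ∑ i, MvPolynomial.C (b i) * MvPolynomial.pderiv i f

section dirDeriv

variable {n : ℕ} (b : Fin n → ℝ) (f : MvPolynomial (Fin n) ℝ)

lemma eval_dirDeriv (x : Fin n → ℝ) : MvPolynomial.eval x (dirDeriv b f)
    = ∑ i, b i * MvPolynomial.eval x (MvPolynomial.pderiv i f) := by
  simp [dirDeriv, map_sum]

lemma hasDerivAt_eval_comp {x : ℝ → Fin n → ℝ} {x' : Fin n → ℝ} {t : ℝ}
    (hx : ∀ i, HasDerivAt (fun s => x s i) (x' i) t) :
    HasDerivAt (fun s => MvPolynomial.eval (x s) f)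
      (MvPolynomial.eval (x t) (dirDeriv x' f)) t := by
  classical
  rw [eval_dirDeriv]
  induction f using MvPolynomial.induction_on with
  | C a => simpa using hasDerivAt_const t a
  | add p q hp hq =>
    simp only [map_add, mul_add, Finset.sum_add_distrib]
    exact hp.fun_add hq
  | mul_X p i hp =>
    have := hp.fun_mul (hx i)
    simp only [map_mul, MvPolynomial.eval_X]
    refine this.congr_deriv (Eq.symm ?_)
    simp only [MvPolynomial.pderiv_mul, MvPolynomial.pderiv_X, map_add, map_mul,
      MvPolynomial.eval_X, mul_add, Finset.sum_add_distrib, Finset.sum_mul, ← mul_assoc]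
    congr 1
    rw [Finset.sum_eq_single i]
    · simp [mul_comm]
    · intro j _ hj
      simp [hj.symm]
    · simp

lemma coeff_dirDeriv (J : Fin n →₀ ℕ) : MvPolynomial.coeff J (dirDeriv b f)
    = ∑ i, b i * ((J i + 1) * MvPolynomial.coeff (J + Finsupp.single i 1) f) := by
  rw [dirDeriv, MvPolynomial.coeff_sum]
  refine Finset.sum_congr rfl fun i _ => ?_
  rw [MvPolynomial.coeff_C_mul, MvPolynomial.coeff_pderiv]
  ring

variable {f}

lemma totalDegree_dirDeriv_le {d : ℕ} (hf : f.totalDegree ≤ d + 1) :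
    (dirDeriv b f).totalDegree ≤ d := by
  rw [← DegLT.iff_totalDegree] at *
  intro I hI
  rw [coeff_dirDeriv]
  refine Finset.sum_eq_zero fun i _ => ?_
  rw [hf _ (by rw [map_add, Finsupp.degree_single]; omega)]
  ring

variable (f)

lemma topSq_le_sum_pderiv (d : ℕ) : topSq (d + 1) f ≤ ∑ J ∈ topExp n d,
    ∑ i, ((J i + 1) * MvPolynomial.coeff (J + Finsupp.single i 1) f) ^ 2 := by
  classical
  have h1 : topSq (d + 1) f ≤ ∑ I ∈ topExp n (d + 1),
      ∑ i, ((I i : ℝ) * MvPolynomial.coeff I f) ^ 2 := by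
    refine Finset.sum_le_sum fun I hI => ?_
    have hI' := mem_topExp.1 hI
    obtain ⟨i, hi⟩ : ∃ i, I i ≠ 0 := by
      by_contra! h
      have : I = 0 := Finsupp.ext h
      simp [this] at hI'
    refine le_trans ?_ (Finset.single_le_sum (f := fun i => ((I i : ℝ) * MvPolynomial.coeff I f) ^ 2)
      (fun _ _ => sq_nonneg _) (Finset.mem_univ i))
    have : (1 : ℝ) ≤ I i := by exact_mod_cast Nat.one_le_iff_ne_zero.2 hi
    rw [mul_pow]
    exact le_mul_of_one_le_left (sq_nonneg _) (one_le_pow₀ this)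
  refine h1.trans (le_of_eq ?_)
  rw [Finset.sum_comm, Finset.sum_comm (s := topExp n d)]
  refine Finset.sum_congr rfl fun i _ => ?_
  symm
  refine Finset.sum_of_injOn (fun J => J + Finsupp.single i 1) ?_ ?_ ?_ ?_
  · intro a _ b _ h
    exact add_right_cancel h
  · intro J hJ
    have := mem_topExp.1 hJ
    exact mem_topExp.2 (by rw [map_add, Finsupp.degree_single, this])
  · intro I hI hI'
    have hz : I i = 0 := by
      by_contra h
      refine hI' ⟨I - Finsupp.single i 1, ?_, ?_⟩
      · have e : I - Finsupp.single i 1 + Finsupp.single i 1 = I :=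
          tsub_add_cancel_of_le (by
            rw [Finsupp.single_le_iff]; omega)
        have := congrArg Finsupp.degree e
        rw [map_add, Finsupp.degree_single, mem_topExp.1 hI] at this
        exact mem_topExp.2 (by omega)
      · exact tsub_add_cancel_of_le (by rw [Finsupp.single_le_iff]; omega)
    simp [hz]
  · intro J _
    simp

end dirDeriv

/-! ### Oscillatory integrals with a damped amplitude -/

lemma integral_abs_deriv_le {q q' : ℝ → ℝ} {M : ℝ} (hq : ∀ x, HasDerivAt q (q' x) x)
    (hc : Continuous q') (hM : ∀ x, |q x| ≤ M) (N : ℕ) :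
    ∀ (a b : ℝ) (S : Finset ℝ), a ≤ b → S.card ≤ N → (∀ x ∈ Set.Ioo a b, q' x = 0 → x ∈ S) →
      ∫ x in a..b, |q' x| ≤ 2 * M * (S.card + 1) := by
  induction N using Nat.strong_induction_on with
  | _ N ih =>
  intro a b S hab hS hz
  have hM0 : 0 ≤ M := (abs_nonneg _).trans (hM 0)
  by_cases hex : ∃ c ∈ Set.Ioo a b, q' c = 0
  · obtain ⟨c, hc1, hc2⟩ := hex
    have hcS := hz c hc1 hc2
    set S₁ := S.filter (· < c) with hS₁
    set S₂ := S.filter (c < ·) with hS₂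
    have hcard : S₁.card + S₂.card + 1 ≤ S.card := by
      have hd : Disjoint S₁ S₂ := by
        rw [Finset.disjoint_filter]
        intro x _ h1 h2
        exact absurd (h1.trans h2) (lt_irrefl _)
      rw [← Finset.card_union_of_disjoint hd]
      have : c ∉ S₁ ∪ S₂ := by simp [hS₁, hS₂]
      rw [← Finset.card_insert_of_notMem this]
      refine Finset.card_le_card ?_
      intro x hx
      simp only [Finset.mem_insert, Finset.mem_union, hS₁, hS₂, Finset.mem_filter] at hx
      rcases hx with rfl | h | h
      · exact hcS
      · exact h.1
      · exact h.1
    have h1 := ih (N - 1) (by omega) a c S₁ hc1.1.le (by omega) (fun x hx h => by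
      simp only [hS₁, Finset.mem_filter]
      exact ⟨hz x ⟨hx.1, hx.2.trans hc1.2⟩ h, hx.2⟩)
    have h2 := ih (N - 1) (by omega) c b S₂ hc1.2.le (by omega) (fun x hx h => by
      simp only [hS₂, Finset.mem_filter]
      exact ⟨hz x ⟨hc1.1.trans hx.1, hx.2⟩ h, hx.1⟩)
    have hi : ∀ u v, IntervalIntegrable (fun x => |q' x|) volume u v := fun u v =>
      hc.abs.intervalIntegrable u v
    rw [← intervalIntegral.integral_add_adjacent_intervals (hi a c) (hi c b)]
    have hcard' : (S₁.card : ℝ) + S₂.card + 1 ≤ S.card := by exact_mod_cast hcard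
    have : 2 * M * (S₁.card + 1) + 2 * M * (S₂.card + 1) ≤ 2 * M * (S.card + 1) := by
      rw [← mul_add]
      exact mul_le_mul_of_nonneg_left (by linarith) (by positivity)
    linarith
  · push Not at hex
    have hInt : ∫ x in a..b, q' x = q b - q a :=
      intervalIntegral.integral_eq_sub_of_hasDerivAt (fun x _ => hq x) (hc.intervalIntegrable a b)
    have hbd : |q b - q a| ≤ 2 * M := by
      have := abs_sub (q b) (q a)
      linarith [hM a, hM b]
    have hle : 2 * M ≤ 2 * M * (S.card + 1) := by
      have : (0 : ℝ) ≤ S.card := by positivity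
      nlinarith
    rcases hasDerivWithinAt_forall_lt_or_forall_gt_of_forall_ne (convex_Ioo a b)
      (fun x _ => (hq x).hasDerivWithinAt) hex with h | h
    · have : ∫ x in a..b, |q' x| = ∫ x in a..b, -q' x := by
        rw [intervalIntegral.integral_of_le hab, intervalIntegral.integral_of_le hab,
          integral_Ioc_eq_integral_Ioo, integral_Ioc_eq_integral_Ioo]
        exact setIntegral_congr_fun measurableSet_Ioo fun x hx => abs_of_neg (h x hx)
      rw [this, intervalIntegral.integral_neg, hInt]
      exact (neg_le_abs _).trans (hbd.trans hle)
    · have : ∫ x in a..b, |q' x| = ∫ x in a..b, q' x := by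
        rw [intervalIntegral.integral_of_le hab, intervalIntegral.integral_of_le hab,
          integral_Ioc_eq_integral_Ioo, integral_Ioc_eq_integral_Ioo]
        exact setIntegral_congr_fun measurableSet_Ioo fun x hx => abs_of_pos (h x hx)
      rw [this, hInt]
      exact (le_abs_self _).trans (hbd.trans hle)

/-- A function has at most `N` zeros in `(a, b)`, or vanishes identically there. -/
def FewZeros (N : ℕ) (a b : ℝ) (g : ℝ → ℝ) : Prop :=
  (∀ x ∈ Set.Ioo a b, g x = 0) ∨
    ∃ S : Finset ℝ, S.card ≤ N ∧ ∀ x ∈ Set.Ioo a b, g x = 0 → x ∈ S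

lemma norm_integral_exp_mul_damped_le {p p₁ p₂ v v₁ : ℝ → ℝ} {ε a b : ℝ} {N : ℕ}
    (hp : ∀ x, HasDerivAt p (p₁ x) x) (hp₁ : ∀ x, HasDerivAt p₁ (p₂ x) x)
    (hp₂ : Continuous p₂) (hv : ∀ x, HasDerivAt v (v₁ x) x) (hv₁ : Continuous v₁)
    (hε : 0 < ε) (hab : a ≤ b)
    (hz : FewZeros N a b
      (fun x => p₂ x * (ε ^ 2 - p₁ x ^ 2 + v x ^ 2) - 2 * p₁ x * v x * v₁ x)) :
    ‖∫ x in a..b, Complex.exp (Complex.I * p x)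
        * ((p₁ x ^ 2 / (ε ^ 2 + p₁ x ^ 2 + v x ^ 2) : ℝ) : ℂ)‖ ≤ (N + 2) / ε := by
  have cp : Continuous p := continuous_iff_continuousAt.2 fun x => (hp x).continuousAt
  have cp₁ : Continuous p₁ := continuous_iff_continuousAt.2 fun x => (hp₁ x).continuousAt
  have cv : Continuous v := continuous_iff_continuousAt.2 fun x => (hv x).continuousAt
  have hD : ∀ x, 0 < ε ^ 2 + p₁ x ^ 2 + v x ^ 2 := fun x => by positivity
  set num : ℝ → ℝ := fun x =>
    p₂ x * (ε ^ 2 - p₁ x ^ 2 + v x ^ 2) - 2 * p₁ x * v x * v₁ x with hnum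
  set q : ℝ → ℝ := fun x => p₁ x / (ε ^ 2 + p₁ x ^ 2 + v x ^ 2) with hq
  set q' : ℝ → ℝ := fun x => num x / (ε ^ 2 + p₁ x ^ 2 + v x ^ 2) ^ 2 with hq'
  have cq : Continuous q := cp₁.div (by fun_prop) fun x => (hD x).ne'
  have cq' : Continuous q' := by
    refine Continuous.div ?_ (by fun_prop) fun x => (pow_pos (hD x) 2).ne'
    fun_prop
  have dq : ∀ x, HasDerivAt q (q' x) x := fun x => by
    have h1 : HasDerivAt (fun x => ε ^ 2 + p₁ x ^ 2 + v x ^ 2)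
        (2 * p₁ x * p₂ x + 2 * v x * v₁ x) x := by
      have := (((hp₁ x).fun_pow 2).const_add (ε ^ 2)).fun_add ((hv x).fun_pow 2)
      refine this.congr_deriv ?_
      norm_num
    refine ((hp₁ x).fun_div h1 (hD x).ne').congr_deriv ?_
    simp only [hq', hnum]
    congr 1
    ring
  have hqM : ∀ x, |q x| ≤ 1 / (2 * ε) := fun x => by
    simp only [hq]
    rw [abs_div, abs_of_pos (hD x), div_le_div_iff₀ (hD x) (by positivity)]
    have : 0 ≤ (ε - |p₁ x|) ^ 2 := sq_nonneg _
    nlinarith [sq_abs (p₁ x), sq_nonneg (v x)]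
  have hTV : ∫ x in a..b, |q' x| ≤ (N + 1) / ε := by
    rcases hz with h | ⟨S, hS, h⟩
    · have : ∫ x in a..b, |q' x| = 0 := by
        rw [intervalIntegral.integral_of_le hab, integral_Ioc_eq_integral_Ioo]
        rw [setIntegral_congr_fun (g := fun _ => (0 : ℝ)) measurableSet_Ioo]
        · simp
        · intro x hx
          have := h x hx
          simp [hq', this]
      rw [this]
      positivity
    · refine (integral_abs_deriv_le dq cq' hqM N a b S hab hS fun x hx h0 => h x hx ?_).trans ?_
      · simp only [hq'] at h0
        exact (div_eq_zero_iff.1 h0).resolve_right (pow_pos (hD x) 2).ne'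
      · have : (S.card : ℝ) ≤ N := by exact_mod_cast hS
        rw [show 2 * (1 / (2 * ε)) = 1 / ε by field_simp, one_div_mul_eq_div]
        gcongr
  have dE : ∀ x, HasDerivAt (fun x => -Complex.I * Complex.exp (Complex.I * p x))
      (Complex.exp (Complex.I * p x) * p₁ x) x := fun x => by
    have := (((hp x).ofReal_comp.const_mul Complex.I).cexp).const_mul (-Complex.I)
    refine this.congr_deriv ?_
    linear_combination (-Complex.exp (Complex.I * p x) * p₁ x) * Complex.I_mul_I
  have hibp := intervalIntegral.integral_mul_deriv_eq_deriv_mul (a := a) (b := b)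
    (u := fun x => (q x : ℂ)) (u' := fun x => (q' x : ℂ))
    (v := fun x => -Complex.I * Complex.exp (Complex.I * p x))
    (v' := fun x => Complex.exp (Complex.I * p x) * p₁ x)
    (fun x _ => (dq x).ofReal_comp) (fun x _ => dE x)
    (Continuous.intervalIntegrable (by fun_prop) a b)
    (Continuous.intervalIntegrable (by fun_prop) a b)
  have heq : (fun x => Complex.exp (Complex.I * p x)
        * ((p₁ x ^ 2 / (ε ^ 2 + p₁ x ^ 2 + v x ^ 2) : ℝ) : ℂ))
      = fun x => (q x : ℂ) * (Complex.exp (Complex.I * p x) * p₁ x) := by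
    funext x
    simp only [hq]
    push_cast
    ring
  have hn : ∀ x, ‖-Complex.I * Complex.exp (Complex.I * p x)‖ = 1 := fun x => by
    rw [norm_mul, mul_comm Complex.I, Complex.norm_exp_ofReal_mul_I]
    simp
  rw [heq, hibp]
  have h3 : ‖∫ x in a..b, (q' x : ℂ) * (-Complex.I * Complex.exp (Complex.I * p x))‖
      ≤ ∫ x in a..b, |q' x| := by
    refine (intervalIntegral.norm_integral_le_integral_norm hab).trans (le_of_eq ?_)
    congr 1
    funext x
    rw [norm_mul, hn, mul_one, Complex.norm_real, Real.norm_eq_abs]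
  have hb : ∀ x, ‖(q x : ℂ) * (-Complex.I * Complex.exp (Complex.I * p x))‖ ≤ 1 / (2 * ε) :=
    fun x => by
      rw [norm_mul, hn, mul_one, Complex.norm_real, Real.norm_eq_abs]
      exact hqM x
  have hsplit : ((N : ℝ) + 2) / ε = 1 / (2 * ε) + 1 / (2 * ε) + (N + 1) / ε := by
    field_simp
    ring
  rw [hsplit]
  refine (norm_sub_le _ _).trans (add_le_add ((norm_sub_le _ _).trans
    (add_le_add (hb b) (hb a))) (h3.trans hTV))

/-! ### Trigonometric polynomials -/

/-- `g` is a trigonometric polynomial of degree at most `N`. -/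
def IsTrigPoly (N : ℕ) (g : ℝ → ℝ) : Prop :=
  ∃ P : Polynomial ℂ, P.natDegree ≤ 2 * N ∧
    ∀ θ : ℝ, (g θ : ℂ) * Complex.exp (Complex.I * θ) ^ N = P.eval (Complex.exp (Complex.I * θ))

namespace IsTrigPoly

open Polynomial in
lemma mono {N M : ℕ} {g : ℝ → ℝ} (h : IsTrigPoly N g) (hNM : N ≤ M) : IsTrigPoly M g := by
  obtain ⟨P, hP, h⟩ := h
  refine ⟨P * X ^ (M - N), ?_, fun θ => ?_⟩
  · refine natDegree_mul_le.trans ?_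
    rw [natDegree_X_pow]
    omega
  · rw [eval_mul, ← h, eval_pow, eval_X, mul_assoc, ← pow_add, Nat.add_sub_cancel' hNM]

lemma add {N : ℕ} {g h : ℝ → ℝ} (hg : IsTrigPoly N g) (hh : IsTrigPoly N h) :
    IsTrigPoly N (fun θ => g θ + h θ) := by
  obtain ⟨P, hP, hg⟩ := hg
  obtain ⟨Q, hQ, hh⟩ := hh
  refine ⟨P + Q, (Polynomial.natDegree_add_le _ _).trans (max_le hP hQ), fun θ => ?_⟩
  rw [Polynomial.eval_add, ← hg, ← hh]
  push_cast
  ring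

lemma mul {N M : ℕ} {g h : ℝ → ℝ} (hg : IsTrigPoly N g) (hh : IsTrigPoly M h) :
    IsTrigPoly (N + M) (fun θ => g θ * h θ) := by
  obtain ⟨P, hP, hg⟩ := hg
  obtain ⟨Q, hQ, hh⟩ := hh
  refine ⟨P * Q, Polynomial.natDegree_mul_le.trans (by omega), fun θ => ?_⟩
  rw [Polynomial.eval_mul, ← hg, ← hh]
  push_cast
  ring

lemma const (c : ℝ) : IsTrigPoly 0 (fun _ => c) :=
  ⟨Polynomial.C (c : ℂ), by simp, fun θ => by simp⟩

lemma const_mul {N : ℕ} {g : ℝ → ℝ} (c : ℝ) (hg : IsTrigPoly N g) :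
    IsTrigPoly N (fun θ => c * g θ) := by
  simpa using (const c).mul hg

lemma sub {N : ℕ} {g h : ℝ → ℝ} (hg : IsTrigPoly N g) (hh : IsTrigPoly N h) :
    IsTrigPoly N (fun θ => g θ - h θ) := by
  simpa [sub_eq_add_neg] using hg.add (hh.const_mul (-1))

lemma sum {ι : Type*} {N : ℕ} (s : Finset ι) (g : ι → ℝ → ℝ)
    (h : ∀ i ∈ s, IsTrigPoly N (g i)) : IsTrigPoly N (fun θ => ∑ i ∈ s, g i θ) := by
  classical
  induction s using Finset.induction_on with
  | empty => simpa using (const 0).mono (Nat.zero_le N)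
  | insert i s hi ih =>
    simp only [Finset.sum_insert hi]
    exact (h i (Finset.mem_insert_self _ _)).add
      (ih fun j hj => h j (Finset.mem_insert_of_mem hj))

lemma pow {N : ℕ} {g : ℝ → ℝ} (hg : IsTrigPoly N g) (k : ℕ) :
    IsTrigPoly (k * N) (fun θ => g θ ^ k) := by
  induction k with
  | zero => simpa using const 1
  | succ k ih =>
    simp only [pow_succ, Nat.succ_mul]
    exact ih.mul hg

lemma prod {ι : Type*} (s : Finset ι) (N : ι → ℕ) (g : ι → ℝ → ℝ)
    (h : ∀ i ∈ s, IsTrigPoly (N i) (g i)) :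
    IsTrigPoly (∑ i ∈ s, N i) (fun θ => ∏ i ∈ s, g i θ) := by
  classical
  induction s using Finset.induction_on with
  | empty => simpa using const 1
  | insert i s hi ih =>
    simp only [Finset.prod_insert hi, Finset.sum_insert hi]
    exact (h i (Finset.mem_insert_self _ _)).mul
      (ih fun j hj => h j (Finset.mem_insert_of_mem hj))

lemma cos : IsTrigPoly 1 Real.cos := by
  refine ⟨Polynomial.C (1 / 2) * Polynomial.X ^ 2 + Polynomial.C (1 / 2), ?_, fun θ => ?_⟩
  · compute_degree
  · simp only [Polynomial.eval_add, Polynomial.eval_mul, Polynomial.eval_C, Polynomial.eval_pow,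
      Polynomial.eval_X, pow_one, Complex.ofReal_cos, Complex.cos]
    have : Complex.exp (-θ * Complex.I) * Complex.exp (Complex.I * θ) = 1 := by
      rw [← Complex.exp_add]; simp [mul_comm]
    rw [mul_comm (θ : ℂ) Complex.I]
    linear_combination this / 2

lemma sin : IsTrigPoly 1 Real.sin := by
  refine ⟨Polynomial.C (-Complex.I / 2) * Polynomial.X ^ 2 + Polynomial.C (Complex.I / 2), ?_,
    fun θ => ?_⟩
  · compute_degree
  · simp only [Polynomial.eval_add, Polynomial.eval_mul, Polynomial.eval_C, Polynomial.eval_pow,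
      Polynomial.eval_X, pow_one, Complex.ofReal_sin, Complex.sin]
    have : Complex.exp (-θ * Complex.I) * Complex.exp (Complex.I * θ) = 1 := by
      rw [← Complex.exp_add]; simp [mul_comm]
    rw [mul_comm (θ : ℂ) Complex.I]
    linear_combination (Complex.I * this) / 2

lemma eval_mvPolynomial {n d : ℕ} {f : MvPolynomial (Fin n) ℝ} (hf : f.totalDegree ≤ d)
    {x : ℝ → Fin n → ℝ} (hx : ∀ i, IsTrigPoly 1 (fun θ => x θ i)) :
    IsTrigPoly d (fun θ => MvPolynomial.eval (x θ) f) := by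
  simp only [MvPolynomial.eval_eq']
  refine sum _ _ fun I hI => const_mul _ ?_
  have := prod Finset.univ (fun i => I i * 1) (fun i θ => x θ i ^ I i) fun i _ => (hx i).pow _
  refine this.mono ?_
  have h2 : I.degree ≤ f.totalDegree := MvPolynomial.le_totalDegree hI
  rw [Finsupp.degree_eq_sum] at h2
  simpa using h2.trans hf

lemma eq_re {N : ℕ} {g : ℝ → ℝ} {P : Polynomial ℂ} (h : ∀ θ : ℝ, (g θ : ℂ)
      * Complex.exp (Complex.I * θ) ^ N = P.eval (Complex.exp (Complex.I * θ))) (θ : ℝ) :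
    g θ = (P.eval (Complex.exp (Complex.I * θ)) * Complex.exp (-Complex.I * θ) ^ N).re := by
  have : Complex.exp (Complex.I * θ) * Complex.exp (-Complex.I * θ) = 1 := by
    rw [← Complex.exp_add]; simp
  rw [← h, mul_assoc, ← mul_pow, this, one_pow, mul_one, Complex.ofReal_re]

lemma differentiable {N : ℕ} {g : ℝ → ℝ} (hg : IsTrigPoly N g) : Differentiable ℝ g := by
  obtain ⟨P, -, h⟩ := hg
  have : g = fun θ : ℝ => (P.eval (Complex.exp (Complex.I * θ))
      * Complex.exp (-Complex.I * θ) ^ N).re := funext (eq_re h)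
  rw [this]
  have hof : ∀ θ, HasDerivAt (fun θ : ℝ => (θ : ℂ)) 1 θ := fun θ => Complex.ofRealCLM.hasDerivAt
  have hd : Differentiable ℝ (fun θ : ℝ => (P.eval (Complex.exp (Complex.I * θ))
      * Complex.exp (-Complex.I * θ) ^ N)) := by
    intro θ
    have h1 := ((hof θ).const_mul Complex.I).cexp
    have h2 := (((hof θ).const_mul (-Complex.I)).cexp).fun_pow N
    have h3 := (P.hasDerivAt (Complex.exp (Complex.I * θ))).comp θ h1
    exact (h3.fun_mul h2).differentiableAt
  exact fun θ => (Complex.reCLM.differentiableAt).comp θ (hd θ)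

lemma deriv {N : ℕ} {g : ℝ → ℝ} (hg : IsTrigPoly N g) : IsTrigPoly N (deriv g) := by
  have hdiff := hg.differentiable
  obtain ⟨P, hP, h⟩ := hg
  refine ⟨Polynomial.C Complex.I * (Polynomial.X * Polynomial.derivative P)
    - Polynomial.C (Complex.I * N) * P, ?_, fun θ => ?_⟩
  · refine (Polynomial.natDegree_sub_le _ _).trans (max_le ?_ ?_)
    · refine (Polynomial.natDegree_C_mul_le _ _).trans ?_
      rcases Nat.eq_zero_or_pos P.natDegree with h0 | h0
      · rw [Polynomial.derivative_of_natDegree_zero h0]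
        simp
      · refine Polynomial.natDegree_mul_le.trans ?_
        have := Polynomial.natDegree_derivative_lt h0.ne'
        have := Polynomial.natDegree_X_le (R := ℂ)
        omega
    · exact (Polynomial.natDegree_C_mul_le _ _).trans hP
  · have hof : HasDerivAt (fun θ : ℝ => (θ : ℂ)) 1 θ := Complex.ofRealCLM.hasDerivAt
    have h1 := (hof.const_mul Complex.I).cexp
    have h3 := (P.hasDerivAt (Complex.exp (Complex.I * θ))).comp θ h1
    have h4 := ((hdiff θ).hasDerivAt.ofReal_comp).fun_mul (h1.fun_pow N)
    have h5 : (fun θ : ℝ => (g θ : ℂ) * Complex.exp (Complex.I * θ) ^ N)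
        = (fun z => P.eval z) ∘ fun θ : ℝ => Complex.exp (Complex.I * θ) := funext h
    rw [h5] at h4
    have h6 := h4.unique h3
    have h7 : (N : ℂ) * Complex.exp (Complex.I * θ) ^ (N - 1) * Complex.exp (Complex.I * θ)
        = N * Complex.exp (Complex.I * θ) ^ N := by
      rcases Nat.eq_zero_or_pos N with rfl | hN
      · simp
      · rw [mul_assoc, ← pow_succ, Nat.sub_add_cancel hN]
    simp only [Polynomial.eval_sub, Polynomial.eval_mul, Polynomial.eval_C, Polynomial.eval_X,
      ← h]
    linear_combination h6 - g θ * Complex.I * h7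

lemma fewZeros {N : ℕ} {g : ℝ → ℝ} (hg : IsTrigPoly N g) :
    FewZeros (2 * N) 0 (2 * Real.pi) g := by
  classical
  obtain ⟨P, hP, h⟩ := hg
  by_cases hP0 : P = 0
  · left
    intro x _
    have := h x
    simpa [hP0, Complex.exp_ne_zero] using this
  right
  set Z : Set ℝ := {x | x ∈ Set.Ioo 0 (2 * Real.pi) ∧ g x = 0} with hZ
  have hmaps : ∀ x ∈ Z, Complex.exp (Complex.I * x) ∈ (P.roots.toFinset : Set ℂ) := by
    rintro x ⟨-, hx⟩
    have := h x
    rw [hx, Complex.ofReal_zero, zero_mul] at this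
    simp [hP0, ← this]
  have hinj : Set.InjOn (fun x : ℝ => Complex.exp (Complex.I * x)) Z := by
    rintro x ⟨hx, -⟩ y ⟨hy, -⟩ hxy
    obtain ⟨k, hk⟩ := Complex.exp_eq_exp_iff_exists_int.1 hxy
    have hk' : (x : ℂ) = ((y + k * (2 * Real.pi) : ℝ) : ℂ) := by
      have : Complex.I * (x : ℂ) = Complex.I * ((y + k * (2 * Real.pi) : ℝ) : ℂ) := by
        rw [hk]; push_cast; ring
      exact mul_left_cancel₀ Complex.I_ne_zero this
    have hk2 : x = y + k * (2 * Real.pi) := by exact_mod_cast hk'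
    have hpi := Real.pi_pos
    have h1 : (k : ℝ) < 1 := by
      by_contra! hc
      nlinarith [hx.2, hy.1]
    have h2 : (-1 : ℝ) < k := by
      by_contra! hc
      nlinarith [hx.1, hy.2]
    have h1' : k < 1 := by exact_mod_cast h1
    have h2' : -1 < k := by exact_mod_cast h2
    have : k = 0 := by omega
    simpa [this] using hk2
  have hfin : Z.Finite := Set.Finite.of_injOn hmaps hinj (Finset.finite_toSet _)
  refine ⟨hfin.toFinset, ?_, fun x hx h0 => by simpa [hZ] using ⟨hx, h0⟩⟩
  refine (Finset.card_le_card_of_injOn (t := P.roots.toFinset)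
    (fun x : ℝ => Complex.exp (Complex.I * x)) ?_ ?_).trans ?_
  · intro x hx
    exact hmaps x (by simpa using hx)
  · simpa using hinj
  · exact (Multiset.toFinset_card_le _).trans ((Polynomial.card_roots' P).trans hP)

end IsTrigPoly

lemma norm_integral_rotation_le {n d : ℕ} {f : MvPolynomial (Fin n) ℝ} (hf : f.totalDegree ≤ d)
    (A B C : Fin n → ℝ) {ε : ℝ} (hε : 0 < ε) :
    ‖∫ θ in (0 : ℝ)..(2 * Real.pi), Complex.exp (Complex.I *
        (MvPolynomial.eval (fun i => A i * Real.cos θ + B i * Real.sin θ) f : ℝ)) *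
      (((MvPolynomial.eval (fun i => A i * Real.cos θ + B i * Real.sin θ)
          (dirDeriv (fun i => B i * Real.cos θ - A i * Real.sin θ) f)) ^ 2 /
        (ε ^ 2 + (MvPolynomial.eval (fun i => A i * Real.cos θ + B i * Real.sin θ)
          (dirDeriv (fun i => B i * Real.cos θ - A i * Real.sin θ) f)) ^ 2 +
          (MvPolynomial.eval (fun i => A i * Real.cos θ + B i * Real.sin θ)
            (dirDeriv C f)) ^ 2) : ℝ) : ℂ)‖ ≤ (6 * d + 2) / ε := by
  set x : ℝ → Fin n → ℝ := fun θ i => A i * Real.cos θ + B i * Real.sin θ with hx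
  have hxt : ∀ i, IsTrigPoly 1 (fun θ => x θ i) := fun i =>
    (IsTrigPoly.cos.const_mul _).add (IsTrigPoly.sin.const_mul _)
  set p : ℝ → ℝ := fun θ => MvPolynomial.eval (x θ) f with hp
  set v : ℝ → ℝ := fun θ => MvPolynomial.eval (x θ) (dirDeriv C f) with hv
  have tp : IsTrigPoly d p := IsTrigPoly.eval_mvPolynomial hf hxt
  have tv : IsTrigPoly d v :=
    IsTrigPoly.eval_mvPolynomial (totalDegree_dirDeriv_le C (hf.trans (Nat.le_succ d))) hxt
  have hp₁ : ∀ θ, MvPolynomial.eval (x θ)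
      (dirDeriv (fun i => B i * Real.cos θ - A i * Real.sin θ) f) = deriv p θ := fun θ => by
    symm
    refine (hasDerivAt_eval_comp f fun i => ?_).deriv
    have := ((Real.hasDerivAt_cos θ).const_mul (A i)).fun_add
      ((Real.hasDerivAt_sin θ).const_mul (B i))
    exact this.congr_deriv (by ring)
  have tp₁ := tp.deriv
  have tp₂ := tp₁.deriv
  have tv₁ := tv.deriv
  have hz : IsTrigPoly (d + (d + d)) (fun θ => deriv (deriv p) θ
      * (ε ^ 2 - deriv p θ ^ 2 + v θ ^ 2) - 2 * deriv p θ * v θ * deriv v θ) := by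
    refine IsTrigPoly.sub (tp₂.mul (IsTrigPoly.add (IsTrigPoly.sub
      ((IsTrigPoly.const _).mono (Nat.zero_le _)) ?_) ?_)) ?_
    · simpa [pow_two] using tp₁.mul tp₁
    · simpa [pow_two] using tv.mul tv
    · have := ((tp₁.mul (tv.mul tv₁)).const_mul 2)
      simpa [mul_assoc] using this
  have key := norm_integral_exp_mul_damped_le (ε := ε)
    (fun θ => (tp.differentiable θ).hasDerivAt) (fun θ => (tp₁.differentiable θ).hasDerivAt)
    tp₂.differentiable.continuous (fun θ => (tv.differentiable θ).hasDerivAt)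
    tv₁.differentiable.continuous hε Real.two_pi_pos.le hz.fewZeros
  simp only [← hp₁] at key
  refine key.trans (le_of_eq ?_)
  push_cast
  ring

/-! ### From Fourier decay to small-ball estimates -/

/-- `ν` has dimension-free Fourier decay for polynomials of degree `d`. -/
def FourierDecay (ν : Measure ℝ) (d : ℕ) : Prop :=
  ∃ K : ℝ, 0 < K ∧ ∀ (n : ℕ) (f : MvPolynomial (Fin n) ℝ), f.totalDegree ≤ d → 0 < topSq d f →
    ‖∫ x, Complex.exp (Complex.I * (MvPolynomial.eval x f : ℝ)) ∂Measure.pi (fun _ => ν)‖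
      ≤ K * topSq d f ^ (-(1 / (2 * d) : ℝ))

/-- `ν` has dimension-free small-ball estimates for polynomials of degree `d`. -/
def SmallBall (ν : Measure ℝ) (d : ℕ) : Prop :=
  ∃ K : ℝ, 0 < K ∧ ∀ (n : ℕ) (u : MvPolynomial (Fin n) ℝ), u.totalDegree ≤ d → 0 < topSq d u →
    ∫ x, 1 / (1 + MvPolynomial.eval x u ^ 2) ∂Measure.pi (fun _ => ν)
      ≤ K * topSq d u ^ (-(1 / (2 * d) : ℝ))

lemma norm_cexp_I_mul_ofReal (x : ℝ) : ‖Complex.exp (Complex.I * x)‖ = 1 := by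
  rw [mul_comm, Complex.norm_exp_ofReal_mul_I]

section

variable {Ω : Type*} [MeasurableSpace Ω] (μ : Measure Ω) [IsProbabilityMeasure μ]
  {u : Ω → ℝ}

lemma norm_integral_cexp_le_one (u : Ω → ℝ) :
    ‖∫ x, Complex.exp (Complex.I * u x) ∂μ‖ ≤ 1 := by
  refine (norm_integral_le_of_norm_le_const (C := 1)
    (Filter.Eventually.of_forall fun x => (norm_cexp_I_mul_ofReal _).le)).trans ?_
  simp

lemma integrable_cexp_I_mul (hu : Measurable u) :
    Integrable (fun x => Complex.exp (Complex.I * u x)) μ :=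
  Integrable.of_bound (by fun_prop) 1
    (Filter.Eventually.of_forall fun x => (norm_cexp_I_mul_ofReal _).le)

lemma integrable_one_div_one_add_sq (hu : Measurable u) :
    Integrable (fun x => 1 / (1 + u x ^ 2)) μ :=
  Integrable.of_bound (Measurable.aestronglyMeasurable (by fun_prop)) 1
    (Filter.Eventually.of_forall fun x => by
    rw [Real.norm_eq_abs, abs_of_nonneg (by positivity), div_le_one (by positivity)]
    nlinarith [sq_nonneg (u x)])

lemma integral_one_div_one_add_sq_le (hu : Measurable u) :
    ∫ x, 1 / (1 + u x ^ 2) ∂μ ≤ ∫ s in Set.Ioi (0 : ℝ),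
      Real.exp (-s) * ‖∫ x, Complex.exp (Complex.I * (s * u x : ℝ)) ∂μ‖ := by
  have hre : ∀ a : ℝ, (-1 + Complex.I * a).re < 0 := fun a => by simp
  have hne : ∀ a : ℝ, (-1 + Complex.I * a) ≠ 0 := fun a h => by
    have := hre a
    rw [h] at this
    simp at this
  have h1 : ∀ x, 1 / (1 + u x ^ 2)
      = (∫ s in Set.Ioi (0 : ℝ), Complex.exp ((-1 + Complex.I * u x) * s)).re := fun x => by
    rw [integral_exp_mul_complex_Ioi (hre _)]
    simp only [Complex.ofReal_zero, mul_zero, Complex.exp_zero]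
    rw [Complex.div_re]
    simp [Complex.normSq_apply]
    ring
  have hnorm : ∀ (a s : ℝ), ‖Complex.exp ((-1 + Complex.I * a) * s)‖ = Real.exp (-s) :=
    fun a s => by
      rw [Complex.norm_exp]
      simp
  have hInt : Integrable (Function.uncurry fun (x : Ω) (s : ℝ) =>
      Complex.exp ((-1 + Complex.I * u x) * s)) (μ.prod (volume.restrict (Set.Ioi 0))) := by
    have h2 : Integrable (fun z : Ω × ℝ => (1 : ℝ) * Real.exp (-z.2))
        (μ.prod (volume.restrict (Set.Ioi 0))) :=
      (integrable_const (1 : ℝ)).mul_prod (integrableOn_exp_neg_Ioi 0)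
    refine h2.mono' ?_ (Filter.Eventually.of_forall fun z => ?_)
    · simp only [Function.uncurry_def]
      exact Measurable.aestronglyMeasurable (by fun_prop)
    · simp only [Function.uncurry_def, hnorm, one_mul, le_refl]
  have hG : Integrable (fun x => ∫ s in Set.Ioi (0 : ℝ),
      Complex.exp ((-1 + Complex.I * u x) * s)) μ := hInt.integral_prod_left
  calc ∫ x, 1 / (1 + u x ^ 2) ∂μ
      = (∫ x, (∫ s in Set.Ioi (0 : ℝ), Complex.exp ((-1 + Complex.I * u x) * s)) ∂μ).re := by
        simp_rw [h1]
        exact integral_re hG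
    _ ≤ ‖∫ x, (∫ s in Set.Ioi (0 : ℝ), Complex.exp ((-1 + Complex.I * u x) * s)) ∂μ‖ :=
        Complex.re_le_norm _
    _ = ‖∫ s in Set.Ioi (0 : ℝ), ∫ x, Complex.exp ((-1 + Complex.I * u x) * s) ∂μ‖ := by
        rw [integral_integral_swap hInt]
    _ ≤ ∫ s in Set.Ioi (0 : ℝ), ‖∫ x, Complex.exp ((-1 + Complex.I * u x) * s) ∂μ‖ :=
        norm_integral_le_integral_norm _
    _ = _ := by
        congr 1
        funext s
        have : ∀ x, Complex.exp ((-1 + Complex.I * u x) * s)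
            = (Real.exp (-s) : ℂ) * Complex.exp (Complex.I * (s * u x : ℝ)) := fun x => by
          rw [Complex.ofReal_exp, ← Complex.exp_add]
          push_cast
          ring_nf
        simp_rw [this]
        rw [integral_const_mul, norm_mul, Complex.norm_real, Real.norm_eq_abs,
          abs_of_pos (Real.exp_pos _)]

lemma integral_one_div_one_add_sq_le_of_decay (hu : Measurable u) {K α : ℝ} (hα : α < 1)
    (h : ∀ s : ℝ, 0 < s → ‖∫ x, Complex.exp (Complex.I * (s * u x : ℝ)) ∂μ‖ ≤ K * s ^ (-α)) :
    ∫ x, 1 / (1 + u x ^ 2) ∂μ ≤ K * Real.Gamma (1 - α) := by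
  refine (integral_one_div_one_add_sq_le μ hu).trans ?_
  rw [Real.Gamma_eq_integral (by linarith), ← integral_const_mul]
  have hconv := Real.GammaIntegral_convergent (s := 1 - α) (by linarith)
  refine integral_mono_of_nonneg (Filter.Eventually.of_forall fun s => by positivity)
    (hconv.const_mul K) ?_
  filter_upwards [self_mem_ae_restrict measurableSet_Ioi] with s hs
  have h1 := mul_le_mul_of_nonneg_left (h s hs) (Real.exp_pos (-s)).le
  refine h1.trans (le_of_eq ?_)
  rw [show (1 - α - 1) = -α by ring]
  ring

end

lemma measurable_eval_mvPolynomial {n : ℕ} (f : MvPolynomial (Fin n) ℝ) :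
    Measurable (fun x : Fin n → ℝ => MvPolynomial.eval x f) :=
  (MvPolynomial.continuous_eval f).measurable

lemma totalDegree_C_mul_le {n : ℕ} (c : ℝ) (f : MvPolynomial (Fin n) ℝ) :
    (MvPolynomial.C c * f).totalDegree ≤ f.totalDegree := by
  refine (MvPolynomial.totalDegree_mul _ _).trans ?_
  simp

theorem FourierDecay.smallBall {ν : Measure ℝ} [IsProbabilityMeasure ν] {d : ℕ} (hd : 2 ≤ d)
    (h : FourierDecay ν d) : SmallBall ν d := by
  obtain ⟨K, hK, h⟩ := h
  have hd' : (2 : ℝ) ≤ d := by exact_mod_cast hd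
  have hα : (1 / d : ℝ) < 1 := by
    rw [div_lt_one (by linarith)]
    linarith
  refine ⟨K * Real.Gamma (1 - 1 / d), mul_pos hK (Real.Gamma_pos_of_pos (by linarith)),
    fun n u hu hT => ?_⟩
  refine (integral_one_div_one_add_sq_le_of_decay _ (measurable_eval_mvPolynomial u) hα
    (K := K * topSq d u ^ (-(1 / (2 * d) : ℝ))) fun s hs => ?_).trans (le_of_eq (by ring))
  have := h n (MvPolynomial.C s * u) ((totalDegree_C_mul_le _ _).trans hu)
    (by rw [topSq_C_mul]; positivity)
  simp only [map_mul, MvPolynomial.eval_C] at this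
  refine this.trans (le_of_eq ?_)
  rw [topSq_C_mul, Real.mul_rpow (by positivity) hT.le, ← Real.rpow_natCast s 2,
    ← Real.rpow_mul hs.le]
  have : ((2 : ℕ) : ℝ) * -(1 / (2 * d) : ℝ) = -(1 / d) := by
    push_cast
    field_simp
  rw [this]
  ring

/-! ### Integrating out one coordinate -/

lemma measurePreserving_update {n : ℕ} (ν : Measure ℝ) [IsProbabilityMeasure ν] (i : Fin n) :
    MeasurePreserving (fun z : (Fin n → ℝ) × ℝ => Function.update z.1 i z.2)
      ((Measure.pi fun _ => ν).prod ν) (Measure.pi fun _ => ν) := by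
  have hm : Measurable (fun z : (Fin n → ℝ) × ℝ => Function.update z.1 i z.2) := by
    rw [measurable_pi_iff]
    intro j
    by_cases h : j = i
    · subst h
      simpa using measurable_snd
    · simp only [Function.update_of_ne h]
      exact (measurable_pi_apply j).comp measurable_fst
  refine ⟨hm, (Measure.pi_eq fun s hs => ?_).symm⟩
  rw [Measure.map_apply hm (MeasurableSet.univ_pi hs)]
  have : (fun z : (Fin n → ℝ) × ℝ => Function.update z.1 i z.2) ⁻¹' Set.univ.pi s
      = (Set.univ.pi (Function.update s i Set.univ)) ×ˢ s i := by
    ext z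
    simp only [Set.mem_preimage, Set.mem_pi, Set.mem_univ, true_implies, Set.mem_prod]
    constructor
    · intro h
      refine ⟨fun j => ?_, by simpa using h i⟩
      by_cases hj : j = i
      · subst hj; simp
      · simpa [Function.update_of_ne hj] using h j
    · rintro ⟨h1, h2⟩ j
      by_cases hj : j = i
      · subst hj; simpa using h2
      · simpa [Function.update_of_ne hj] using h1 j
  rw [this, Measure.prod_prod, Measure.pi_pi, ← Finset.mul_prod_erase _ _ (Finset.mem_univ i),
    ← Finset.mul_prod_erase Finset.univ (fun j => ν (s j)) (Finset.mem_univ i)]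
  simp only [Function.update_self, measure_univ, one_mul]
  rw [mul_comm]
  congr 1
  refine Finset.prod_congr rfl fun j hj => ?_
  rw [Function.update_of_ne (Finset.ne_of_mem_erase hj)]

lemma norm_integral_pi_le_of_slice {n : ℕ} (ν : Measure ℝ) [IsProbabilityMeasure ν] (i : Fin n)
    {E : Type*} [NormedAddCommGroup E] [NormedSpace ℝ E] {F : (Fin n → ℝ) → E}
    (hF : Integrable F (Measure.pi fun _ => ν)) {K : ℝ}
    (h : ∀ x, ‖∫ y, F (Function.update x i y) ∂ν‖ ≤ K) :
    ‖∫ x, F x ∂Measure.pi (fun _ => ν)‖ ≤ K := by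
  have hmp := measurePreserving_update ν i
  have hInt : Integrable (fun z : (Fin n → ℝ) × ℝ => F (Function.update z.1 i z.2))
      ((Measure.pi fun _ => ν).prod ν) := hmp.integrable_comp_of_integrable hF
  have : ∫ x, F x ∂Measure.pi (fun _ => ν)
      = ∫ x, ∫ y, F (Function.update x i y) ∂ν ∂Measure.pi (fun _ => ν) := by
    rw [← integral_prod _ hInt, ← hmp.map_eq, integral_map hmp.measurable.aemeasurable]
    · rw [hmp.map_eq]
    · rw [hmp.map_eq]; exact hF.aestronglyMeasurable
  rw [this]
  refine (norm_integral_le_of_norm_le_const (Filter.Eventually.of_forall h)).trans ?_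
  simp

/-! ### Polynomials of degree one -/

lemma eval_of_totalDegree_le_one {n : ℕ} {f : MvPolynomial (Fin n) ℝ} (hf : f.totalDegree ≤ 1)
    (x : Fin n → ℝ) : MvPolynomial.eval x f = MvPolynomial.coeff 0 f
      + ∑ i, MvPolynomial.coeff (Finsupp.single i 1) f * x i := by
  classical
  have : f = MvPolynomial.C (MvPolynomial.coeff 0 f) + ∑ i,
      MvPolynomial.C (MvPolynomial.coeff (Finsupp.single i 1) f) * MvPolynomial.X i := by
    ext I
    rw [MvPolynomial.coeff_add, MvPolynomial.coeff_sum, MvPolynomial.coeff_C]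
    simp only [MvPolynomial.coeff_C_mul, MvPolynomial.coeff_X]
    by_cases h0 : I = 0
    · subst h0
      have : ∀ i : Fin n, (Finsupp.single i 1 : Fin n →₀ ℕ) ≠ 0 := fun i => by simp
      simp [this]
    by_cases h1 : ∃ i, Finsupp.single i 1 = I
    · obtain ⟨i, rfl⟩ := h1
      rw [if_neg (Ne.symm h0), zero_add, Finset.sum_eq_single i]
      · simp
      · intro j _ hj
        simp [Finsupp.single_left_inj, hj]
      · simp
    · have hdeg : 1 < I.degree := by
        by_contra! hle
        rcases Nat.le_one_iff_eq_zero_or_eq_one.1 hle with h | h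
        · exact h0 ((Finsupp.degree_eq_zero_iff I).1 h)
        · have : I ∈ Set.range fun a : Fin n => (Finsupp.single a 1 : Fin n →₀ ℕ) := by
            rw [Finsupp.range_single_one]; exact h
          exact h1 this
      rw [MvPolynomial.coeff_eq_zero_of_totalDegree_lt (lt_of_le_of_lt hf hdeg),
        if_neg (Ne.symm h0), zero_add]
      push Not at h1
      simp [h1]
  conv_lhs => rw [this]
  simp

lemma topSq_one {n : ℕ} (f : MvPolynomial (Fin n) ℝ) :
    topSq 1 f = ∑ i, MvPolynomial.coeff (Finsupp.single i 1) f ^ 2 := by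
  symm
  refine Finset.sum_of_injOn (fun i => Finsupp.single i 1) ?_ ?_ ?_ ?_
  · intro i _ j _ h
    exact (Finsupp.single_left_inj one_ne_zero).1 h
  · intro i _
    exact mem_topExp.2 (by simp [Finsupp.degree_single])
  · intro I hI hI'
    have : I ∈ Set.range fun a : Fin n => (Finsupp.single a 1 : Fin n →₀ ℕ) := by
      rw [Finsupp.range_single_one]; exact mem_topExp.1 hI
    obtain ⟨i, rfl⟩ := this
    exact absurd ⟨i, by simp⟩ hI'
  · intro i _; rfl

/-! ### The uniform measure on `[-1, 1]` -/

/-- The uniform probability measure on `[-1, 1]`. -/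
def unifMeasure : Measure ℝ := (2⁻¹ : ENNReal) • volume.restrict (Set.Icc (-1) 1)

instance : IsProbabilityMeasure unifMeasure := ⟨by
  rw [unifMeasure, Measure.smul_apply, Measure.restrict_apply_univ, Real.volume_Icc]
  norm_num
  exact ENNReal.inv_mul_cancel (by norm_num) (by norm_num)⟩

lemma integral_unifMeasure {E : Type*} [NormedAddCommGroup E] [NormedSpace ℝ E] (g : ℝ → E) :
    ∫ y, g y ∂unifMeasure = (1 / 2 : ℝ) • ∫ y in (-1 : ℝ)..1, g y := by
  rw [unifMeasure, integral_smul_measure, intervalIntegral.integral_of_le (by norm_num),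
    integral_Icc_eq_integral_Ioc]
  norm_num

lemma norm_charFun_unifMeasure_sq_le (τ : ℝ) :
    ‖∫ y, Complex.exp (Complex.I * (τ * y : ℝ)) ∂unifMeasure‖ ^ 2 ≤ 1 / (1 + 1 / 4 * τ ^ 2) := by
  rcases eq_or_ne τ 0 with rfl | hτ
  · simp
  have hne : Complex.I * τ ≠ 0 := mul_ne_zero Complex.I_ne_zero (Complex.ofReal_ne_zero.2 hτ)
  have h1 : ∫ y, Complex.exp (Complex.I * (τ * y : ℝ)) ∂unifMeasure
      = ((Real.sin τ / τ : ℝ) : ℂ) := by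
    rw [integral_unifMeasure]
    have : ∀ y : ℝ, Complex.exp (Complex.I * (τ * y : ℝ)) = Complex.exp (Complex.I * τ * y) :=
      fun y => by push_cast; ring_nf
    simp_rw [this]
    rw [integral_exp_mul_complex hne]
    have e1 : Complex.exp (Complex.I * τ * (1 : ℝ)) = Complex.cos τ + Complex.sin τ * Complex.I := by
      rw [← Complex.exp_mul_I]; push_cast; ring_nf
    have e2 : Complex.exp (Complex.I * τ * (-1 : ℝ))
        = Complex.cos τ - Complex.sin τ * Complex.I := by
      rw [show Complex.I * τ * ((-1 : ℝ) : ℂ) = (-(τ : ℂ)) * Complex.I by push_cast; ring,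
        Complex.exp_mul_I, Complex.cos_neg, Complex.sin_neg]
      ring
    rw [e1, e2, Complex.real_smul]
    have hτ' : (τ : ℂ) ≠ 0 := Complex.ofReal_ne_zero.2 hτ
    have hI := Complex.I_ne_zero
    push_cast
    field_simp
    ring
  rw [h1, Complex.norm_real, Real.norm_eq_abs, sq_abs, div_pow,
    div_le_div_iff₀ (by positivity) (by positivity), one_mul]
  rcases le_or_gt (τ ^ 2) 2 with h | h
  · have hc : 1 - τ ^ 2 / 2 ≤ Real.cos τ := Real.one_sub_sq_div_two_le_cos
    have hs : Real.sin τ ^ 2 ≤ τ ^ 2 - τ ^ 4 / 4 := by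
      rw [Real.sin_sq]
      nlinarith
    have : Real.sin τ ^ 2 * (1 + 1 / 4 * τ ^ 2) ≤ (τ ^ 2 - τ ^ 4 / 4) * (1 + 1 / 4 * τ ^ 2) :=
      mul_le_mul_of_nonneg_right hs (by positivity)
    nlinarith [pow_nonneg (sq_nonneg τ) 3]
  · have : Real.sin τ ^ 2 * (1 + 1 / 4 * τ ^ 2) ≤ 1 * (1 + 1 / 4 * τ ^ 2) :=
      mul_le_mul_of_nonneg_right (Real.sin_sq_le_one τ) (by positivity)
    linarith

lemma one_add_sum_le_prod {ι : Type*} (s : Finset ι) (x : ι → ℝ) (hx : ∀ i ∈ s, 0 ≤ x i) :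
    1 + ∑ i ∈ s, x i + ((∑ i ∈ s, x i) ^ 2 - ∑ i ∈ s, x i ^ 2) / 2 ≤ ∏ i ∈ s, (1 + x i) := by
  classical
  induction s using Finset.induction_on with
  | empty => simp
  | insert i s hi ih =>
    rw [Finset.sum_insert hi, Finset.prod_insert hi, Finset.sum_insert hi]
    have hxi := hx i (Finset.mem_insert_self _ _)
    have hx' : ∀ j ∈ s, 0 ≤ x j := fun j hj => hx j (Finset.mem_insert_of_mem hj)
    have h := ih hx'
    have hsq : ∑ j ∈ s, x j ^ 2 ≤ (∑ j ∈ s, x j) ^ 2 :=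
      Finset.sum_sq_le_sq_sum_of_nonneg hx'
    have := mul_le_mul_of_nonneg_left h (by linarith : 0 ≤ 1 + x i)
    nlinarith

lemma norm_integral_cexp_affine {n : ℕ} (ν : Measure ℝ) [IsProbabilityMeasure ν] (c : ℝ)
    (a : Fin n → ℝ) :
    ‖∫ x, Complex.exp (Complex.I * (c + ∑ i, a i * x i : ℝ)) ∂Measure.pi (fun _ => ν)‖
      = ∏ i, ‖∫ y, Complex.exp (Complex.I * (a i * y : ℝ)) ∂ν‖ := by
  have : ∀ x : Fin n → ℝ, Complex.exp (Complex.I * (c + ∑ i, a i * x i : ℝ))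
      = Complex.exp (Complex.I * c) * ∏ i, Complex.exp (Complex.I * (a i * x i : ℝ)) := fun x => by
    rw [← Complex.exp_sum, ← Complex.exp_add]
    push_cast
    rw [mul_add, Finset.mul_sum]
  simp_rw [this]
  rw [integral_const_mul, norm_mul, norm_cexp_I_mul_ofReal, one_mul,
    integral_fintype_prod_eq_prod (fun i (y : ℝ) => Complex.exp (Complex.I * (a i * y : ℝ))),
    norm_prod]

lemma norm_integral_cexp_affine_unif_sq_le {n : ℕ} (c : ℝ) (a : Fin n → ℝ) :
    ‖∫ x, Complex.exp (Complex.I * (c + ∑ i, a i * x i : ℝ))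
        ∂Measure.pi (fun _ => unifMeasure)‖ ^ 2 ≤ (∏ i, (1 + 1 / 4 * a i ^ 2))⁻¹ := by
  rw [norm_integral_cexp_affine, ← Finset.prod_pow, ← Finset.prod_inv_distrib]
  refine Finset.prod_le_prod (fun _ _ => sq_nonneg _) fun i _ => ?_
  simpa using norm_charFun_unifMeasure_sq_le (a i)

theorem fourierDecay_unifMeasure_one : FourierDecay unifMeasure 1 := by
  refine ⟨2, by norm_num, fun n f hf hT => ?_⟩
  simp_rw [eval_of_totalDegree_le_one hf]
  have h := norm_integral_cexp_affine_unif_sq_le (MvPolynomial.coeff 0 f)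
    (fun i => MvPolynomial.coeff (Finsupp.single i 1) f)
  have h2 := one_add_sum_le_prod Finset.univ
    (fun i => 1 / 4 * MvPolynomial.coeff (Finsupp.single i 1) f ^ 2) fun _ _ => by positivity
  have hsq := Finset.sum_sq_le_sq_sum_of_nonneg (s := Finset.univ)
    (f := fun i : Fin n => 1 / 4 * MvPolynomial.coeff (Finsupp.single i 1) f ^ 2)
    fun _ _ => by positivity
  rw [← Finset.mul_sum, ← topSq_one] at h2 hsq
  have h3 : (topSq 1 f)/4 ≤ ∏ i : Fin n, (1 + 1 / 4 * MvPolynomial.coeff (Finsupp.single i 1) f ^ 2) := by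
    linarith
  have h4 := h.trans (inv_anti₀ (by positivity) h3)
  have e : topSq 1 f ^ (-(1 / (2 * (1 : ℕ))) : ℝ) = (Real.sqrt (topSq 1 f))⁻¹ := by
    rw [Real.rpow_neg hT.le, Real.sqrt_eq_rpow]
    norm_num
  rw [e]
  refine abs_le_of_sq_le_sq' (h4.trans (le_of_eq ?_)) (by positivity) |>.2
  rw [mul_pow, inv_pow, Real.sq_sqrt hT.le]
  field_simp
  norm_num

lemma integral_one_div_one_add_sq_affine_le {a : ℝ} (ha : a ≠ 0) (c l r : ℝ) :
    ∫ y in l..r, 1 / (1 + (a * y + c) ^ 2) ≤ Real.pi / |a| := by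
  rw [intervalIntegral.integral_comp_mul_add (fun x => 1 / (1 + x ^ 2)) ha,
    integral_one_div_one_add_sq, smul_eq_mul]
  refine (le_abs_self _).trans ?_
  rw [abs_mul, abs_inv, inv_mul_eq_div]
  gcongr
  have h1 := Real.arctan_lt_pi_div_two (a * r + c)
  have h2 := Real.neg_pi_div_two_lt_arctan (a * r + c)
  have h3 := Real.arctan_lt_pi_div_two (a * l + c)
  have h4 := Real.neg_pi_div_two_lt_arctan (a * l + c)
  rw [abs_le]
  constructor <;> linarith

lemma integral_exp_neg_mul_inv_le {b : ℝ} (hb : 0 < b) {g : ℝ → ℝ}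
    (hg0 : ∀ s, 0 ≤ g s) (hg : ∀ s, g s ≤ (1 + (b * s) ^ 2)⁻¹) :
    ∫ s in Set.Ioi (0 : ℝ), Real.exp (-s) * g s ≤ Real.pi / 2 / b := by
  have h1 : ∫ s in Set.Ioi (0 : ℝ), (1 + (b * s) ^ 2)⁻¹ = Real.pi / 2 / b := by
    rw [integral_comp_mul_left_Ioi (fun x => (1 + x ^ 2)⁻¹) 0 hb, mul_zero,
      integral_Ioi_inv_one_add_sq]
    simp
    ring
  rw [← h1]
  have hi : Integrable (fun s : ℝ => (1 + (b * s) ^ 2)⁻¹) :=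
    integrable_inv_one_add_sq.comp_mul_left' hb.ne'
  refine integral_mono_of_nonneg (Filter.Eventually.of_forall fun s =>
    mul_nonneg (Real.exp_pos _).le (hg0 s)) hi.integrableOn ?_
  filter_upwards [self_mem_ae_restrict measurableSet_Ioi] with s hs
  have : Real.exp (-s) ≤ 1 := Real.exp_le_one_iff.2 (by simpa using hs.le)
  calc Real.exp (-s) * g s ≤ 1 * g s := mul_le_mul_of_nonneg_right this (hg0 s)
    _ ≤ _ := by rw [one_mul]; exact hg s

theorem smallBall_unifMeasure_one : SmallBall unifMeasure 1 := by
  refine ⟨2 * Real.pi, by positivity, fun n u hu hT => ?_⟩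
  set a : Fin n → ℝ := fun i => MvPolynomial.coeff (Finsupp.single i 1) u with ha
  set T := topSq 1 u with hTdef
  have hTa : T = ∑ i, a i ^ 2 := topSq_one u
  have hev := eval_of_totalDegree_le_one hu
  have e : T ^ (-(1 / (2 * (1 : ℕ))) : ℝ) = (Real.sqrt T)⁻¹ := by
    rw [Real.rpow_neg hT.le, Real.sqrt_eq_rpow]
    norm_num
  have hsT : 0 < Real.sqrt T := Real.sqrt_pos.2 hT
  rw [e]
  by_cases hbig : ∃ i, T / 2 ≤ a i ^ 2
  · obtain ⟨i, hi⟩ := hbig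
    have hai : a i ≠ 0 := fun h => by rw [h] at hi; norm_num at hi; linarith
    have hsl := norm_integral_pi_le_of_slice unifMeasure i
      (integrable_one_div_one_add_sq _ (measurable_eval_mvPolynomial u))
      (K := 1 / 2 * (Real.pi / |a i|)) fun x => by
        have hx : ∀ y, MvPolynomial.eval (Function.update x i y) u
            = a i * y + (MvPolynomial.coeff 0 u + ∑ j ∈ Finset.univ.erase i, a j * x j) :=
          fun y => by
          rw [hev, ← Finset.add_sum_erase _ _ (Finset.mem_univ i), Function.update_self]
          have : ∑ j ∈ Finset.univ.erase i, a j * Function.update x i y j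
              = ∑ j ∈ Finset.univ.erase i, a j * x j :=
            Finset.sum_congr rfl fun j hj => by
              rw [Function.update_of_ne (Finset.ne_of_mem_erase hj)]
          rw [this]
          ring
        simp_rw [hx]
        rw [integral_unifMeasure, Real.norm_eq_abs, abs_of_nonneg, smul_eq_mul]
        · gcongr
          exact integral_one_div_one_add_sq_affine_le hai _ _ _
        · refine smul_nonneg (by norm_num) (intervalIntegral.integral_nonneg (by norm_num) ?_)
          intro y _
          positivity
    refine (le_abs_self _).trans (hsl.trans ?_)
    have : Real.sqrt T ≤ 2 * |a i| := by
      rw [Real.sqrt_le_left (by positivity), mul_pow, sq_abs]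
      linarith
    rw [← div_eq_mul_inv, ← mul_div_assoc, div_le_div_iff₀ (abs_pos.2 hai) hsT]
    nlinarith [Real.pi_pos, abs_nonneg (a i), mul_le_mul_of_nonneg_left this Real.pi_pos.le]
  · push Not at hbig
    refine (integral_one_div_one_add_sq_le _ (measurable_eval_mvPolynomial u)).trans ?_
    have hb : 0 < Real.sqrt T / Real.sqrt 8 := by positivity
    refine (integral_exp_neg_mul_inv_le hb (fun s => norm_nonneg _) fun s => ?_).trans ?_
    · have h1 := norm_integral_cexp_affine_unif_sq_le (s * MvPolynomial.coeff 0 u)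
        (fun i => s * a i)
      have h2 := one_add_sum_le_prod Finset.univ
        (fun i => 1 / 4 * (s * a i) ^ 2) fun _ _ => by positivity
      have hS : ∑ i, 1 / 4 * (s * a i) ^ 2 = s ^ 2 * T / 4 := by
        rw [hTa, mul_div_assoc, Finset.sum_div, Finset.mul_sum]
        exact Finset.sum_congr rfl fun i _ => by ring
      have hS2 : ∑ i, (1 / 4 * (s * a i) ^ 2) ^ 2 ≤ (s ^ 2 * T / 4) ^ 2 / 2 := by
        calc ∑ i, (1 / 4 * (s * a i) ^ 2) ^ 2
            ≤ ∑ i, (s ^ 2 * T / 8) * (1 / 4 * (s * a i) ^ 2) := by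
              refine Finset.sum_le_sum fun i _ => ?_
              rw [sq (1 / 4 * (s * a i) ^ 2)]
              refine mul_le_mul_of_nonneg_right ?_ (by positivity)
              rw [mul_pow]
              nlinarith [hbig i, sq_nonneg s]
          _ = (s ^ 2 * T / 4) ^ 2 / 2 := by rw [← Finset.mul_sum, hS]; ring
      rw [hS] at h2
      have h3 : (1 + s ^ 2 * T / 8) ^ 2 ≤ ∏ i, (1 + 1 / 4 * (s * a i) ^ 2) := by nlinarith
      have h4 := h1.trans (inv_anti₀ (by positivity) h3)
      have hb2 : (Real.sqrt T / Real.sqrt 8 * s) ^ 2 = s ^ 2 * T / 8 := by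
        rw [mul_pow, div_pow, Real.sq_sqrt hT.le, Real.sq_sqrt (by norm_num)]
        ring
      rw [hb2]
      have hfun : ∀ x, s * MvPolynomial.eval x u
          = s * MvPolynomial.coeff 0 u + ∑ i, s * a i * x i := fun x => by
        rw [hev, mul_add, Finset.mul_sum]
        simp only [ha, mul_assoc]
      simp_rw [hfun]
      rw [← inv_pow] at h4
      exact abs_le_of_sq_le_sq' h4 (by positivity) |>.2
    · rw [div_div_eq_mul_div, div_eq_mul_inv _ (Real.sqrt T)]
      refine mul_le_mul_of_nonneg_right ?_ (by positivity)
      have : Real.sqrt 8 ≤ 4 := by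
        rw [Real.sqrt_le_left (by norm_num)]; norm_num
      nlinarith [Real.pi_pos]

/-! ### One-dimensional van der Corput estimates -/

open Polynomial in
lemma fewZeros_eval (p : ℝ[X]) {N : ℕ} (hp : p.natDegree ≤ N) (a b : ℝ) :
    FewZeros N a b (fun x => p.eval x) := by
  classical
  rcases eq_or_ne p 0 with rfl | h
  · exact Or.inl fun x _ => by simp
  · refine Or.inr ⟨p.roots.toFinset, ?_, fun x _ hx => ?_⟩
    · exact (Multiset.toFinset_card_le _).trans ((Polynomial.card_roots' p).trans hp)
    · simpa [h] using hx

/-- Dimension-one oscillatory integral estimate for polynomial phases of degree `d`. -/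
def VanDerCorput (d : ℕ) : Prop :=
  ∃ K : ℝ, 0 < K ∧ ∀ p : Polynomial ℝ, p.natDegree ≤ d → p.coeff d ≠ 0 →
    ‖∫ y, Complex.exp (Complex.I * (p.eval y : ℝ)) ∂unifMeasure‖
      ≤ K * |p.coeff d| ^ (-(1 / d : ℝ))

lemma vanDerCorput_one : VanDerCorput 1 := by
  refine ⟨2, by norm_num, fun p hp ha => ?_⟩
  have he : ∀ y : ℝ, p.eval y = p.coeff 1 * y + p.coeff 0 := fun y => by
    rw [Polynomial.eval_eq_sum_range' (Nat.lt_succ_of_le hp)]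
    simp [Finset.sum_range_succ]
    ring
  set a := p.coeff 1
  have h1 : ∀ y : ℝ, Complex.exp (Complex.I * (p.eval y : ℝ))
      = Complex.exp (Complex.I * (p.coeff 0 : ℝ)) * Complex.exp (Complex.I * (a * y : ℝ)) :=
    fun y => by
      rw [he, ← Complex.exp_add]
      push_cast
      ring_nf
  simp_rw [h1]
  rw [integral_const_mul, norm_mul, norm_cexp_I_mul_ofReal, one_mul]
  have h2 := norm_charFun_unifMeasure_sq_le a
  have ha' : 0 < |a| := abs_pos.2 ha
  have e : |a| ^ (-(1 / (1 : ℕ)) : ℝ) = |a|⁻¹ := by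
    rw [← Real.rpow_neg_one]
    norm_num
  rw [e]
  refine abs_le_of_sq_le_sq' (h2.trans ?_) (by positivity) |>.2
  have : 0 < a ^ 2 := by positivity
  rw [mul_pow, inv_pow, sq_abs, ← div_eq_mul_inv, div_le_div_iff₀ (by positivity) this]
  linarith

lemma VanDerCorput.smallBall {d : ℕ} (hd : 1 ≤ d) (h : VanDerCorput d) :
    ∃ K : ℝ, 0 < K ∧ ∀ p : Polynomial ℝ, p.natDegree ≤ d → p.coeff d ≠ 0 →
      ∫ y, 1 / (1 + p.eval y ^ 2) ∂unifMeasure ≤ K * |p.coeff d| ^ (-(1 / d : ℝ)) := by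
  rcases hd.eq_or_lt with rfl | hd
  · refine ⟨Real.pi, Real.pi_pos, fun p hp ha => ?_⟩
    have he : ∀ y : ℝ, p.eval y = p.coeff 1 * y + p.coeff 0 := fun y => by
      rw [Polynomial.eval_eq_sum_range' (Nat.lt_succ_of_le hp)]
      simp [Finset.sum_range_succ]
      ring
    have e : |p.coeff 1| ^ (-(1 / (1 : ℕ)) : ℝ) = |p.coeff 1|⁻¹ := by
      rw [← Real.rpow_neg_one]
      norm_num
    rw [integral_unifMeasure, e]
    simp_rw [he]
    have := integral_one_div_one_add_sq_affine_le ha (p.coeff 0) (-1) 1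
    rw [smul_eq_mul, ← div_eq_mul_inv]
    have : 0 ≤ Real.pi / |p.coeff 1| := by positivity
    linarith
  · obtain ⟨K, hK, hb⟩ := h
    have hd' : (1 : ℝ) < d := by exact_mod_cast hd
    have hα : (1 / d : ℝ) < 1 := by rw [div_lt_one (by linarith)]; exact hd'
    refine ⟨K * Real.Gamma (1 - 1 / d), mul_pos hK (Real.Gamma_pos_of_pos (by linarith)),
      fun p hp ha => ?_⟩
    have := integral_one_div_one_add_sq_le_of_decay unifMeasure (u := fun y => p.eval y)
      (K := K * |p.coeff d| ^ (-(1 / d : ℝ))) (α := 1 / d)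
      p.continuous.measurable hα fun s hs => ?_
    · refine this.trans (le_of_eq (by ring))
    · have := hb (Polynomial.C s * p) ((Polynomial.natDegree_C_mul_le _ _).trans hp)
        (by simpa using ⟨hs.ne', ha⟩)
      simp only [Polynomial.eval_mul, Polynomial.eval_C, Polynomial.coeff_C_mul, abs_mul,
        abs_of_pos hs] at this
      rw [Real.mul_rpow hs.le (abs_nonneg _)] at this
      refine this.trans (le_of_eq (by ring))

lemma VanDerCorput.succ {d : ℕ} (hd : 1 ≤ d) (h : VanDerCorput d) : VanDerCorput (d + 1) := by
  obtain ⟨K, hK, hb⟩ := h.smallBall hd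
  refine ⟨(3 * d + 2) + K, by positivity, fun p hp ha => ?_⟩
  set a := p.coeff (d + 1) with hadef
  have ha' : 0 < |a| := abs_pos.2 ha
  have hd0 : (0 : ℝ) < d := by exact_mod_cast hd
  set ε : ℝ := |a| ^ (1 / (d + 1) : ℝ) with hε
  have hε0 : 0 < ε := by positivity
  set q := Polynomial.derivative p with hq
  have hqd : q.natDegree ≤ d := (Polynomial.natDegree_derivative_le p).trans (by omega)
  have hqc : q.coeff d = a * (d + 1) := by rw [hq, Polynomial.coeff_derivative]
  have hsb := hb (Polynomial.C ε⁻¹ * q) ((Polynomial.natDegree_C_mul_le _ _).trans hqd)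
    (by rw [Polynomial.coeff_C_mul, hqc]; positivity)
  have hosc := norm_integral_exp_mul_damped_le (p := fun x => p.eval x) (p₁ := fun x => q.eval x)
    (p₂ := fun x => (Polynomial.derivative q).eval x) (v := fun _ => 0) (v₁ := fun _ => 0)
    (ε := ε) (a := -1) (b := 1) (N := 3 * d) (fun x => p.hasDerivAt x) (fun x => q.hasDerivAt x)
    (Polynomial.continuous _) (fun x => hasDerivAt_const x _) continuous_const hε0
    (by norm_num) (by
      have := fewZeros_eval (Polynomial.derivative q * (Polynomial.C (ε ^ 2) - q ^ 2))
        (N := 3 * d) ?_ (-1) 1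
      · simpa using this
      · refine Polynomial.natDegree_mul_le.trans ?_
        have h1 := Polynomial.natDegree_derivative_le q
        have h2 : (Polynomial.C (ε ^ 2) - q ^ 2).natDegree ≤ 2 * d := by
          refine (Polynomial.natDegree_sub_le _ _).trans (max_le (by simp) ?_)
          exact Polynomial.natDegree_pow_le.trans (by gcongr)
        omega)
  have hdec : ∀ x : ℝ, Complex.exp (Complex.I * (p.eval x : ℝ))
      = Complex.exp (Complex.I * (p.eval x : ℝ))
          * ((q.eval x ^ 2 / (ε ^ 2 + q.eval x ^ 2 + 0 ^ 2) : ℝ) : ℂ)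
        + Complex.exp (Complex.I * (p.eval x : ℝ))
          * ((1 / (1 + ((Polynomial.C ε⁻¹ * q).eval x) ^ 2) : ℝ) : ℂ) := fun x => by
    rw [← mul_add, ← Complex.ofReal_add]
    have : q.eval x ^ 2 / (ε ^ 2 + q.eval x ^ 2 + 0 ^ 2)
        + 1 / (1 + ((Polynomial.C ε⁻¹ * q).eval x) ^ 2) = 1 := by
      rw [Polynomial.eval_mul, Polynomial.eval_C]
      have : 0 < ε ^ 2 + q.eval x ^ 2 := by positivity
      field_simp
      ring
    rw [this]
    simp
  have hm1 : Integrable (fun x : ℝ => Complex.exp (Complex.I * (p.eval x : ℝ))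
      * ((q.eval x ^ 2 / (ε ^ 2 + q.eval x ^ 2 + 0 ^ 2) : ℝ) : ℂ)) unifMeasure := by
    refine Integrable.of_bound (Measurable.aestronglyMeasurable (by fun_prop)) 1
      (Filter.Eventually.of_forall fun x => ?_)
    rw [norm_mul, norm_cexp_I_mul_ofReal, one_mul, Complex.norm_real, Real.norm_eq_abs,
      abs_of_nonneg (by positivity)]
    exact div_le_one_of_le₀ (by nlinarith [sq_nonneg ε]) (by positivity)
  have hm2 : Integrable (fun x : ℝ => Complex.exp (Complex.I * (p.eval x : ℝ))
      * ((1 / (1 + ((Polynomial.C ε⁻¹ * q).eval x) ^ 2) : ℝ) : ℂ)) unifMeasure := by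
    refine Integrable.of_bound (Measurable.aestronglyMeasurable (by fun_prop)) 1
      (Filter.Eventually.of_forall fun x => ?_)
    rw [norm_mul, norm_cexp_I_mul_ofReal, one_mul, Complex.norm_real, Real.norm_eq_abs,
      abs_of_nonneg (by positivity)]
    exact div_le_one_of_le₀ (by nlinarith [sq_nonneg ((Polynomial.C ε⁻¹ * q).eval x)])
      (by positivity)
  rw [integral_congr_ae (Filter.Eventually.of_forall hdec), integral_add hm1 hm2]
  have b1 : ‖∫ x, Complex.exp (Complex.I * (p.eval x : ℝ))
      * ((q.eval x ^ 2 / (ε ^ 2 + q.eval x ^ 2 + 0 ^ 2) : ℝ) : ℂ) ∂unifMeasure‖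
      ≤ (3 * d + 2) / ε := by
    rw [integral_unifMeasure, norm_smul]
    push_cast at hosc ⊢
    have h0 : (0 : ℝ) ≤ (3 * d + 2) / ε := by positivity
    norm_num at hosc ⊢
    linarith
  have b2 : ‖∫ x, Complex.exp (Complex.I * (p.eval x : ℝ))
      * ((1 / (1 + ((Polynomial.C ε⁻¹ * q).eval x) ^ 2) : ℝ) : ℂ) ∂unifMeasure‖
      ≤ ∫ x, 1 / (1 + ((Polynomial.C ε⁻¹ * q).eval x) ^ 2) ∂unifMeasure := by
    refine (norm_integral_le_integral_norm _).trans (le_of_eq (integral_congr_ae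
      (Filter.Eventually.of_forall fun x => ?_)))
    simp only [norm_mul, norm_cexp_I_mul_ofReal, one_mul, Complex.norm_real, Real.norm_eq_abs]
    rw [abs_of_nonneg (by positivity)]
  have e1 : (3 * d + 2) / ε = (3 * d + 2) * |a| ^ (-(1 / ((d + 1 : ℕ) : ℝ))) := by
    rw [hε, Real.rpow_neg (abs_nonneg _), div_eq_mul_inv]
    push_cast
    rfl
  have e2 : |(Polynomial.C ε⁻¹ * q).coeff d| ^ (-(1 / d : ℝ))
      ≤ |a| ^ (-(1 / ((d + 1 : ℕ) : ℝ))) := by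
    have h1 : |a| ^ (1 - 1 / (d + 1) : ℝ) ≤ |(Polynomial.C ε⁻¹ * q).coeff d| := by
      rw [Polynomial.coeff_C_mul, hqc, abs_mul, abs_mul, abs_inv, abs_of_pos hε0,
        abs_of_pos (by positivity : (0 : ℝ) < d + 1), Real.rpow_sub ha', Real.rpow_one, ← hε,
        div_eq_inv_mul]
      gcongr
      nlinarith
    refine (Real.rpow_le_rpow_of_nonpos (by positivity) h1
      (by rw [neg_nonpos]; positivity)).trans (le_of_eq ?_)
    rw [← Real.rpow_mul (abs_nonneg _)]
    congr 1
    push_cast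
    field_simp
    ring
  calc _ ≤ (3 * d + 2) / ε + K * |(Polynomial.C ε⁻¹ * q).coeff d| ^ (-(1 / d : ℝ)) :=
        (norm_add_le _ _).trans (add_le_add b1 (b2.trans hsb))
    _ ≤ _ := by
        rw [e1, add_mul _ K]
        exact add_le_add le_rfl (mul_le_mul_of_nonneg_left e2 hK.le)

theorem vanDerCorput {d : ℕ} (hd : 1 ≤ d) : VanDerCorput d := by
  induction d, hd using Nat.le_induction with
  | base => exact vanDerCorput_one
  | succ d hd ih => exact ih.succ hd

/-! ### Mixtures -/

section mixture

variable {ι X Y Z : Type*} [Fintype ι] [MeasurableSpace X] [MeasurableSpace Y] [MeasurableSpace Z]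

lemma measurePreserving_pi_mixture (P : ι → Measure X) (ν : ι → Measure Y) (μ : ι → Measure Z)
    [∀ i, IsProbabilityMeasure (P i)] [∀ i, IsProbabilityMeasure (ν i)]
    [∀ i, IsProbabilityMeasure (μ i)] {Φ : ι → X × Y → Z}
    (h : ∀ i, MeasurePreserving (Φ i) ((P i).prod (ν i)) (μ i)) :
    MeasurePreserving (fun z : (ι → X) × (ι → Y) => fun i => Φ i (z.1 i, z.2 i))
      ((Measure.pi P).prod (Measure.pi ν)) (Measure.pi μ) :=
  (measurePreserving_pi (fun i => (P i).prod (ν i)) μ h).comp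
    ((measurePreserving_arrowProdEquivProdArrow X Y ι P ν).symm)

end mixture

lemma norm_integral_cexp_mixture_le {n : ℕ} (P : Fin n → Measure (ℝ × ℝ)) (ν : Measure ℝ)
    (μ : Fin n → Measure ℝ) [∀ i, IsProbabilityMeasure (P i)] [IsProbabilityMeasure ν]
    [∀ i, IsProbabilityMeasure (μ i)]
    (h : ∀ i, MeasurePreserving (fun z : (ℝ × ℝ) × ℝ => z.1.1 + z.1.2 * z.2)
      ((P i).prod ν) (μ i)) (f : MvPolynomial (Fin n) ℝ)
    {G : (Fin n → ℝ × ℝ) → ℝ} (hG : Integrable G (Measure.pi P))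
    (hb : ∀ᵐ ω ∂Measure.pi P, ‖∫ y, Complex.exp (Complex.I * (MvPolynomial.eval y
      (affSubst (fun i => (ω i).1) (fun i => (ω i).2) f) : ℝ)) ∂Measure.pi (fun _ => ν)‖ ≤ G ω) :
    ‖∫ x, Complex.exp (Complex.I * (MvPolynomial.eval x f : ℝ)) ∂Measure.pi μ‖
      ≤ ∫ ω, G ω ∂Measure.pi P := by
  have hmp := measurePreserving_pi_mixture P (fun _ => ν) μ h
  have hm : Measurable fun x : Fin n → ℝ =>
      Complex.exp (Complex.I * (MvPolynomial.eval x f : ℝ)) := by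
    have := measurable_eval_mvPolynomial f
    fun_prop
  have hInt := hmp.integrable_comp_of_integrable
    (integrable_cexp_I_mul (Measure.pi μ) (measurable_eval_mvPolynomial f))
  rw [← hmp.map_eq, integral_map hmp.aemeasurable hm.aestronglyMeasurable]
  refine (congrArg norm (integral_prod _ hInt)).trans_le ?_
  refine norm_integral_le_of_norm_le hG ?_
  filter_upwards [hb] with ω hω
  simpa [eval_affSubst] using hω

/-! ### Convexity inequalities -/

section convexity

variable {ι : Type*}

lemma rpow_neg_sum_le (s : Finset ι) {p X : ι → ℝ} {x : ℝ} (hx : 0 ≤ x)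
    (hp : ∀ i ∈ s, 0 ≤ p i) (hp1 : ∑ i ∈ s, p i = 1) (hX : ∀ i ∈ s, 0 < X i) :
    (∑ i ∈ s, p i * X i) ^ (-x) ≤ ∑ i ∈ s, p i * X i ^ (-x) := by
  have h1 := Real.geom_mean_le_arith_mean_weighted s p X hp hp1 fun i hi => (hX i hi).le
  have h2 := Real.geom_mean_le_arith_mean_weighted s p (fun i => X i ^ (-x)) hp hp1
    fun i hi => (Real.rpow_pos_of_pos (hX i hi) _).le
  have hpos : 0 < ∏ i ∈ s, X i ^ p i :=
    Finset.prod_pos fun i hi => Real.rpow_pos_of_pos (hX i hi) _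
  refine (Real.rpow_le_rpow_of_nonpos hpos h1 (neg_nonpos.2 hx)).trans (le_trans (le_of_eq ?_) h2)
  rw [← Real.finsetProd_rpow _ _ fun i hi => (Real.rpow_pos_of_pos (hX i hi) _).le]
  refine Finset.prod_congr rfl fun i hi => ?_
  rw [← Real.rpow_mul (hX i hi).le, ← Real.rpow_mul (hX i hi).le, mul_comm]

/-- A version of `rpow_neg_sum_le` for weights whose sum is a positive number. -/
lemma rpow_neg_sum_le_of_pos (s : Finset ι) {a X : ι → ℝ} {x : ℝ} (hx : 0 ≤ x)
    (ha : ∀ i ∈ s, 0 ≤ a i) (hT : 0 < ∑ i ∈ s, a i) (hX : ∀ i ∈ s, 0 < X i) :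
    (∑ i ∈ s, a i * X i) ^ (-x)
      ≤ (∑ i ∈ s, a i) ^ (-x) * ∑ i ∈ s, (a i / ∑ i ∈ s, a i) * X i ^ (-x) := by
  set T := ∑ i ∈ s, a i with hTdef
  have h := rpow_neg_sum_le s hx (p := fun i => a i / T)
    (fun i hi => div_nonneg (ha i hi) hT.le) (by rw [← Finset.sum_div, div_self hT.ne']) hX
  have e : ∑ i ∈ s, a i * X i = T * ∑ i ∈ s, a i / T * X i := by
    rw [Finset.mul_sum]
    refine Finset.sum_congr rfl fun i _ => ?_
    field_simp
  rw [e, Real.mul_rpow hT.le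
    (Finset.sum_nonneg fun i hi => mul_nonneg (div_nonneg (ha i hi) hT.le) (hX i hi).le)]
  exact mul_le_mul_of_nonneg_left h (Real.rpow_nonneg hT.le _)

lemma prod_pow_sq_rpow_neg [Fintype ι] {w : ι → ℝ} (hw : ∀ i, 0 < w i) (I : ι → ℕ) (x : ℝ) :
    ((∏ i, w i ^ I i) ^ 2) ^ (-x) = ∏ i, w i ^ (-(2 * x * I i)) := by
  rw [← Finset.prod_pow, ← Real.finsetProd_rpow _ _ fun i _ => by positivity]
  refine Finset.prod_congr rfl fun i _ => ?_
  rw [← pow_mul, ← Real.rpow_natCast, ← Real.rpow_mul (hw i).le]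
  congr 1
  push_cast
  ring

end convexity

/-! ### The uniform measure on the three-dimensional unit ball and its marginals -/

lemma volume_disc (r : ℝ) :
    volume {β : ℝ × ℝ | β.1 ^ 2 + β.2 ^ 2 < r} = ENNReal.ofReal (Real.pi * r) := by
  rcases le_or_gt r 0 with hr | hr
  · rw [ENNReal.ofReal_eq_zero.2 (mul_nonpos_of_nonneg_of_nonpos Real.pi_pos.le hr)]
    have : {β : ℝ × ℝ | β.1 ^ 2 + β.2 ^ 2 < r} = ∅ := by
      ext β
      simp only [Set.mem_ofPred_eq, Set.mem_empty_iff_false, iff_false, not_lt]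
      exact hr.trans (by positivity)
    rw [this, measure_empty]
  · have hms : MeasurableSet {β : ℝ × ℝ | β.1 ^ 2 + β.2 ^ 2 < r} :=
      measurableSet_lt (by fun_prop) measurable_const
    rw [← Complex.volume_preserving_equiv_real_prod.measure_preimage hms.nullMeasurableSet]
    have : Complex.measurableEquivRealProd ⁻¹' {β : ℝ × ℝ | β.1 ^ 2 + β.2 ^ 2 < r}
        = Metric.ball 0 (Real.sqrt r) := by
      ext z
      rw [Set.mem_preimage, Set.mem_ofPred_eq, mem_ball_zero_iff, Real.lt_sqrt (norm_nonneg _),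
        Complex.sq_norm, Complex.normSq_apply]
      simp [Complex.measurableEquivRealProd_apply, pow_two]
    rw [this, Complex.volume_ball, ← ENNReal.ofReal_pow (Real.sqrt_nonneg _), Real.sq_sqrt hr.le,
      mul_comm, ENNReal.ofReal_mul Real.pi_pos.le]
    congr 1
    rw [← NNReal.coe_real_pi, ENNReal.ofReal_coe_nnreal]

/-- The open unit ball in three-dimensional space. -/
def unitBall : Set (ℝ × (ℝ × ℝ)) := {z | z.1 ^ 2 + z.2.1 ^ 2 + z.2.2 ^ 2 < 1}

lemma measurableSet_unitBall : MeasurableSet unitBall :=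
  measurableSet_lt (by fun_prop) measurable_const

/-- The uniform probability measure on the three-dimensional unit ball. -/
def ballMeasure : Measure (ℝ × (ℝ × ℝ)) :=
  ENNReal.ofReal (3 / (4 * Real.pi)) • volume.restrict unitBall

/-- The law of one coordinate of a uniform point of the unit ball. -/
def ballFst : Measure ℝ := ballMeasure.map Prod.fst

/-- The law of two coordinates of a uniform point of the unit ball. -/
def ballSnd : Measure (ℝ × ℝ) := ballMeasure.map Prod.snd

lemma ballFst_eq_withDensity :
    ballFst = volume.withDensity fun a => ENNReal.ofReal (3 / 4 * (1 - a ^ 2)) := by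
  ext s hs
  rw [ballFst, Measure.map_apply measurable_fst hs, withDensity_apply _ hs, ballMeasure,
    Measure.smul_apply, Measure.restrict_apply (measurable_fst hs), smul_eq_mul,
    Measure.volume_eq_prod, Measure.prod_apply ((measurable_fst hs).inter measurableSet_unitBall),
    ← lintegral_indicator hs,
    ← lintegral_const_mul' _ _ ENNReal.ofReal_ne_top]
  refine lintegral_congr fun a => ?_
  by_cases ha : a ∈ s
  · rw [Set.indicator_of_mem ha]
    have : Prod.mk a ⁻¹' (Prod.fst ⁻¹' s ∩ unitBall)
        = {β : ℝ × ℝ | β.1 ^ 2 + β.2 ^ 2 < 1 - a ^ 2} := by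
      ext β
      simp only [Set.mem_preimage, Set.mem_inter_iff, ha, true_and, unitBall, Set.mem_ofPred_eq]
      constructor <;> intro h <;> linarith
    rw [this, volume_disc, ← ENNReal.ofReal_mul (by positivity)]
    congr 1
    field_simp
  · rw [Set.indicator_of_notMem ha]
    have : Prod.mk a ⁻¹' (Prod.fst ⁻¹' s ∩ unitBall) = ∅ := by
      ext β
      simp [ha]
    rw [this, measure_empty, mul_zero]

lemma ballFst_eq_restrict : ballFst = (volume.restrict (Set.Ioc (-1) 1)).withDensity
    fun a => ENNReal.ofReal (3 / 4 * (1 - a ^ 2)) := by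
  rw [ballFst_eq_withDensity, ← withDensity_indicator measurableSet_Ioc]
  congr 1
  funext a
  by_cases ha : a ∈ Set.Ioc (-1 : ℝ) 1
  · rw [Set.indicator_of_mem ha]
  · rw [Set.indicator_of_notMem ha, ENNReal.ofReal_eq_zero]
    rw [Set.mem_Ioc, not_and_or, not_lt, not_le] at ha
    rcases ha with h | h <;> nlinarith

lemma integral_ballFst {E : Type*} [NormedAddCommGroup E] [NormedSpace ℝ E] (g : ℝ → E) :
    ∫ a, g a ∂ballFst = ∫ a in (-1 : ℝ)..1, (3 / 4 * (1 - a ^ 2)) • g a := by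
  rw [ballFst_eq_restrict, integral_withDensity_eq_integral_toReal_smul (by fun_prop) (by simp),
    intervalIntegral.integral_of_le (by norm_num)]
  refine setIntegral_congr_fun measurableSet_Ioc fun a ha => ?_
  have : 0 ≤ 3 / 4 * (1 - a ^ 2) := by nlinarith [ha.1, ha.2]
  simp only [ENNReal.toReal_ofReal this]

instance : IsProbabilityMeasure ballFst := ⟨by
  rw [ballFst_eq_restrict, withDensity_apply _ MeasurableSet.univ, Measure.restrict_univ,
    ← ofReal_integral_eq_lintegral_ofReal, ← intervalIntegral.integral_of_le (by norm_num)]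
  · rw [intervalIntegral.integral_const_mul, intervalIntegral.integral_sub (by simp)
      (Continuous.intervalIntegrable (by fun_prop) _ _), integral_pow]
    norm_num
  · exact (Continuous.intervalIntegrable (by fun_prop) _ _).1
  · filter_upwards [self_mem_ae_restrict measurableSet_Ioc] with a ha
    simp only [Pi.zero_apply]
    nlinarith [ha.1, ha.2]⟩

instance : IsProbabilityMeasure ballMeasure :=
  have : IsProbabilityMeasure (ballMeasure.map Prod.fst) :=
    inferInstanceAs (IsProbabilityMeasure ballFst)
  Measure.isProbabilityMeasure_of_map Prod.fst

instance : IsProbabilityMeasure ballSnd :=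
  Measure.isProbabilityMeasure_map measurable_snd.aemeasurable

lemma measurePreserving_ballMeasure (L : (ℝ × (ℝ × ℝ)) ≃ₗ[ℝ] (ℝ × (ℝ × ℝ)))
    (hL : ∀ z, (L z).1 ^ 2 + (L z).2.1 ^ 2 + (L z).2.2 ^ 2 = z.1 ^ 2 + z.2.1 ^ 2 + z.2.2 ^ 2) :
    MeasurePreserving L ballMeasure ballMeasure := by
  have hLm : Measurable L := (LinearMap.continuous_of_finiteDimensional L.toLinearMap).measurable
  have hdet : LinearMap.det L.toLinearMap ≠ 0 := L.isUnit_det'.ne_zero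
  have h0 : (volume : Measure (ℝ × ℝ)).IsAddHaarMeasure :=
    Measure.prod.instIsAddHaarMeasure volume volume
  have : (volume : Measure (ℝ × (ℝ × ℝ))).IsAddHaarMeasure :=
    Measure.prod.instIsAddHaarMeasure volume volume
  have h1 := Measure.map_linearMap_addHaar_eq_smul_addHaar
    (volume : Measure (ℝ × (ℝ × ℝ))) hdet
  have hpre : L ⁻¹' unitBall = unitBall := by
    ext z
    simp only [Set.mem_preimage, unitBall, Set.mem_ofPred_eq, hL]
  set k := ENNReal.ofReal |(LinearMap.det L.toLinearMap)⁻¹| with hk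
  have h2 : ballMeasure.map L = k • ballMeasure := by
    rw [ballMeasure, Measure.map_smul]
    conv_lhs => rw [← hpre]
    rw [← Measure.restrict_map hLm measurableSet_unitBall]
    have : (volume : Measure (ℝ × (ℝ × ℝ))).map L = k • volume := h1
    rw [this, Measure.restrict_smul, smul_comm]
  have h3 : k = 1 := by
    have : IsProbabilityMeasure (ballMeasure.map L) :=
      Measure.isProbabilityMeasure_map hLm.aemeasurable
    have h4 := this.measure_univ
    rw [h2, Measure.smul_apply, measure_univ, smul_eq_mul, mul_one] at h4
    exact h4
  exact ⟨hLm, by rw [h2, h3, one_smul]⟩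

lemma measurePreserving_ballMeasure_rotation (θ : ℝ) :
    MeasurePreserving (fun z : ℝ × (ℝ × ℝ) => (z.1 * Real.cos θ + z.2.1 * Real.sin θ,
      (z.2.1 * Real.cos θ - z.1 * Real.sin θ, z.2.2))) ballMeasure ballMeasure := by
  have h := Real.sin_sq_add_cos_sq θ
  let L : (ℝ × (ℝ × ℝ)) ≃ₗ[ℝ] (ℝ × (ℝ × ℝ)) :=
    { toFun := fun z => (z.1 * Real.cos θ + z.2.1 * Real.sin θ,
        (z.2.1 * Real.cos θ - z.1 * Real.sin θ, z.2.2))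
      map_add' := fun x y => by ext <;> simp <;> ring
      map_smul' := fun c x => by ext <;> simp <;> ring
      invFun := fun z => (z.1 * Real.cos θ - z.2.1 * Real.sin θ,
        (z.2.1 * Real.cos θ + z.1 * Real.sin θ, z.2.2))
      left_inv := fun z => by
        ext <;> simp
        · linear_combination z.1 * h
        · linear_combination z.2.1 * h
      right_inv := fun z => by
        ext <;> simp
        · linear_combination z.1 * h
        · linear_combination z.2.1 * h }
  refine measurePreserving_ballMeasure L fun z => ?_
  change (z.1 * Real.cos θ + z.2.1 * Real.sin θ) ^ 2
    + (z.2.1 * Real.cos θ - z.1 * Real.sin θ) ^ 2 + z.2.2 ^ 2 = _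
  linear_combination (z.1 ^ 2 + z.2.1 ^ 2) * h

lemma measurePreserving_ballMeasure_swap :
    MeasurePreserving (fun z : ℝ × (ℝ × ℝ) => (z.1, (z.2.2, z.2.1))) ballMeasure ballMeasure := by
  let L : (ℝ × (ℝ × ℝ)) ≃ₗ[ℝ] (ℝ × (ℝ × ℝ)) :=
    { toFun := fun z => (z.1, (z.2.2, z.2.1))
      map_add' := fun x y => rfl
      map_smul' := fun c x => rfl
      invFun := fun z => (z.1, (z.2.2, z.2.1))
      left_inv := fun z => rfl
      right_inv := fun z => rfl }
  refine measurePreserving_ballMeasure L fun z => ?_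
  change z.1 ^ 2 + z.2.2 ^ 2 + z.2.1 ^ 2 = _
  ring

lemma measurePreserving_ballMeasure_frame {g h : ℝ} (hgh : g ^ 2 + h ^ 2 = 1) :
    MeasurePreserving (fun z : ℝ × (ℝ × ℝ) => (g * z.2.1 + h * z.2.2,
      (-h * z.2.1 + g * z.2.2, z.1))) ballMeasure ballMeasure := by
  let L : (ℝ × (ℝ × ℝ)) ≃ₗ[ℝ] (ℝ × (ℝ × ℝ)) :=
    { toFun := fun z => (g * z.2.1 + h * z.2.2, (-h * z.2.1 + g * z.2.2, z.1))
      map_add' := fun x y => by ext <;> simp <;> ring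
      map_smul' := fun c x => by ext <;> simp <;> ring
      invFun := fun z => (z.2.2, (g * z.1 - h * z.2.1, h * z.1 + g * z.2.1))
      left_inv := fun z => by
        ext <;> simp
        · linear_combination z.2.1 * hgh
        · linear_combination z.2.2 * hgh
      right_inv := fun z => by
        ext <;> simp
        · linear_combination z.1 * hgh
        · linear_combination z.2.1 * hgh }
  refine measurePreserving_ballMeasure L fun z => ?_
  change (g * z.2.1 + h * z.2.2) ^ 2 + (-h * z.2.1 + g * z.2.2) ^ 2 + z.1 ^ 2 = _
  linear_combination (z.2.1 ^ 2 + z.2.2 ^ 2) * hgh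

/-- Half the length of the chord of the unit ball above `β`. -/
def halfChord (β : ℝ × ℝ) : ℝ := Real.sqrt (1 - β.1 ^ 2 - β.2 ^ 2)

@[fun_prop]
lemma measurable_halfChord : Measurable halfChord := by
  unfold halfChord
  fun_prop

lemma halfChord_nonneg (β : ℝ × ℝ) : 0 ≤ halfChord β := Real.sqrt_nonneg _

lemma prodMk_preimage_unitBall (β : ℝ × ℝ) :
    (fun a => (a, β)) ⁻¹' unitBall = Set.Ioo (-halfChord β) (halfChord β) := by
  ext a
  rw [Set.mem_preimage, unitBall, Set.mem_ofPred_eq, Set.mem_Ioo, ← abs_lt, halfChord,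
    Real.lt_sqrt (abs_nonneg _), sq_abs]
  constructor <;> intro h <;> linarith

lemma ballSnd_eq_withDensity : ballSnd = volume.withDensity fun β =>
    ENNReal.ofReal (3 / (4 * Real.pi)) * ENNReal.ofReal (2 * halfChord β) := by
  ext s hs
  rw [ballSnd, Measure.map_apply measurable_snd hs, withDensity_apply _ hs, ballMeasure,
    Measure.smul_apply, Measure.restrict_apply (measurable_snd hs), smul_eq_mul,
    Measure.volume_eq_prod, Measure.prod_apply_symm
      ((measurable_snd hs).inter measurableSet_unitBall),
    lintegral_const_mul' _ _ ENNReal.ofReal_ne_top, ← lintegral_indicator hs]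
  congr 1
  refine lintegral_congr fun β => ?_
  by_cases ha : β ∈ s
  · rw [Set.indicator_of_mem ha]
    have : (fun a => (a, β)) ⁻¹' (Prod.snd ⁻¹' s ∩ unitBall)
        = (fun a => (a, β)) ⁻¹' unitBall := by
      ext a
      simp [ha]
    rw [this, prodMk_preimage_unitBall, Real.volume_Ioo]
    ring_nf
  · rw [Set.indicator_of_notMem ha]
    have : (fun a => (a, β)) ⁻¹' (Prod.snd ⁻¹' s ∩ unitBall) = ∅ := by
      ext a
      simp [ha]
    rw [this, measure_empty]

lemma unifMeasure_eq_Ioo : unifMeasure = (2⁻¹ : ENNReal) • volume.restrict (Set.Ioo (-1) 1) := by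
  rw [unifMeasure, Measure.restrict_congr_set Ioo_ae_eq_Icc]

lemma ofReal_mul_unifMeasure_preimage {σ : ℝ} (hσ : 0 ≤ σ) {t : Set ℝ} (ht : MeasurableSet t) :
    ENNReal.ofReal (2 * σ) * unifMeasure ((fun y => σ * y) ⁻¹' t)
      = volume (t ∩ Set.Ioo (-σ) σ) := by
  rcases hσ.eq_or_lt with rfl | hσ
  · simp
  · rw [unifMeasure_eq_Ioo, Measure.smul_apply, Measure.restrict_apply (measurable_const_mul σ ht)]
    have : (fun y => σ * y) ⁻¹' t ∩ Set.Ioo (-1) 1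
        = (fun y => σ * y) ⁻¹' (t ∩ Set.Ioo (-σ) σ) := by
      ext y
      simp only [Set.mem_inter_iff, Set.mem_preimage, Set.mem_Ioo]
      constructor
      · rintro ⟨h1, h2, h3⟩
        exact ⟨h1, by nlinarith, by nlinarith⟩
      · rintro ⟨h1, h2, h3⟩
        refine ⟨h1, ?_, ?_⟩
        · by_contra! h
          nlinarith
        · by_contra! h
          nlinarith
    rw [this, Real.volume_preimage_mul_left hσ.ne', smul_eq_mul, ← mul_assoc, ← mul_assoc,
      abs_of_pos (inv_pos.2 hσ)]
    have : ENNReal.ofReal (2 * σ) * 2⁻¹ * ENNReal.ofReal σ⁻¹ = 1 := by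
      have h2 : (2⁻¹ : ENNReal) = ENNReal.ofReal 2⁻¹ := by
        rw [ENNReal.ofReal_inv_of_pos (by norm_num)]
        norm_num
      rw [h2, ← ENNReal.ofReal_mul (by positivity), ← ENNReal.ofReal_mul (by positivity)]
      rw [show 2 * σ * 2⁻¹ * σ⁻¹ = 1 by field_simp, ENNReal.ofReal_one]
    rw [this, one_mul]

lemma measurePreserving_chord :
    MeasurePreserving (fun z : (ℝ × ℝ) × ℝ => (halfChord z.1 * z.2, z.1))
      (ballSnd.prod unifMeasure) ballMeasure := by
  have hm : Measurable (fun z : (ℝ × ℝ) × ℝ => (halfChord z.1 * z.2, z.1)) := by fun_prop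
  refine ⟨hm, ?_⟩
  ext s hs
  rw [Measure.map_apply hm hs, Measure.prod_apply (hm hs), ballSnd_eq_withDensity,
    lintegral_withDensity_eq_lintegral_mul _ (by fun_prop) (measurable_measure_prodMk_left (hm hs)),
    ballMeasure, Measure.smul_apply, Measure.restrict_apply hs, smul_eq_mul,
    Measure.volume_eq_prod ℝ (ℝ × ℝ), Measure.prod_apply_symm (hs.inter measurableSet_unitBall),
    ← lintegral_const_mul' _ _ ENNReal.ofReal_ne_top]
  refine lintegral_congr fun β => ?_
  have h1 : MeasurableSet ((fun a => (a, β)) ⁻¹' s) := measurable_prodMk_right hs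
  rw [Pi.mul_apply, mul_assoc, Set.preimage_inter, prodMk_preimage_unitBall,
    ← ofReal_mul_unifMeasure_preimage (halfChord_nonneg β) h1]
  rfl

/-! ### Moments and characteristic functions for the ball marginals -/

lemma ae_halfChord_pos : ∀ᵐ β ∂ballSnd, 0 < halfChord β := by
  rw [ballSnd_eq_withDensity, ae_withDensity_iff (by
    have := measurable_halfChord
    fun_prop)]
  refine .of_forall fun β h => ?_
  rcases (halfChord_nonneg β).eq_or_lt with h0 | h0
  · simp [← h0] at h
  · exact h0

lemma integrable_halfChord_rpow_volume :
    Integrable (fun β : ℝ × ℝ => halfChord β ^ (-(3 / 2) : ℝ)) volume := by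
  rw [← Complex.volume_preserving_equiv_real_prod.integrable_comp_emb
    Complex.measurableEquivRealProd.measurableEmbedding]
  have heq : (fun β : ℝ × ℝ => halfChord β ^ (-(3 / 2) : ℝ)) ∘ Complex.measurableEquivRealProd
      = fun z : ℂ => (fun y : ℝ => Real.sqrt (1 - y ^ 2) ^ (-(3 / 2) : ℝ)) ‖z‖ := by
    ext z
    simp only [Function.comp_apply, halfChord, Complex.measurableEquivRealProd_apply,
      Complex.sq_norm, Complex.normSq_apply]
    ring_nf
  rw [heq, integrable_fun_norm_addHaar volume
    (f := fun y : ℝ => Real.sqrt (1 - y ^ 2) ^ (-(3 / 2) : ℝ))]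
  simp only [Complex.finrank_real_complex, smul_eq_mul, Nat.add_one_sub_one, pow_one]
  have hI : IntegrableOn (fun y : ℝ => (1 - y) ^ (-(3 / 4) : ℝ)) (Set.Ioo 0 1) := by
    have h1 : IntervalIntegrable (fun y : ℝ => y ^ (-(3 / 4) : ℝ)) volume 0 1 :=
      intervalIntegral.intervalIntegrable_rpow' (by norm_num)
    have h2 := (h1.comp_sub_left 1).symm
    simp only [sub_zero, sub_self] at h2
    rw [intervalIntegrable_iff_integrableOn_Ioo_of_le zero_le_one] at h2
    exact h2
  have hJ : Integrable ((Set.Ioo (0:ℝ) 1).indicator fun y : ℝ => (1 - y) ^ (-(3 / 4) : ℝ)) :=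
    (integrable_indicator_iff measurableSet_Ioo).2 hI
  refine Integrable.mono' hJ.integrableOn (Measurable.aestronglyMeasurable (by fun_prop)) ?_
  refine (ae_restrict_iff' measurableSet_Ioi).2 (.of_forall fun y (hy : 0 < y) => ?_)
  rcases lt_or_ge y 1 with h1 | h1
  · rw [Set.indicator_of_mem (Set.mem_Ioo.2 ⟨hy, h1⟩), Real.norm_of_nonneg (by positivity),
      Real.sqrt_eq_rpow, ← Real.rpow_mul (by nlinarith)]
    have : (1 - y ^ 2) ^ (1 / 2 * -(3 / 2) : ℝ) ≤ (1 - y) ^ (-(3 / 4) : ℝ) := by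
      rw [show (1 / 2 * -(3 / 2) : ℝ) = -(3 / 4) by norm_num]
      exact Real.rpow_le_rpow_of_nonpos (by linarith) (by nlinarith) (by norm_num)
    calc _ ≤ 1 * _ := mul_le_mul_of_nonneg_right h1.le (Real.rpow_nonneg (by nlinarith) _)
      _ ≤ _ := by rw [one_mul]; exact this
  · rw [Real.sqrt_eq_zero_of_nonpos (by nlinarith), Real.zero_rpow (by norm_num), mul_zero, norm_zero]
    exact Set.indicator_nonneg (fun z hz => Real.rpow_nonneg (by linarith [hz.2]) _) y

lemma integrable_halfChord_rpow :
    Integrable (fun β => halfChord β ^ (-(5 / 2) : ℝ)) ballSnd := by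
  rw [ballSnd_eq_withDensity, integrable_withDensity_iff_integrable_smul' (by
    have := measurable_halfChord
    fun_prop) (.of_forall fun β => ENNReal.mul_lt_top ENNReal.ofReal_lt_top ENNReal.ofReal_lt_top)]
  refine (integrable_halfChord_rpow_volume.const_mul (3 / (4 * Real.pi) * 2)).congr
    (.of_forall fun β => ?_)
  have h0 := halfChord_nonneg β
  simp only [smul_eq_mul]
  rw [ENNReal.toReal_mul, ENNReal.toReal_ofReal (by positivity),
    ENNReal.toReal_ofReal (by positivity)]
  rcases h0.eq_or_lt with h | h
  · rw [← h, Real.zero_rpow (by norm_num), Real.zero_rpow (by norm_num)]; ring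
  · rw [show (-(3 / 2) : ℝ) = 1 + -(5 / 2) by norm_num, Real.rpow_add h, Real.rpow_one]
    ring

lemma integral_cexp_ballFst (τ : ℝ) :
    ∫ a, Complex.exp (Complex.I * (τ * a : ℝ)) ∂ballFst
      = ((∫ a in (-1:ℝ)..1, 3 / 4 * (1 - a ^ 2) * Real.cos (τ * a) : ℝ) : ℂ) := by
  rw [integral_ballFst]
  set F : ℝ → ℂ := fun a => (3 / 4 * (1 - a ^ 2) : ℝ) • Complex.exp (Complex.I * (τ * a : ℝ))
    with hF
  have hFc : Continuous F := by rw [hF]; fun_prop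
  have h1 : ∫ a in (-1:ℝ)..1, F (-a) = ∫ a in (-1:ℝ)..1, F a := by
    rw [intervalIntegral.integral_comp_neg]; simp
  have h2 : ∫ a in (-1:ℝ)..1, (F a + F (-a)) = 2 * ∫ a in (-1:ℝ)..1, F a := by
    rw [intervalIntegral.integral_add (hFc.intervalIntegrable _ _)
      (Continuous.intervalIntegrable (by fun_prop) _ _), h1, two_mul]
  have h3 : ∀ a, F a + F (-a) = 2 * ((3 / 4 * (1 - a ^ 2) * Real.cos (τ * a) : ℝ) : ℂ) := by
    intro a
    simp only [hF, Complex.real_smul]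
    push_cast
    rw [Complex.cos]
    ring_nf
  simp_rw [h3] at h2
  rw [intervalIntegral.integral_const_mul, intervalIntegral.integral_ofReal] at h2
  exact (mul_left_cancel₀ two_ne_zero h2).symm

lemma integral_one_sub_sq_mul_cos {τ : ℝ} (hτ : τ ≠ 0) :
    ∫ a in (-1:ℝ)..1, 3 / 4 * (1 - a ^ 2) * Real.cos (τ * a)
      = 3 * (Real.sin τ - τ * Real.cos τ) / τ ^ 3 := by
  have hd : ∀ a ∈ Set.uIcc (-1:ℝ) 1, HasDerivAt (fun a : ℝ => 3 / 4 * ((1 - a ^ 2) * Real.sin (τ * a) / τ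
      - 2 * a * Real.cos (τ * a) / τ ^ 2 + 2 * Real.sin (τ * a) / τ ^ 3))
      (3 / 4 * (1 - a ^ 2) * Real.cos (τ * a)) a := by
    intro a _
    have hl : HasDerivAt (fun a : ℝ => τ * a) τ a := by
      simpa using (hasDerivAt_id a).const_mul τ
    have hs := hl.sin
    have hc := hl.cos
    have hq : HasDerivAt (fun a : ℝ => 1 - a ^ 2) (-(2 * a)) a := by
      simpa using ((hasDerivAt_pow 2 a).const_sub 1)
    have h2 : HasDerivAt (fun a : ℝ => 2 * a) 2 a := by
      simpa using (hasDerivAt_id a).const_mul (2:ℝ)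
    refine (((((hq.fun_mul hs).div_const τ).fun_sub ((h2.fun_mul hc).div_const (τ ^ 2))).fun_add
      ((hs.const_mul 2).div_const (τ ^ 3))).const_mul (3 / 4)).congr_deriv ?_
    field_simp
    ring
  rw [intervalIntegral.integral_eq_sub_of_hasDerivAt hd
    (Continuous.intervalIntegrable (by fun_prop) _ _)]
  simp only [mul_neg, mul_one, Real.sin_neg, Real.cos_neg]
  field_simp
  ring

lemma norm_integral_cexp_ballFst_le (τ : ℝ) :
    ‖∫ a, Complex.exp (Complex.I * (τ * a : ℝ)) ∂ballFst‖ ≤ (1 + τ ^ 2 / 25)⁻¹ := by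
  rw [integral_cexp_ballFst, Complex.norm_real, Real.norm_eq_abs]
  have hπ1 := Real.pi_gt_three
  have hπ2 : Real.pi ^ 2 < 10 := by nlinarith [Real.pi_lt_d2]
  have hpos : 0 < 1 + τ ^ 2 / 25 := by positivity
  rcases le_or_gt |τ| Real.pi with h | h
  · have hτ2 : τ ^ 2 ≤ Real.pi ^ 2 := sq_le_sq' (abs_le.1 h).1 (abs_le.1 h).2
    have hup : ∫ a in (-1:ℝ)..1, 3 / 4 * (1 - a ^ 2) * Real.cos (τ * a)
        ≤ ∫ a in (-1:ℝ)..1, 3 / 4 * (1 - a ^ 2) * (1 - 1 / 5 * (τ * a) ^ 2) := by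
      refine intervalIntegral.integral_mono_on (by norm_num)
        (Continuous.intervalIntegrable (by fun_prop) _ _)
        (Continuous.intervalIntegrable (by fun_prop) _ _) fun a ha => ?_
      refine mul_le_mul_of_nonneg_left ?_ (by nlinarith [ha.1, ha.2])
      refine (Real.cos_le_one_sub_mul_cos_sq (x := τ * a) ?_).trans ?_
      · rw [abs_mul]
        exact (mul_le_of_le_one_right (abs_nonneg _) (abs_le.2 ha)).trans h
      · have : (1:ℝ) / 5 ≤ 2 / Real.pi ^ 2 := by
          rw [div_le_div_iff₀ (by norm_num) (by positivity)]; linarith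
        nlinarith [mul_le_mul_of_nonneg_right this (sq_nonneg (τ * a))]
    have hlo : ∫ a in (-1:ℝ)..1, 3 / 4 * (1 - a ^ 2) * (1 - 1 / 2 * (τ * a) ^ 2)
        ≤ ∫ a in (-1:ℝ)..1, 3 / 4 * (1 - a ^ 2) * Real.cos (τ * a) := by
      refine intervalIntegral.integral_mono_on (by norm_num)
        (Continuous.intervalIntegrable (by fun_prop) _ _)
        (Continuous.intervalIntegrable (by fun_prop) _ _) fun a ha => ?_
      refine mul_le_mul_of_nonneg_left ?_ (by nlinarith [ha.1, ha.2])
      have := Real.one_sub_sq_div_two_le_cos (x := τ * a)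
      linarith
    have hcomp : ∀ c : ℝ, ∫ a in (-1:ℝ)..1, 3 / 4 * (1 - a ^ 2) * (1 - c * (τ * a) ^ 2)
        = 1 - c * τ ^ 2 / 5 := by
      intro c
      have hd : ∀ a ∈ Set.uIcc (-1:ℝ) 1, HasDerivAt (fun a : ℝ => 3 / 4 * (a - (1 + c * τ ^ 2) / 3 * a ^ 3
          + c * τ ^ 2 / 5 * a ^ 5)) (3 / 4 * (1 - a ^ 2) * (1 - c * (τ * a) ^ 2)) a := by
        intro a _
        refine ((((hasDerivAt_id' a).fun_sub ((hasDerivAt_pow 3 a).const_mul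
          ((1 + c * τ ^ 2) / 3))).fun_add ((hasDerivAt_pow 5 a).const_mul
          (c * τ ^ 2 / 5))).const_mul (3 / 4)).congr_deriv ?_
        norm_num
        ring
      rw [intervalIntegral.integral_eq_sub_of_hasDerivAt hd
        (Continuous.intervalIntegrable (by fun_prop) _ _)]
      ring
    rw [hcomp] at hup hlo
    rw [abs_of_nonneg (by nlinarith), ← one_div, le_div_iff₀ hpos]
    nlinarith [mul_le_mul_of_nonneg_right hup hpos.le, sq_nonneg (τ ^ 2)]
  · have hτ0 : 0 < |τ| := by linarith
    have hne : τ ≠ 0 := abs_pos.1 hτ0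
    rw [integral_one_sub_sq_mul_cos hne]
    have hs : 9 ≤ τ ^ 2 := by rw [← sq_abs]; nlinarith
    have h1 : (Real.sin τ - τ * Real.cos τ) ^ 2 ≤ 1 + τ ^ 2 := by
      nlinarith [sq_nonneg (Real.cos τ + τ * Real.sin τ), Real.sin_sq_add_cos_sq τ]
    refine abs_le_of_sq_le_sq ?_ (by positivity)
    rw [div_pow, inv_pow, ← one_div, div_le_div_iff₀ (by positivity) (by positivity)]
    have h2 : 9 * (1 + τ ^ 2) * (1 + τ ^ 2 / 25) ^ 2 ≤ (τ ^ 2) ^ 3 := by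
      generalize τ ^ 2 = s at hs
      nlinarith [mul_nonneg (sub_nonneg.2 hs) (sub_nonneg.2 hs), mul_nonneg (mul_nonneg (sub_nonneg.2 hs) (sub_nonneg.2 hs)) (sub_nonneg.2 hs)]
    calc (3 * (Real.sin τ - τ * Real.cos τ)) ^ 2 * (1 + τ ^ 2 / 25) ^ 2
        = 9 * (Real.sin τ - τ * Real.cos τ) ^ 2 * (1 + τ ^ 2 / 25) ^ 2 := by ring
      _ ≤ 9 * (1 + τ ^ 2) * (1 + τ ^ 2 / 25) ^ 2 := by gcongr
      _ ≤ _ := h2.trans (by ring_nf; rfl)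

lemma norm_integral_cexp_ballSnd_le (p q : ℝ) :
    ‖∫ β, Complex.exp (Complex.I * (p * β.1 + q * β.2 : ℝ)) ∂ballSnd‖
      ≤ (1 + (p ^ 2 + q ^ 2) / 25)⁻¹ := by
  rcases eq_or_ne (p ^ 2 + q ^ 2) 0 with h0 | h0
  · rw [h0]
    simpa using norm_integral_cexp_le_one ballSnd fun β => p * β.1 + q * β.2
  have hpos : 0 < p ^ 2 + q ^ 2 := lt_of_le_of_ne (by positivity) h0.symm
  set r := Real.sqrt (p ^ 2 + q ^ 2) with hr
  have hr0 : 0 < r := Real.sqrt_pos.2 hpos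
  have hr2 : r ^ 2 = p ^ 2 + q ^ 2 := Real.sq_sqrt hpos.le
  have hf := measurePreserving_ballMeasure_frame (g := p / r) (h := q / r) (by
    rw [div_pow, div_pow, ← add_div, hr2, div_self h0])
  have hm : ∀ g : ℝ × ℝ → ℝ, Continuous g →
      ∫ β, Complex.exp (Complex.I * (g β : ℝ)) ∂ballSnd
        = ∫ z, Complex.exp (Complex.I * (g z.2 : ℝ)) ∂ballMeasure := by
    intro g hg
    rw [ballSnd, integral_map measurable_snd.aemeasurable
      (Continuous.aestronglyMeasurable (by fun_prop))]
  have hm' : ∫ a, Complex.exp (Complex.I * (r * a : ℝ)) ∂ballFst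
        = ∫ z, Complex.exp (Complex.I * (r * z.1 : ℝ)) ∂ballMeasure := by
    rw [ballFst, integral_map measurable_fst.aemeasurable
      (Continuous.aestronglyMeasurable (by fun_prop))]
  have key : ∫ z, Complex.exp (Complex.I * (p * z.2.1 + q * z.2.2 : ℝ)) ∂ballMeasure
      = ∫ z, Complex.exp (Complex.I * (r * z.1 : ℝ)) ∂ballMeasure := by
    conv_rhs => rw [← hf.map_eq]
    rw [integral_map hf.measurable.aemeasurable
      (Continuous.aestronglyMeasurable (by fun_prop))]
    refine integral_congr_ae (.of_forall fun z => ?_)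
    simp only
    congr 3
    field_simp
  rw [hm (fun β => p * β.1 + q * β.2) (by fun_prop), key, ← hm', ← hr2]
  exact norm_integral_cexp_ballFst_le r

/-! ### A negative moment of weighted sums of planar vectors -/

lemma integrable_abs_rpow_gaussianReal {s : ℝ} (hs : -1 < s) :
    Integrable (fun g : ℝ => |g| ^ s) (ProbabilityTheory.gaussianReal 0 1) := by
  rw [ProbabilityTheory.gaussianReal_of_var_ne_zero _ one_ne_zero,
    integrable_withDensity_iff_integrable_smul'
      (ProbabilityTheory.measurable_gaussianPDF 0 1) (.of_forall fun g => by
        simp [ProbabilityTheory.gaussianPDF])]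
  have h1 : Integrable (fun g : ℝ => (fun y : ℝ => y ^ s * Real.exp (-(1 / 2) * y ^ 2)) ‖g‖) := by
    rw [integrable_fun_norm_addHaar volume
      (f := fun y : ℝ => y ^ s * Real.exp (-(1 / 2) * y ^ 2))]
    simpa using integrableOn_rpow_mul_exp_neg_mul_sq (b := 1 / 2) (by norm_num) hs
  refine (h1.const_mul (Real.sqrt (2 * Real.pi))⁻¹).congr (.of_forall fun g => ?_)
  simp only [ProbabilityTheory.toReal_gaussianPDF, ProbabilityTheory.gaussianPDFReal,
    Real.norm_eq_abs, sq_abs, smul_eq_mul, NNReal.coe_one, mul_one, sub_zero]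
  rw [show -(1 / 2) * g ^ 2 = -g ^ 2 / 2 by ring]
  ring

lemma integral_cexp_gaussianReal (t : ℝ) :
    ∫ g, Complex.exp (Complex.I * (t * g : ℝ)) ∂(ProbabilityTheory.gaussianReal 0 1)
      = (Real.exp (-(t ^ 2 / 2)) : ℂ) := by
  have := ProbabilityTheory.charFun_gaussianReal (μ := 0) (v := 1) t
  rw [charFun_apply_real] at this
  calc _ = ∫ g : ℝ, Complex.exp (t * g * Complex.I) ∂(ProbabilityTheory.gaussianReal 0 1) := by
        refine integral_congr_ae (.of_forall fun g => ?_)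
        simp only
        push_cast
        ring_nf
    _ = _ := by
        rw [this]
        push_cast
        ring_nf

lemma inv_one_add_le_rpow {x s : ℝ} (hx : 0 < x) (hs : 0 ≤ s) (hs1 : s ≤ 1) :
    (1 + x)⁻¹ ≤ x ^ (-s) := by
  rw [Real.rpow_neg hx.le]
  refine inv_anti₀ (by positivity) ?_
  rcases le_or_gt x 1 with h | h
  · linarith [Real.rpow_le_one hx.le h hs]
  · calc x ^ s ≤ x ^ (1:ℝ) := Real.rpow_le_rpow_of_exponent_le h.le hs1
      _ ≤ 1 + x := by rw [Real.rpow_one]; linarith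

lemma one_add_sum_le_prod_of_nonneg {ι : Type*} (s : Finset ι) (x : ι → ℝ)
    (hx : ∀ i ∈ s, 0 ≤ x i) : 1 + ∑ i ∈ s, x i ≤ ∏ i ∈ s, (1 + x i) := by
  have h1 := one_add_sum_le_prod s x hx
  have h2 := Finset.sum_sq_le_sq_sum_of_nonneg hx
  linarith

/-- The squared length of the weighted sum `∑ i, α i • β i` of planar vectors. -/
def sumSq {n : ℕ} (α : Fin n → ℝ) (β : Fin n → ℝ × ℝ) : ℝ :=
  (∑ i, α i * (β i).1) ^ 2 + (∑ i, α i * (β i).2) ^ 2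

lemma sumSq_nonneg {n : ℕ} (α : Fin n → ℝ) (β : Fin n → ℝ × ℝ) : 0 ≤ sumSq α β := by
  unfold sumSq; positivity

@[fun_prop]
lemma continuous_sumSq {n : ℕ} (α : Fin n → ℝ) : Continuous (sumSq α) := by
  unfold sumSq; fun_prop

lemma integral_exp_neg_mul_sumSq_eq {n : ℕ} (α : Fin n → ℝ) {l : ℝ} (hl : 0 ≤ l) :
    ((∫ β, Real.exp (-(l * sumSq α β)) ∂(Measure.pi fun _ => ballSnd) : ℝ) : ℂ)
      = ∫ g : ℝ × ℝ, ∏ i, (∫ b : ℝ × ℝ, Complex.exp (Complex.I *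
          ((Real.sqrt (2 * l) * α i * g.1) * b.1 + (Real.sqrt (2 * l) * α i * g.2) * b.2 : ℝ))
            ∂ballSnd)
        ∂((ProbabilityTheory.gaussianReal 0 1).prod (ProbabilityTheory.gaussianReal 0 1)) := by
  set γ := ProbabilityTheory.gaussianReal 0 1 with hγ
  set s := Real.sqrt (2 * l) with hs
  have hs2 : s ^ 2 = 2 * l := Real.sq_sqrt (by positivity)
  have h1 : ∀ β : Fin n → ℝ × ℝ, ((Real.exp (-(l * sumSq α β)) : ℝ) : ℂ)
      = ∫ g : ℝ × ℝ, Complex.exp (Complex.I *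
        ((s * ∑ i, α i * (β i).1) * g.1 + (s * ∑ i, α i * (β i).2) * g.2 : ℝ)) ∂(γ.prod γ) := by
    intro β
    have : ∀ g : ℝ × ℝ, Complex.exp (Complex.I *
        ((s * ∑ i, α i * (β i).1) * g.1 + (s * ∑ i, α i * (β i).2) * g.2 : ℝ))
        = Complex.exp (Complex.I * ((s * ∑ i, α i * (β i).1) * g.1 : ℝ))
          * Complex.exp (Complex.I * ((s * ∑ i, α i * (β i).2) * g.2 : ℝ)) := by
      intro g
      rw [← Complex.exp_add]
      push_cast
      ring_nf
    simp_rw [this]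
    rw [integral_prod_mul (fun x : ℝ => Complex.exp (Complex.I * ((s * ∑ i, α i * (β i).1) * x : ℝ)))
      (fun x : ℝ => Complex.exp (Complex.I * ((s * ∑ i, α i * (β i).2) * x : ℝ))),
      integral_cexp_gaussianReal, integral_cexp_gaussianReal, ← Complex.ofReal_mul, ← Real.exp_add]
    congr 2
    rw [mul_pow, mul_pow, hs2, sumSq]
    ring
  rw [← integral_complex_ofReal]
  simp_rw [h1]
  rw [integral_integral_swap]
  · refine integral_congr_ae (.of_forall fun g => ?_)
    simp only
    rw [← integral_fintype_prod_eq_prod]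
    refine integral_congr_ae (.of_forall fun β => ?_)
    simp only
    rw [← Complex.exp_sum, ← Finset.mul_sum, ← Complex.ofReal_sum]
    congr 3
    simp only [Finset.mul_sum, Finset.sum_mul, ← Finset.sum_add_distrib]
    exact Finset.sum_congr rfl fun i _ => by ring
  · exact integrable_cexp_I_mul _ (u := fun z : (Fin n → ℝ × ℝ) × (ℝ × ℝ) =>
      (s * ∑ i, α i * (z.1 i).1) * z.2.1 + (s * ∑ i, α i * (z.1 i).2) * z.2.2) (by fun_prop)

/-- A constant controlling the Laplace transform of `sumSq`. -/
def sumSqConst : ℝ := (4 / 25 : ℝ) ^ (-(11 / 12) : ℝ) *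
  (∫ g : ℝ, |g| ^ (-(11 / 12) : ℝ) ∂(ProbabilityTheory.gaussianReal 0 1)) ^ 2

lemma integral_exp_neg_mul_sumSq_le {n : ℕ} (α : Fin n → ℝ) (hα : ∑ i, α i ^ 2 = 1) {l : ℝ}
    (hl : 0 < l) :
    ∫ β, Real.exp (-(l * sumSq α β)) ∂(Measure.pi fun _ => ballSnd)
      ≤ sumSqConst * l ^ (-(11 / 12) : ℝ) := by
  set γ := ProbabilityTheory.gaussianReal 0 1 with hγ
  have hpos : 0 ≤ ∫ β, Real.exp (-(l * sumSq α β)) ∂(Measure.pi fun _ : Fin n => ballSnd) :=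
    integral_nonneg fun β => (Real.exp_pos _).le
  rw [← Real.norm_of_nonneg hpos, ← Complex.norm_real, integral_exp_neg_mul_sumSq_eq α hl.le]
  have hi := integrable_abs_rpow_gaussianReal (s := -(11 / 12)) (by norm_num)
  have hne : ∀ᵐ g ∂γ, g ≠ 0 := by
    have := ProbabilityTheory.nullSingletonClass_gaussianReal (μ := 0) (v := 1) one_ne_zero
    rw [ae_iff]
    simp [hγ, measure_singleton]
  have hne1 : ∀ᵐ g : ℝ × ℝ ∂(γ.prod γ), g.1 ≠ 0 :=
    Measure.quasiMeasurePreserving_fst.ae hne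
  have hne2 : ∀ᵐ g : ℝ × ℝ ∂(γ.prod γ), g.2 ≠ 0 :=
    Measure.quasiMeasurePreserving_snd.ae hne
  have hG : Integrable (fun g : ℝ × ℝ => ((4 / 25 : ℝ) ^ (-(11 / 12) : ℝ) * l ^ (-(11 / 12) : ℝ))
      * (|g.1| ^ (-(11 / 12) : ℝ) * |g.2| ^ (-(11 / 12) : ℝ))) (γ.prod γ) :=
    (hi.mul_prod hi).const_mul _
  refine (norm_integral_le_of_norm_le hG ?_).trans ?_
  · filter_upwards [hne1, hne2] with g h1 h2
    rw [norm_prod]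
    have hx : 0 < 4 / 25 * l * (|g.1| * |g.2|) := by positivity
    calc _ ≤ ∏ i, (1 + ((Real.sqrt (2 * l) * α i * g.1) ^ 2
            + (Real.sqrt (2 * l) * α i * g.2) ^ 2) / 25)⁻¹ :=
          Finset.prod_le_prod (fun i _ => norm_nonneg _)
            fun i _ => norm_integral_cexp_ballSnd_le _ _
      _ = (∏ i, (1 + 2 * l * (g.1 ^ 2 + g.2 ^ 2) / 25 * α i ^ 2))⁻¹ := by
          rw [Finset.prod_inv_distrib]
          congr 1
          refine Finset.prod_congr rfl fun i _ => ?_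
          rw [mul_pow, mul_pow, mul_pow, mul_pow, Real.sq_sqrt (by positivity)]
          ring
      _ ≤ (1 + 4 / 25 * l * (|g.1| * |g.2|))⁻¹ := by
          refine inv_anti₀ (by positivity) ?_
          have h3 : 1 + ∑ i, 2 * l * (g.1 ^ 2 + g.2 ^ 2) / 25 * α i ^ 2
              ≤ ∏ i, (1 + 2 * l * (g.1 ^ 2 + g.2 ^ 2) / 25 * α i ^ 2) :=
            one_add_sum_le_prod_of_nonneg _ _ fun i _ => by positivity
          rw [← Finset.mul_sum, hα, mul_one] at h3
          refine le_trans ?_ h3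
          have : 2 * (|g.1| * |g.2|) ≤ g.1 ^ 2 + g.2 ^ 2 := by
            rw [← sq_abs g.1, ← sq_abs g.2]; nlinarith [sq_nonneg (|g.1| - |g.2|)]
          nlinarith
      _ ≤ (4 / 25 * l * (|g.1| * |g.2|)) ^ (-(11 / 12) : ℝ) :=
          inv_one_add_le_rpow hx (by norm_num) (by norm_num)
      _ = _ := by
          rw [Real.mul_rpow (by positivity) (by positivity),
            Real.mul_rpow (by positivity) (by positivity),
            Real.mul_rpow (by positivity) (by positivity)]
  · rw [integral_const_mul, integral_prod_mul (fun x : ℝ => |x| ^ (-(11 / 12) : ℝ))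
      (fun x : ℝ => |x| ^ (-(11 / 12) : ℝ)), sumSqConst]
    exact le_of_eq (by ring)

lemma lintegral_rpow_mul_exp_eq {r : ℝ} (hr : 0 < r) :
    ∫⁻ l in Set.Ioi (0:ℝ), ENNReal.ofReal (l ^ (-(1 / 6) : ℝ) * Real.exp (-(l * r)))
      = ENNReal.ofReal (Real.Gamma (5 / 6) * r ^ (-(5 / 6) : ℝ)) := by
  have h := Real.integral_rpow_mul_exp_neg_mul_Ioi (a := 5 / 6) (r := r) (by norm_num) hr
  have hG : 0 < Real.Gamma (5 / 6) := Real.Gamma_pos_of_pos (by norm_num)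
  have h' : ∫ l in Set.Ioi (0:ℝ), l ^ (-(1 / 6) : ℝ) * Real.exp (-(l * r))
      = Real.Gamma (5 / 6) * r ^ (-(5 / 6) : ℝ) := by
    rw [Real.rpow_neg hr.le, ← Real.inv_rpow hr.le, mul_comm (Real.Gamma _), ← one_div, ← h]
    norm_num [mul_comm]
  rw [← h', ofReal_integral_eq_lintegral_ofReal]
  · exact Integrable.of_integral_ne_zero (by rw [h']; positivity)
  · exact (ae_restrict_iff' measurableSet_Ioi).2 (.of_forall fun l (hl : 0 < l) => by
      simp only [Pi.zero_apply]; positivity)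

lemma lintegral_rpow_eq_top :
    ∫⁻ l in Set.Ioi (0:ℝ), ENNReal.ofReal (l ^ (-(1 / 6) : ℝ)) = ⊤ := by
  by_contra h
  refine not_integrableOn_Ioi_rpow (-(1 / 6)) ⟨Measurable.aestronglyMeasurable (by fun_prop), ?_⟩
  rw [hasFiniteIntegral_iff_ofReal]
  · exact lt_top_iff_ne_top.2 h
  · exact (ae_restrict_iff' measurableSet_Ioi).2 (.of_forall fun l (hl : 0 < l) => by
      simp only [Pi.zero_apply]; positivity)

lemma exists_lintegral_sumSq_le : ∃ M : ℝ, 0 ≤ M ∧ ∀ (n : ℕ) (α : Fin n → ℝ),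
    ∑ i, α i ^ 2 = 1 →
    ∫⁻ β, (∫⁻ l in Set.Ioi (0:ℝ), ENNReal.ofReal (l ^ (-(1 / 6) : ℝ) * Real.exp (-(l * sumSq α β))))
      ∂(Measure.pi fun _ => ballSnd) ≤ ENNReal.ofReal M := by
  have hC0 : 0 ≤ sumSqConst := by
    unfold sumSqConst
    have : (0:ℝ) ≤ (4 / 25 : ℝ) ^ (-(11 / 12) : ℝ) := by positivity
    exact mul_nonneg this (sq_nonneg _)
  set b : ℝ → ℝ := (Set.Ioc (0:ℝ) 1).indicator (fun l => l ^ (-(1 / 6) : ℝ)) +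
    (Set.Ioi (1:ℝ)).indicator (fun l => sumSqConst * l ^ (-(13 / 12) : ℝ)) with hb
  have hb0 : ∀ l, 0 ≤ b l := by
    intro l
    refine add_nonneg (Set.indicator_nonneg (fun x hx => Real.rpow_nonneg hx.1.le _) l)
      (Set.indicator_nonneg (fun x (hx : 1 < x) => ?_) l)
    exact mul_nonneg hC0 (Real.rpow_nonneg (by linarith) _)
  have hbi : Integrable b := by
    refine Integrable.add ?_ ?_
    · rw [integrable_indicator_iff measurableSet_Ioc,
        ← intervalIntegrable_iff_integrableOn_Ioc_of_le zero_le_one]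
      exact intervalIntegral.intervalIntegrable_rpow' (by norm_num)
    · rw [integrable_indicator_iff measurableSet_Ioi]
      exact (integrableOn_Ioi_rpow_of_lt (by norm_num) one_pos).const_mul _
  refine ⟨∫ l, b l, integral_nonneg hb0, fun n α hα => ?_⟩
  rw [lintegral_lintegral_swap (Measurable.aemeasurable (by
    have := (continuous_sumSq α).measurable
    fun_prop)),
    ofReal_integral_eq_lintegral_ofReal hbi (.of_forall hb0)]
  refine le_trans (lintegral_mono_ae ?_) (lintegral_mono' Measure.restrict_le_self le_rfl)
  refine (ae_restrict_iff' measurableSet_Ioi).2 (.of_forall fun l (hl : 0 < l) => ?_)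
  have hInt : Integrable (fun β => Real.exp (-(l * sumSq α β))) (Measure.pi fun _ => ballSnd) := by
    refine Integrable.mono' (integrable_const (1:ℝ))
      (Continuous.aestronglyMeasurable (by fun_prop)) (.of_forall fun β => ?_)
    rw [Real.norm_of_nonneg (Real.exp_pos _).le]
    exact Real.exp_le_one_iff.2 (neg_nonpos.2 (mul_nonneg hl.le (sumSq_nonneg _ _)))
  rw [← ofReal_integral_eq_lintegral_ofReal (hInt.const_mul _)
    (.of_forall fun β => by positivity), integral_const_mul]
  refine ENNReal.ofReal_le_ofReal ?_
  rcases le_or_gt l 1 with h1 | h1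
  · have : b l = l ^ (-(1 / 6) : ℝ) := by
      rw [hb, Pi.add_apply, Set.indicator_of_mem (Set.mem_Ioc.2 ⟨hl, h1⟩),
        Set.indicator_of_notMem (by simpa using h1), add_zero]
    rw [this]
    refine mul_le_of_le_one_right (by positivity) ?_
    calc _ ≤ ∫ β : Fin n → ℝ × ℝ, (1:ℝ) ∂(Measure.pi fun _ => ballSnd) :=
          integral_mono hInt (integrable_const _) fun β =>
            Real.exp_le_one_iff.2 (neg_nonpos.2 (mul_nonneg hl.le (sumSq_nonneg _ _)))
      _ = 1 := by simp
  · have : b l = sumSqConst * l ^ (-(13 / 12) : ℝ) := by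
      rw [hb, Pi.add_apply, Set.indicator_of_notMem (by simp [h1]),
        Set.indicator_of_mem (Set.mem_Ioi.2 h1), zero_add]
    rw [this, show (-(13 / 12) : ℝ) = -(1 / 6) + -(11 / 12) by norm_num, Real.rpow_add hl]
    calc _ ≤ l ^ (-(1 / 6) : ℝ) * (sumSqConst * l ^ (-(11 / 12) : ℝ)) :=
          mul_le_mul_of_nonneg_left (integral_exp_neg_mul_sumSq_le α hα hl) (by positivity)
      _ = _ := by ring

lemma exists_integral_sumSq_rpow_le : ∃ M : ℝ, 0 < M ∧ ∀ (n : ℕ) (α : Fin n → ℝ),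
    ∑ i, α i ^ 2 = 1 →
    (∀ᵐ β ∂(Measure.pi fun _ : Fin n => ballSnd), 0 < sumSq α β) ∧
    Integrable (fun β => sumSq α β ^ (-(5 / 6) : ℝ)) (Measure.pi fun _ => ballSnd) ∧
    ∫ β, sumSq α β ^ (-(5 / 6) : ℝ) ∂(Measure.pi fun _ => ballSnd) ≤ M := by
  obtain ⟨M, hM, h⟩ := exists_lintegral_sumSq_le
  have hG : 0 < Real.Gamma (5 / 6) := Real.Gamma_pos_of_pos (by norm_num)
  refine ⟨M / Real.Gamma (5 / 6) + 1, by positivity, fun n α hα => ?_⟩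
  have hl := h n α hα
  have hmeas : Measurable fun β : Fin n → ℝ × ℝ => ∫⁻ l in Set.Ioi (0:ℝ),
      ENNReal.ofReal (l ^ (-(1 / 6) : ℝ) * Real.exp (-(l * sumSq α β))) := by
    refine Measurable.lintegral_prod_right' (f := fun z : (Fin n → ℝ × ℝ) × ℝ =>
      ENNReal.ofReal (z.2 ^ (-(1 / 6) : ℝ) * Real.exp (-(z.2 * sumSq α z.1)))) ?_
    have := (continuous_sumSq α).measurable
    fun_prop
  have hae : ∀ᵐ β ∂(Measure.pi fun _ : Fin n => ballSnd), 0 < sumSq α β := by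
    filter_upwards [ae_lt_top hmeas (hl.trans_lt ENNReal.ofReal_lt_top).ne] with β hβ
    refine lt_of_le_of_ne (sumSq_nonneg α β) fun h0 => ?_
    simp only [← h0, mul_zero, neg_zero, Real.exp_zero, mul_one, lintegral_rpow_eq_top] at hβ
    exact lt_irrefl _ hβ
  have hle : ∫⁻ β, ENNReal.ofReal (Real.Gamma (5 / 6) * sumSq α β ^ (-(5 / 6) : ℝ))
      ∂(Measure.pi fun _ : Fin n => ballSnd) ≤ ENNReal.ofReal M := by
    refine le_trans (le_of_eq (lintegral_congr_ae ?_)) hl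
    filter_upwards [hae] with β hβ
    exact (lintegral_rpow_mul_exp_eq hβ).symm
  have hnn : ∀ β, 0 ≤ Real.Gamma (5 / 6) * sumSq α β ^ (-(5 / 6) : ℝ) := fun β =>
    mul_nonneg hG.le (Real.rpow_nonneg (sumSq_nonneg α β) _)
  have hm : AEStronglyMeasurable (fun β => Real.Gamma (5 / 6) * sumSq α β ^ (-(5 / 6) : ℝ))
      (Measure.pi fun _ : Fin n => ballSnd) := by
    refine Measurable.aestronglyMeasurable ?_
    have := (continuous_sumSq α).measurable
    fun_prop
  have hI : Integrable (fun β => Real.Gamma (5 / 6) * sumSq α β ^ (-(5 / 6) : ℝ))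
      (Measure.pi fun _ : Fin n => ballSnd) := by
    refine ⟨hm, ?_⟩
    rw [hasFiniteIntegral_iff_ofReal (.of_forall hnn)]
    exact hle.trans_lt ENNReal.ofReal_lt_top
  have hI' : Integrable (fun β => sumSq α β ^ (-(5 / 6) : ℝ))
      (Measure.pi fun _ : Fin n => ballSnd) := by
    refine (hI.const_mul (Real.Gamma (5 / 6))⁻¹).congr (.of_forall fun β => ?_)
    simp only
    field_simp
  refine ⟨hae, hI', ?_⟩
  rw [← ofReal_integral_eq_lintegral_ofReal hI (.of_forall hnn),
    ENNReal.ofReal_le_ofReal_iff hM, integral_const_mul, mul_comm, ← le_div_iff₀ hG] at hle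
  linarith

/-! ### Integration by parts along rotations -/

section rotation

variable {n : ℕ} (f : MvPolynomial (Fin n) ℝ)

/-- The derivative of `f` at the first components in the direction of the second components. -/
def slopeFst (z : Fin n → ℝ × (ℝ × ℝ)) : ℝ :=
  MvPolynomial.eval (fun i => (z i).1) (dirDeriv (fun i => (z i).2.1) f)

/-- The derivative of `f` at the first components in the direction of the third components. -/
def slopeSnd (z : Fin n → ℝ × (ℝ × ℝ)) : ℝ :=
  MvPolynomial.eval (fun i => (z i).1) (dirDeriv (fun i => (z i).2.2) f)

lemma measurable_eval_fst : Measurable fun z : Fin n → ℝ × (ℝ × ℝ) =>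
    MvPolynomial.eval (fun i => (z i).1) f :=
  (measurable_eval_mvPolynomial f).comp (by fun_prop)

@[fun_prop]
lemma measurable_slopeFst : Measurable (slopeFst f) := by
  unfold slopeFst
  simp_rw [eval_dirDeriv]
  have := fun i => measurable_eval_fst (MvPolynomial.pderiv i f)
  fun_prop

@[fun_prop]
lemma measurable_slopeSnd : Measurable (slopeSnd f) := by
  unfold slopeSnd
  simp_rw [eval_dirDeriv]
  have := fun i => measurable_eval_fst (MvPolynomial.pderiv i f)
  fun_prop

/-- The oscillating factor damped by the weight of the first slope. -/
def dampedExp (ε : ℝ) (z : Fin n → ℝ × (ℝ × ℝ)) : ℂ :=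
  Complex.exp (Complex.I * (MvPolynomial.eval (fun i => (z i).1) f : ℝ)) *
    ((slopeFst f z ^ 2 / (ε ^ 2 + slopeFst f z ^ 2 + slopeSnd f z ^ 2) : ℝ) : ℂ)

@[fun_prop]
lemma measurable_dampedExp (ε : ℝ) : Measurable (dampedExp f ε) := by
  unfold dampedExp
  have := measurable_eval_fst f
  fun_prop

lemma norm_dampedExp_le (ε : ℝ) (z : Fin n → ℝ × (ℝ × ℝ)) : ‖dampedExp f ε z‖ ≤ 1 := by
  rw [dampedExp, norm_mul, norm_cexp_I_mul_ofReal, one_mul, Complex.norm_real,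
    Real.norm_of_nonneg (by positivity)]
  refine div_le_one_of_le₀ ?_ (by positivity)
  nlinarith [sq_nonneg ε, sq_nonneg (slopeSnd f z)]

/-- The rotation of the first two components by the angle `θ`. -/
def rotate (θ : ℝ) (z : Fin n → ℝ × (ℝ × ℝ)) : Fin n → ℝ × (ℝ × ℝ) := fun i =>
  ((z i).1 * Real.cos θ + (z i).2.1 * Real.sin θ,
    ((z i).2.1 * Real.cos θ - (z i).1 * Real.sin θ, (z i).2.2))

variable {f} in
lemma norm_integral_dampedExp_le {d : ℕ} (hf : f.totalDegree ≤ d) {ε : ℝ} (hε : 0 < ε) :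
    ‖∫ z, dampedExp f ε z ∂(Measure.pi fun _ => ballMeasure)‖ ≤ (6 * d + 2) / ε := by
  have hrot : ∀ θ, MeasurePreserving (rotate (n := n) θ) (Measure.pi fun _ => ballMeasure)
      (Measure.pi fun _ => ballMeasure) := fun θ =>
    measurePreserving_pi _ _ fun i => measurePreserving_ballMeasure_rotation θ
  have h1 : ∀ θ, ∫ z, dampedExp f ε (rotate θ z) ∂(Measure.pi fun _ => ballMeasure)
      = ∫ z, dampedExp f ε z ∂(Measure.pi fun _ => ballMeasure) := fun θ => by
    conv_rhs => rw [← (hrot θ).map_eq]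
    rw [integral_map (hrot θ).aemeasurable (measurable_dampedExp f ε).aestronglyMeasurable]
  have hπ := Real.two_pi_pos
  have hm : Measurable fun p : ℝ × (Fin n → ℝ × (ℝ × ℝ)) => dampedExp f ε (rotate p.1 p.2) := by
    refine (measurable_dampedExp f ε).comp ?_
    unfold rotate
    fun_prop
  have hInt : Integrable (Function.uncurry fun (θ : ℝ) (z : Fin n → ℝ × (ℝ × ℝ)) =>
      dampedExp f ε (rotate θ z)) ((volume.restrict (Set.Ioc 0 (2 * Real.pi))).prod
        (Measure.pi fun _ => ballMeasure)) :=
    Integrable.of_bound hm.aestronglyMeasurable 1 (.of_forall fun p => norm_dampedExp_le f ε _)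
  have h2 : ((2 * Real.pi : ℝ) : ℂ) * ∫ z, dampedExp f ε z ∂(Measure.pi fun _ => ballMeasure)
      = ∫ z, (∫ θ in (0:ℝ)..(2 * Real.pi), dampedExp f ε (rotate θ z))
        ∂(Measure.pi fun _ => ballMeasure) := by
    simp_rw [intervalIntegral.integral_of_le hπ.le]
    rw [← integral_integral_swap hInt]
    simp_rw [h1]
    simp [hπ.le]
  have h3 : ‖((2 * Real.pi : ℝ) : ℂ) * ∫ z, dampedExp f ε z
      ∂(Measure.pi fun _ => ballMeasure)‖ ≤ (6 * d + 2) / ε := by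
    rw [h2]
    refine (norm_integral_le_of_norm_le_const (C := (6 * d + 2) / ε)
      (.of_forall fun z => ?_)).trans (by simp)
    exact norm_integral_rotation_le hf (fun i => (z i).1) (fun i => (z i).2.1)
      (fun i => (z i).2.2) hε
  rw [norm_mul, Complex.norm_real, Real.norm_of_nonneg hπ.le] at h3
  refine le_trans ?_ h3
  exact le_mul_of_one_le_left (norm_nonneg _) (by linarith [Real.pi_gt_three])

variable {f} in
lemma norm_integral_cexp_ballFst_pi_le {d : ℕ} (hf : f.totalDegree ≤ d) {ε : ℝ} (hε : 0 < ε) :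
    ‖∫ x, Complex.exp (Complex.I * (MvPolynomial.eval x f : ℝ)) ∂(Measure.pi fun _ => ballFst)‖
      ≤ 2 * ((6 * d + 2) / ε) + ∫ z, ε ^ 2 / (ε ^ 2 + slopeFst f z ^ 2 + slopeSnd f z ^ 2)
          ∂(Measure.pi fun _ => ballMeasure) := by
  set κ : Measure (Fin n → ℝ × (ℝ × ℝ)) := Measure.pi fun _ => ballMeasure with hκ
  have hfst : MeasurePreserving (fun z : Fin n → ℝ × (ℝ × ℝ) => fun i => (z i).1) κ
      (Measure.pi fun _ => ballFst) :=
    measurePreserving_pi (f := fun (_ : Fin n) (x : ℝ × (ℝ × ℝ)) => x.1) _ _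
      fun i => ⟨measurable_fst, rfl⟩
  have hsw : MeasurePreserving (fun z : Fin n → ℝ × (ℝ × ℝ) => fun i =>
      ((z i).1, ((z i).2.2, (z i).2.1))) κ κ :=
    measurePreserving_pi (f := fun (_ : Fin n) (x : ℝ × (ℝ × ℝ)) => (x.1, (x.2.2, x.2.1))) _ _
      fun i => measurePreserving_ballMeasure_swap
  have hmeas := measurable_eval_mvPolynomial f
  have hmeas' := measurable_eval_fst f
  have hD : ∀ z, 0 < ε ^ 2 + slopeFst f z ^ 2 + slopeSnd f z ^ 2 := fun z => by positivity
  have hi1 : Integrable (dampedExp f ε) κ :=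
    Integrable.of_bound (measurable_dampedExp f ε).aestronglyMeasurable 1
      (.of_forall fun z => norm_dampedExp_le f ε _)
  have hi2 : Integrable (fun z => dampedExp f ε fun i => ((z i).1, ((z i).2.2, (z i).2.1))) κ :=
    hsw.integrable_comp_of_integrable hi1
  have hi12 : Integrable (fun z => dampedExp f ε z
      + dampedExp f ε fun i => ((z i).1, ((z i).2.2, (z i).2.1))) κ := hi1.add hi2
  have hw1 : ∀ z, ‖ε ^ 2 / (ε ^ 2 + slopeFst f z ^ 2 + slopeSnd f z ^ 2)‖ ≤ 1 := fun z => by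
    rw [Real.norm_of_nonneg (div_nonneg (sq_nonneg _) (hD z).le)]
    refine div_le_one_of_le₀ ?_ (hD z).le
    nlinarith [sq_nonneg (slopeFst f z), sq_nonneg (slopeSnd f z)]
  have hi4 : Integrable (fun z => ε ^ 2 / (ε ^ 2 + slopeFst f z ^ 2 + slopeSnd f z ^ 2)) κ :=
    Integrable.of_bound (Measurable.aestronglyMeasurable (by fun_prop)) 1 (.of_forall hw1)
  have hi3 : Integrable (fun z => Complex.exp (Complex.I *
      (MvPolynomial.eval (fun i => (z i).1) f : ℝ)) *
      ((ε ^ 2 / (ε ^ 2 + slopeFst f z ^ 2 + slopeSnd f z ^ 2) : ℝ) : ℂ)) κ := by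
    refine Integrable.of_bound (Measurable.aestronglyMeasurable (by fun_prop)) 1
      (.of_forall fun z => ?_)
    rw [norm_mul, norm_cexp_I_mul_ofReal, one_mul, Complex.norm_real]
    exact hw1 z
  have hsplit : ∀ z, Complex.exp (Complex.I * (MvPolynomial.eval (fun i => (z i).1) f : ℝ))
      = dampedExp f ε z + dampedExp f ε (fun i => ((z i).1, ((z i).2.2, (z i).2.1)))
        + Complex.exp (Complex.I * (MvPolynomial.eval (fun i => (z i).1) f : ℝ)) *
      ((ε ^ 2 / (ε ^ 2 + slopeFst f z ^ 2 + slopeSnd f z ^ 2) : ℝ) : ℂ) := by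
    intro z
    have e1 : slopeFst f (fun i => ((z i).1, ((z i).2.2, (z i).2.1))) = slopeSnd f z := rfl
    have e2 : slopeSnd f (fun i => ((z i).1, ((z i).2.2, (z i).2.1))) = slopeFst f z := rfl
    have h1 : slopeFst f z ^ 2 / (ε ^ 2 + slopeFst f z ^ 2 + slopeSnd f z ^ 2)
        + slopeSnd f z ^ 2 / (ε ^ 2 + slopeSnd f z ^ 2 + slopeFst f z ^ 2)
        + ε ^ 2 / (ε ^ 2 + slopeFst f z ^ 2 + slopeSnd f z ^ 2) = 1 := by
      rw [show ε ^ 2 + slopeSnd f z ^ 2 + slopeFst f z ^ 2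
        = ε ^ 2 + slopeFst f z ^ 2 + slopeSnd f z ^ 2 by ring, ← add_div, ← add_div,
        div_eq_one_iff_eq (hD z).ne']
      ring
    rw [dampedExp, dampedExp, e1, e2, ← mul_add, ← mul_add, ← Complex.ofReal_add,
      ← Complex.ofReal_add, h1, Complex.ofReal_one, mul_one]
  have hswi : ∫ z, dampedExp f ε (fun i => ((z i).1, ((z i).2.2, (z i).2.1))) ∂κ
      = ∫ z, dampedExp f ε z ∂κ := by
    conv_rhs => rw [← hsw.map_eq]
    rw [integral_map hsw.aemeasurable (measurable_dampedExp f ε).aestronglyMeasurable]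
  have hb := norm_integral_dampedExp_le hf hε
  have h3 : ‖∫ z, Complex.exp (Complex.I * (MvPolynomial.eval (fun i => (z i).1) f : ℝ)) *
      ((ε ^ 2 / (ε ^ 2 + slopeFst f z ^ 2 + slopeSnd f z ^ 2) : ℝ) : ℂ) ∂κ‖
      ≤ ∫ z, ε ^ 2 / (ε ^ 2 + slopeFst f z ^ 2 + slopeSnd f z ^ 2) ∂κ := by
    refine norm_integral_le_of_norm_le hi4 (.of_forall fun z => ?_)
    rw [norm_mul, norm_cexp_I_mul_ofReal, one_mul, Complex.norm_real,
      Real.norm_of_nonneg (div_nonneg (sq_nonneg _) (hD z).le)]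
  rw [← hfst.map_eq, integral_map hfst.aemeasurable
    (Measurable.aestronglyMeasurable (by fun_prop))]
  rw [integral_congr_ae (.of_forall hsplit), integral_add hi12 hi3,
    integral_add hi1 hi2, hswi]
  refine (norm_add_le _ _).trans (add_le_add ((norm_add_le _ _).trans ?_) h3)
  rw [two_mul]
  exact add_le_add hb hb

end rotation

/-! ### Fourier decay for the ball marginal -/

section slopes

variable {n : ℕ} (f : MvPolynomial (Fin n) ℝ)

/-- The coefficients at `x ^ J` of the partial derivatives of `f`. -/
def gradCoeff (J : Fin n →₀ ℕ) (i : Fin n) : ℝ :=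
  (J i + 1) * MvPolynomial.coeff (J + Finsupp.single i 1) f

/-- The squared length of `gradCoeff`. -/
def gradSq (J : Fin n →₀ ℕ) : ℝ := ∑ i, gradCoeff f J i ^ 2

lemma gradSq_nonneg (J : Fin n →₀ ℕ) : 0 ≤ gradSq f J := Finset.sum_nonneg fun _ _ => sq_nonneg _

/-- The unit vector in the direction of `gradCoeff`. -/
def gradDir (J : Fin n →₀ ℕ) (i : Fin n) : ℝ := gradCoeff f J i / Real.sqrt (gradSq f J)

variable {f}

lemma sum_gradDir_sq {J : Fin n →₀ ℕ} (h : 0 < gradSq f J) : ∑ i, gradDir f J i ^ 2 = 1 := by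
  simp only [gradDir, div_pow, Real.sq_sqrt h.le, ← Finset.sum_div]
  exact div_self h.ne'

lemma sumSq_gradCoeff (J : Fin n →₀ ℕ) (β : Fin n → ℝ × ℝ) :
    sumSq (gradCoeff f J) β = gradSq f J * sumSq (gradDir f J) β := by
  rcases (gradSq_nonneg f J).eq_or_lt with h | h
  · have : ∀ i, gradCoeff f J i = 0 := fun i => by
      have := (Finset.sum_eq_zero_iff_of_nonneg fun i _ => sq_nonneg (gradCoeff f J i)).1 h.symm i
        (Finset.mem_univ i)
      simpa using this
    rw [← h, zero_mul, sumSq]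
    simp [this]
  · have h1 : ∀ i, gradCoeff f J i = Real.sqrt (gradSq f J) * gradDir f J i := fun i => by
      have := Real.sqrt_pos.2 h
      rw [gradDir]
      field_simp
    simp only [sumSq, h1, mul_assoc, ← Finset.mul_sum, mul_pow, Real.sq_sqrt h.le]
    ring

lemma topSq_slopes {m : ℕ} (hf : f.totalDegree ≤ m + 1) (σ : Fin n → ℝ) (β : Fin n → ℝ × ℝ) :
    topSq m (affSubst 0 σ (dirDeriv (fun i => (β i).1) f))
      + topSq m (affSubst 0 σ (dirDeriv (fun i => (β i).2) f))
      = ∑ J ∈ topExp n m with 0 < gradSq f J,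
          gradSq f J * ((∏ i, σ i ^ J i) ^ 2 * sumSq (gradDir f J) β) := by
  rw [topSq_affSubst _ _ (totalDegree_dirDeriv_le _ hf),
    topSq_affSubst _ _ (totalDegree_dirDeriv_le _ hf), ← Finset.sum_add_distrib,
    Finset.sum_filter]
  refine Finset.sum_congr rfl fun J _ => ?_
  have h1 : (∏ i, σ i ^ J i) ^ 2 * MvPolynomial.coeff J (dirDeriv (fun i => (β i).1) f) ^ 2
      + (∏ i, σ i ^ J i) ^ 2 * MvPolynomial.coeff J (dirDeriv (fun i => (β i).2) f) ^ 2
      = (∏ i, σ i ^ J i) ^ 2 * sumSq (gradCoeff f J) β := by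
    rw [coeff_dirDeriv, coeff_dirDeriv, sumSq, mul_add]
    simp only [gradCoeff, mul_comm]
  rw [h1, sumSq_gradCoeff]
  split_ifs with h
  · ring
  · rw [le_antisymm (not_lt.1 h) (gradSq_nonneg f J)]; ring

lemma topSq_le_sum_gradSq (m : ℕ) :
    topSq (m + 1) f ≤ ∑ J ∈ topExp n m with 0 < gradSq f J, gradSq f J := by
  refine (topSq_le_sum_pderiv f m).trans (le_of_eq ?_)
  rw [Finset.sum_filter]
  refine Finset.sum_congr rfl fun J _ => ?_
  split_ifs with h
  · rfl
  · exact le_antisymm (not_lt.1 h) (gradSq_nonneg f J)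

end slopes

lemma rpow_mul_le_young {a b : ℝ} (ha : 0 ≤ a) (hb : 0 ≤ b) :
    a * b ≤ a ^ (5 / 2 : ℝ) + b ^ (5 / 3 : ℝ) := by
  have h := Real.young_inequality_of_nonneg ha hb
    (p := 5 / 2) (q := 5 / 3) (Real.holderConjugate_iff.2 (by norm_num))
  have h1 := Real.rpow_nonneg ha (5 / 2)
  have h2 := Real.rpow_nonneg hb (5 / 3)
  linarith

lemma rpow_neg_le_one_add {R x y : ℝ} (hR : 0 < R) (hx : 0 ≤ x) (hxy : x ≤ y) :
    R ^ (-x) ≤ 1 + R ^ (-y) := by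
  rcases le_or_gt R 1 with h | h
  · have := Real.rpow_le_rpow_of_exponent_ge hR h (neg_le_neg hxy)
    linarith
  · have := Real.rpow_le_one_of_one_le_of_nonpos h.le (neg_nonpos.2 hx)
    have := Real.rpow_nonneg hR.le (-y)
    linarith

/-- Negative powers of a monomial times a squared length split into a sum. -/
lemma monomial_mul_rpow_neg_le {n m : ℕ} (hm : 1 ≤ m) {J : Fin n →₀ ℕ} (hJ : J.degree = m)
    {σ : Fin n → ℝ} (hσ : ∀ i, 0 < σ i) {R : ℝ} (hR : 0 < R) :
    ((∏ i, σ i ^ J i) ^ 2 * R) ^ (-(1 / (2 * m) : ℝ))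
      ≤ ∑ i, (J i / m : ℝ) * σ i ^ (-(5 / 2) : ℝ) + (1 + R ^ (-(5 / 6) : ℝ)) := by
  have hm0 : (0:ℝ) < m := by exact_mod_cast hm
  have hm1 : (1:ℝ) ≤ m := by exact_mod_cast hm
  have hP : 0 < ∏ i, σ i ^ J i := Finset.prod_pos fun i _ => pow_pos (hσ i) _
  rw [Real.mul_rpow (by positivity) hR.le, prod_pow_sq_rpow_neg hσ]
  refine (rpow_mul_le_young (Finset.prod_nonneg fun i _ => Real.rpow_nonneg (hσ i).le _)
    (Real.rpow_nonneg hR.le _)).trans (add_le_add ?_ ?_)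
  · rw [← Real.finsetProd_rpow _ _ fun i _ => Real.rpow_nonneg (hσ i).le _]
    have h := Real.geom_mean_le_arith_mean_weighted Finset.univ (fun i => (J i / m : ℝ))
      (fun i => σ i ^ (-(5 / 2) : ℝ)) (fun i _ => by positivity) (by
        rw [← Finset.sum_div, ← Nat.cast_sum, ← Finsupp.degree_eq_sum, hJ, div_self hm0.ne'])
      (fun i _ => Real.rpow_nonneg (hσ i).le _)
    refine le_trans (le_of_eq (Finset.prod_congr rfl fun i _ => ?_)) h
    rw [← Real.rpow_mul (hσ i).le, ← Real.rpow_mul (hσ i).le]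
    congr 1
    field_simp
  · rw [← Real.rpow_mul hR.le, neg_mul]
    refine rpow_neg_le_one_add hR (by positivity) ?_
    rw [div_mul_div_comm, div_le_div_iff₀ (by positivity) (by norm_num)]
    linarith

lemma SmallBall.integral_two_le {m : ℕ} (hm : 1 ≤ m) {ν : Measure ℝ} [IsProbabilityMeasure ν]
    {K : ℝ} (hK : 0 < K)
    (h : ∀ (n : ℕ) (u : MvPolynomial (Fin n) ℝ), u.totalDegree ≤ m → 0 < topSq m u →
      ∫ x, 1 / (1 + MvPolynomial.eval x u ^ 2) ∂Measure.pi (fun _ => ν)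
        ≤ K * topSq m u ^ (-(1 / (2 * m) : ℝ)))
    {n : ℕ} {u v : MvPolynomial (Fin n) ℝ} (hu : u.totalDegree ≤ m) (hv : v.totalDegree ≤ m)
    (hW : 0 < topSq m u + topSq m v) {ε : ℝ} (hε : 0 < ε) :
    ∫ x, ε ^ 2 / (ε ^ 2 + MvPolynomial.eval x u ^ 2 + MvPolynomial.eval x v ^ 2)
        ∂Measure.pi (fun _ => ν)
      ≤ K * ((ε ^ 2)⁻¹ / 2) ^ (-(1 / (2 * m) : ℝ))
        * (topSq m u + topSq m v) ^ (-(1 / (2 * m) : ℝ)) := by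
  wlog huv : topSq m v ≤ topSq m u generalizing u v
  · have := this hv hu (by linarith) (le_of_not_ge huv)
    rw [add_comm (topSq m u)]
    refine le_trans (le_of_eq ?_) this
    refine integral_congr_ae (.of_forall fun x => ?_)
    simp only
    ring
  have hu0 : 0 < topSq m u := by linarith
  have hC : topSq m (MvPolynomial.C ε⁻¹ * u) = (ε ^ 2)⁻¹ * topSq m u := by
    rw [topSq_C_mul, inv_pow]
  have h1 := h n (MvPolynomial.C ε⁻¹ * u) ((totalDegree_C_mul_le _ _).trans hu)
    (by rw [hC]; positivity)
  have hmu := measurable_eval_mvPolynomial u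
  have hmv := measurable_eval_mvPolynomial v
  calc _ ≤ ∫ x, 1 / (1 + MvPolynomial.eval x (MvPolynomial.C ε⁻¹ * u) ^ 2)
          ∂Measure.pi (fun _ => ν) := by
        refine integral_mono ?_ (integrable_one_div_one_add_sq _
          (measurable_eval_mvPolynomial _)) fun x => ?_
        · refine Integrable.of_bound (Measurable.aestronglyMeasurable (by fun_prop)) 1
            (.of_forall fun x => ?_)
          rw [Real.norm_of_nonneg (by positivity)]
          refine div_le_one_of_le₀ ?_ (by positivity)
          nlinarith [sq_nonneg (MvPolynomial.eval x u), sq_nonneg (MvPolynomial.eval x v)]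
        · simp only [map_mul, MvPolynomial.eval_C]
          rw [div_le_div_iff₀ (by positivity) (by positivity), one_mul, mul_pow, inv_pow, mul_add,
            mul_one, ← mul_assoc, mul_inv_cancel₀ (by positivity), one_mul]
          linarith [sq_nonneg (MvPolynomial.eval x v)]
    _ ≤ K * ((ε ^ 2)⁻¹ * topSq m u) ^ (-(1 / (2 * m) : ℝ)) := by rw [← hC]; exact h1
    _ ≤ K * ((ε ^ 2)⁻¹ / 2 * (topSq m u + topSq m v)) ^ (-(1 / (2 * m) : ℝ)) := by
        refine mul_le_mul_of_nonneg_left (Real.rpow_le_rpow_of_nonpos (by positivity) ?_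
          (neg_nonpos.2 (by positivity))) hK.le
        have : 0 < (ε ^ 2)⁻¹ := by positivity
        nlinarith
    _ = _ := by rw [Real.mul_rpow (by positivity) hW.le, mul_assoc]

/-- The sum of negative moments controlling the slopes. -/
def slopeBound {n : ℕ} (f : MvPolynomial (Fin n) ℝ) (m : ℕ) (β : Fin n → ℝ × ℝ) : ℝ :=
  ∑ J ∈ topExp n m with 0 < gradSq f J,
    gradSq f J / (∑ J ∈ topExp n m with 0 < gradSq f J, gradSq f J) *
      (∑ i, (J i / m : ℝ) * halfChord (β i) ^ (-(5 / 2) : ℝ)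
        + (1 + sumSq (gradDir f J) β ^ (-(5 / 6) : ℝ)))

lemma exists_integral_slopeBound_le : ∃ M : ℝ, 0 < M ∧ ∀ (n m : ℕ) (f : MvPolynomial (Fin n) ℝ),
    1 ≤ m → 0 < topSq (m + 1) f →
    (∀ᵐ β ∂(Measure.pi fun _ : Fin n => ballSnd), (∀ i, 0 < halfChord (β i)) ∧
      ∀ J ∈ topExp n m, 0 < gradSq f J → 0 < sumSq (gradDir f J) β) ∧
    Integrable (slopeBound f m) (Measure.pi fun _ => ballSnd) ∧
    ∫ β, slopeBound f m β ∂(Measure.pi fun _ => ballSnd) ≤ M := by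
  obtain ⟨M, hM, h⟩ := exists_integral_sumSq_rpow_le
  set M₁ := ∫ β, halfChord β ^ (-(5 / 2) : ℝ) ∂ballSnd with hM₁
  have hM₁0 : 0 ≤ M₁ := integral_nonneg fun β => Real.rpow_nonneg (halfChord_nonneg β) _
  refine ⟨M₁ + (1 + M), by positivity, fun n m f hm hf => ?_⟩
  have hm0 : (0:ℝ) < m := by exact_mod_cast hm
  have hev : ∀ i : Fin n, MeasurePreserving (fun β : Fin n → ℝ × ℝ => β i)
      (Measure.pi fun _ => ballSnd) ballSnd := fun i =>
    measurePreserving_eval (fun _ : Fin n => ballSnd) i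
  have hchord : ∀ i : Fin n, Integrable (fun β : Fin n → ℝ × ℝ => halfChord (β i) ^ (-(5 / 2) : ℝ))
      (Measure.pi fun _ => ballSnd) := fun i =>
    (hev i).integrable_comp_of_integrable integrable_halfChord_rpow
  have hchordI : ∀ i : Fin n, ∫ β : Fin n → ℝ × ℝ, halfChord (β i) ^ (-(5 / 2) : ℝ)
      ∂(Measure.pi fun _ => ballSnd) = M₁ := fun i => by
    rw [hM₁]
    conv_rhs => rw [← (hev i).map_eq]
    rw [integral_map (hev i).aemeasurable (Measurable.aestronglyMeasurable (by fun_prop))]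
  set T := ∑ J ∈ topExp n m with 0 < gradSq f J, gradSq f J with hT
  have hT0 : 0 < T := hf.trans_le (topSq_le_sum_gradSq m)
  have hterm : ∀ J ∈ (topExp n m).filter (fun J => 0 < gradSq f J),
      Integrable (fun β : Fin n → ℝ × ℝ => ∑ i, (J i / m : ℝ) * halfChord (β i) ^ (-(5 / 2) : ℝ)
        + (1 + sumSq (gradDir f J) β ^ (-(5 / 6) : ℝ))) (Measure.pi fun _ => ballSnd) ∧
      ∫ β : Fin n → ℝ × ℝ, (∑ i, (J i / m : ℝ) * halfChord (β i) ^ (-(5 / 2) : ℝ)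
        + (1 + sumSq (gradDir f J) β ^ (-(5 / 6) : ℝ))) ∂(Measure.pi fun _ => ballSnd)
        ≤ M₁ + (1 + M) := by
    intro J hJ
    rw [Finset.mem_filter, mem_topExp] at hJ
    obtain ⟨-, hi, hb⟩ := h n (gradDir f J) (sum_gradDir_sq hJ.2)
    have hs : Integrable (fun β : Fin n → ℝ × ℝ =>
        ∑ i, (J i / m : ℝ) * halfChord (β i) ^ (-(5 / 2) : ℝ)) (Measure.pi fun _ => ballSnd) :=
      integrable_finsetSum _ fun i _ => (hchord i).const_mul _
    have h1 : Integrable (fun β : Fin n → ℝ × ℝ => 1 + sumSq (gradDir f J) β ^ (-(5 / 6) : ℝ))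
        (Measure.pi fun _ => ballSnd) := (integrable_const 1).add hi
    refine ⟨hs.add h1, ?_⟩
    rw [integral_add hs h1, integral_add (integrable_const 1) hi,
      integral_finsetSum _ fun i _ => (hchord i).const_mul _]
    simp_rw [integral_const_mul, hchordI]
    rw [← Finset.sum_mul, ← Finset.sum_div, ← Nat.cast_sum, ← Finsupp.degree_eq_sum, hJ.1,
      div_self hm0.ne', one_mul]
    simpa using hb
  refine ⟨?_, ?_, ?_⟩
  · have h1 : ∀ᵐ β ∂(Measure.pi fun _ : Fin n => ballSnd), ∀ i, 0 < halfChord (β i) :=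
      ae_all_iff.2 fun i => (hev i).quasiMeasurePreserving.ae ae_halfChord_pos
    have h2 : ∀ᵐ β ∂(Measure.pi fun _ : Fin n => ballSnd), ∀ J ∈ topExp n m,
        0 < gradSq f J → 0 < sumSq (gradDir f J) β := by
      refine (Finset.eventually_all _).2 fun J _ => ?_
      by_cases hJ : 0 < gradSq f J
      · filter_upwards [(h n (gradDir f J) (sum_gradDir_sq hJ)).1] with β hβ _ using hβ
      · exact .of_forall fun β hJ' => absurd hJ' hJ
    exact h1.and h2
  · exact integrable_finsetSum _ fun J hJ => (hterm J hJ).1.const_mul _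
  · unfold slopeBound
    rw [integral_finsetSum _ fun J hJ => (hterm J hJ).1.const_mul _]
    simp_rw [integral_const_mul]
    calc _ ≤ ∑ J ∈ topExp n m with 0 < gradSq f J, gradSq f J / T * (M₁ + (1 + M)) :=
          Finset.sum_le_sum fun J hJ => mul_le_mul_of_nonneg_left (hterm J hJ).2
            (div_nonneg (gradSq_nonneg f J) hT0.le)
      _ = M₁ + (1 + M) := by
          rw [← Finset.sum_mul, ← Finset.sum_div, ← hT, div_self hT0.ne', one_mul]

lemma integral_slopes_le {m : ℕ} (hm : 1 ≤ m) {K : ℝ} (hK : 0 < K)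
    (h : ∀ (n : ℕ) (u : MvPolynomial (Fin n) ℝ), u.totalDegree ≤ m → 0 < topSq m u →
      ∫ x, 1 / (1 + MvPolynomial.eval x u ^ 2) ∂Measure.pi (fun _ => unifMeasure)
        ≤ K * topSq m u ^ (-(1 / (2 * m) : ℝ)))
    {n : ℕ} {f : MvPolynomial (Fin n) ℝ} (hf : f.totalDegree ≤ m + 1)
    (hT : 0 < topSq (m + 1) f) {ε : ℝ} (hε : 0 < ε) {β : Fin n → ℝ × ℝ}
    (hβ : ∀ i, 0 < halfChord (β i))
    (hβ' : ∀ J ∈ topExp n m, 0 < gradSq f J → 0 < sumSq (gradDir f J) β) :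
    ∫ y, ε ^ 2 / (ε ^ 2 + slopeFst f (fun i => (halfChord (β i) * y i, β i)) ^ 2
        + slopeSnd f (fun i => (halfChord (β i) * y i, β i)) ^ 2)
        ∂Measure.pi (fun _ => unifMeasure)
      ≤ K * ((ε ^ 2)⁻¹ / 2) ^ (-(1 / (2 * m) : ℝ)) *
        (topSq (m + 1) f ^ (-(1 / (2 * m) : ℝ)) * slopeBound f m β) := by
  set σ : Fin n → ℝ := fun i => halfChord (β i) with hσ
  set u := affSubst 0 σ (dirDeriv (fun i => (β i).1) f)
  set v := affSubst 0 σ (dirDeriv (fun i => (β i).2) f)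
  have hu : u.totalDegree ≤ m := totalDegree_affSubst_le _ _ (totalDegree_dirDeriv_le _ hf)
  have hv : v.totalDegree ≤ m := totalDegree_affSubst_le _ _ (totalDegree_dirDeriv_le _ hf)
  have hS := topSq_slopes hf σ β
  have hle := topSq_le_sum_gradSq (f := f) m
  have hT' := hT.trans_le hle
  have hX : ∀ J ∈ (topExp n m).filter (fun J => 0 < gradSq f J),
      0 < (∏ i, σ i ^ J i) ^ 2 * sumSq (gradDir f J) β := fun J hJ => by
    rw [Finset.mem_filter] at hJ
    exact mul_pos (pow_pos (Finset.prod_pos fun i _ => pow_pos (hβ i) _) 2) (hβ' J hJ.1 hJ.2)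
  have hW : 0 < topSq m u + topSq m v := by
    rw [hS]
    refine Finset.sum_pos (fun J hJ => mul_pos (Finset.mem_filter.1 hJ).2 (hX J hJ)) ?_
    by_contra hne
    rw [Finset.not_nonempty_iff_eq_empty.1 hne] at hT'
    simp at hT'
  have e1 : ∀ y : Fin n → ℝ, slopeFst f (fun i => (halfChord (β i) * y i, β i))
      = MvPolynomial.eval y u := fun y => by
    simp only [u, eval_affSubst, slopeFst, Pi.zero_apply, zero_add, hσ]
  have e2 : ∀ y : Fin n → ℝ, slopeSnd f (fun i => (halfChord (β i) * y i, β i))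
      = MvPolynomial.eval y v := fun y => by
    simp only [v, eval_affSubst, slopeSnd, Pi.zero_apply, zero_add, hσ]
  simp_rw [e1, e2]
  refine (SmallBall.integral_two_le hm hK (h) hu hv hW hε).trans
    (mul_le_mul_of_nonneg_left ?_ (by positivity))
  rw [hS]
  refine (rpow_neg_sum_le_of_pos _ (by positivity) (fun J _ => gradSq_nonneg f J) hT' hX).trans ?_
  refine mul_le_mul (Real.rpow_le_rpow_of_nonpos hT hle (neg_nonpos.2 (by positivity))) ?_
    (Finset.sum_nonneg fun J hJ => mul_nonneg (div_nonneg (gradSq_nonneg f J) hT'.le)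
      (Real.rpow_nonneg (hX J hJ).le _)) (by positivity)
  refine Finset.sum_le_sum fun J hJ => mul_le_mul_of_nonneg_left ?_
    (div_nonneg (gradSq_nonneg f J) hT'.le)
  rw [Finset.mem_filter] at hJ
  exact monomial_mul_rpow_neg_le hm (mem_topExp.1 hJ.1) hβ (hβ' J hJ.1 hJ.2)

theorem SmallBall.fourierDecay_ballFst {m : ℕ} (hm : 1 ≤ m) (h : SmallBall unifMeasure m) :
    FourierDecay ballFst (m + 1) := by
  obtain ⟨K, hK, hb⟩ := h
  obtain ⟨M, hM, hMb⟩ := exists_integral_slopeBound_le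
  have hm0 : (0:ℝ) < m := by exact_mod_cast hm
  refine ⟨2 * (6 * (m + 1 : ℕ) + 2) + K * (1 / 2) ^ (-(1 / (2 * m) : ℝ)) * M, by positivity,
    fun n f hf hT => ?_⟩
  set T := topSq (m + 1) f with hTdef
  set ε : ℝ := T ^ (1 / (2 * (m + 1 : ℕ)) : ℝ) with hε
  have hε0 : 0 < ε := by positivity
  obtain ⟨hae, hInt, hle⟩ := hMb n m f hm hT
  refine (norm_integral_cexp_ballFst_pi_le hf hε0).trans ?_
  have hmp := measurePreserving_pi_mixture (fun _ : Fin n => ballSnd) (fun _ => unifMeasure)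
    (fun _ => ballMeasure) fun _ => measurePreserving_chord
  have hmeas : Measurable fun z : Fin n → ℝ × (ℝ × ℝ) =>
      ε ^ 2 / (ε ^ 2 + slopeFst f z ^ 2 + slopeSnd f z ^ 2) := by fun_prop
  have hi : Integrable (fun z : Fin n → ℝ × (ℝ × ℝ) =>
      ε ^ 2 / (ε ^ 2 + slopeFst f z ^ 2 + slopeSnd f z ^ 2)) (Measure.pi fun _ => ballMeasure) := by
    refine Integrable.of_bound hmeas.aestronglyMeasurable 1 (.of_forall fun z => ?_)
    rw [Real.norm_of_nonneg (by positivity)]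
    refine div_le_one_of_le₀ ?_ (by positivity)
    nlinarith [sq_nonneg (slopeFst f z), sq_nonneg (slopeSnd f z)]
  have h2 : ∫ z, ε ^ 2 / (ε ^ 2 + slopeFst f z ^ 2 + slopeSnd f z ^ 2)
      ∂(Measure.pi fun _ => ballMeasure)
      ≤ K * ((ε ^ 2)⁻¹ / 2) ^ (-(1 / (2 * m) : ℝ)) * (T ^ (-(1 / (2 * m) : ℝ)) * M) := by
    have hi' := hmp.integrable_comp_of_integrable hi
    rw [← hmp.map_eq, integral_map hmp.aemeasurable hmeas.aestronglyMeasurable]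
    refine (integral_prod _ hi').trans_le ?_
    refine (integral_mono_ae hi'.integral_prod_left
      ((hInt.const_mul (T ^ (-(1 / (2 * m) : ℝ)))).const_mul
        (K * ((ε ^ 2)⁻¹ / 2) ^ (-(1 / (2 * m) : ℝ)))) ?_).trans ?_
    · filter_upwards [hae] with β hβ
      exact integral_slopes_le hm hK hb hf hT hε0 hβ.1 hβ.2
    · rw [integral_const_mul, integral_const_mul]
      gcongr
  have e1 : (ε : ℝ)⁻¹ = T ^ (-(1 / (2 * (m + 1 : ℕ)) : ℝ)) := by
    rw [hε, ← Real.rpow_neg hT.le]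
  have e2 : ((ε ^ 2)⁻¹ / 2) ^ (-(1 / (2 * m) : ℝ)) * T ^ (-(1 / (2 * m) : ℝ))
      = (1 / 2) ^ (-(1 / (2 * m) : ℝ)) * T ^ (-(1 / (2 * (m + 1 : ℕ)) : ℝ)) := by
    rw [div_eq_mul_one_div, Real.mul_rpow (by positivity) (by norm_num), ← inv_pow, e1,
      ← Real.rpow_natCast, ← Real.rpow_mul hT.le, ← Real.rpow_mul hT.le,
      mul_right_comm, ← Real.rpow_add hT, mul_comm]
    congr 2
    push_cast
    field_simp
    ring
  calc _ ≤ 2 * ((6 * (m + 1 : ℕ) + 2) / ε)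
        + K * ((ε ^ 2)⁻¹ / 2) ^ (-(1 / (2 * m) : ℝ)) * (T ^ (-(1 / (2 * m) : ℝ)) * M) := by
        gcongr
    _ = 2 * (6 * (m + 1 : ℕ) + 2) * ε⁻¹ + K * M * (((ε ^ 2)⁻¹ / 2) ^ (-(1 / (2 * m) : ℝ))
        * T ^ (-(1 / (2 * m) : ℝ))) := by ring
    _ = _ := by rw [e1, e2]; ring

/-! ### The uniform measure as a mixture of affine images of the ball marginal -/

/-- The law of the centre and the half-length in a representation of the uniform measure as a
mixture of affine images of the ball marginal. -/
def unifMixture : Measure (ℝ × ℝ) :=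
  (3⁻¹ : ENNReal) • (Measure.dirac (0, 1) +
    ((volume.restrict (Set.Ioc (0:ℝ) 1)).map (fun r => (r - 1, r)) +
      (volume.restrict (Set.Ioc (0:ℝ) 1)).map (fun r => (1 - r, r))))

instance : IsProbabilityMeasure unifMixture := ⟨by
  rw [unifMixture, Measure.smul_apply, Measure.add_apply, Measure.add_apply,
    Measure.map_apply (by fun_prop) MeasurableSet.univ,
    Measure.map_apply (by fun_prop) MeasurableSet.univ]
  simp only [measure_univ, Set.preimage_univ, Measure.restrict_apply_univ, Real.volume_Ioc]
  norm_num
  exact ENNReal.inv_mul_cancel (by norm_num) (by norm_num)⟩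

lemma integrable_unifMixture {g : ℝ × ℝ → ℝ} (hg : Measurable g)
    (h1 : IntegrableOn (fun r => g (r - 1, r)) (Set.Ioc 0 1))
    (h2 : IntegrableOn (fun r => g (1 - r, r)) (Set.Ioc 0 1)) : Integrable g unifMixture := by
  refine Integrable.smul_measure ?_ (by norm_num)
  refine Integrable.add_measure (integrable_dirac (by simp)) (Integrable.add_measure ?_ ?_)
  · exact (integrable_map_measure hg.aestronglyMeasurable (by fun_prop)).2 h1
  · exact (integrable_map_measure hg.aestronglyMeasurable (by fun_prop)).2 h2

lemma integral_unifMixture {g : ℝ × ℝ → ℝ} (hg : Measurable g)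
    (h1 : IntegrableOn (fun r => g (r - 1, r)) (Set.Ioc 0 1))
    (h2 : IntegrableOn (fun r => g (1 - r, r)) (Set.Ioc 0 1)) :
    ∫ p, g p ∂unifMixture = (1 / 3 : ℝ) * (g (0, 1) +
      ((∫ r in (0:ℝ)..1, g (r - 1, r)) + ∫ r in (0:ℝ)..1, g (1 - r, r))) := by
  have i1 := (integrable_map_measure hg.aestronglyMeasurable
    (show Measurable fun r : ℝ => (r - 1, r) by fun_prop).aemeasurable).2 h1
  have i2 := (integrable_map_measure hg.aestronglyMeasurable
    (show Measurable fun r : ℝ => (1 - r, r) by fun_prop).aemeasurable).2 h2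
  rw [unifMixture, integral_smul_measure, integral_add_measure (integrable_dirac (by simp))
    (i1.add_measure i2), integral_add_measure i1 i2, integral_dirac,
    integral_map (by fun_prop) hg.aestronglyMeasurable,
    integral_map (by fun_prop) hg.aestronglyMeasurable,
    intervalIntegral.integral_of_le zero_le_one, intervalIntegral.integral_of_le zero_le_one]
  norm_num

/-- Averaging the dilations about an endpoint of a function over the ball marginal. -/
lemma integral_ballFst_dilate {g : ℝ → ℝ} (hg : Continuous g) :
    ∫ a in (-1 : ℝ)..1, 3 / 4 * (1 - a ^ 2) * ∫ r in (0:ℝ)..1, g (r * (1 + a))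
      = ∫ b in (0:ℝ)..2, 3 / 8 * (2 - b) ^ 2 * g b := by
  have e1 : ∀ a : ℝ, 3 / 4 * (1 - a ^ 2) * ∫ r in (0:ℝ)..1, g (r * (1 + a))
      = (fun b : ℝ => 3 / 4 * (2 - b) * ∫ s in (0:ℝ)..b, g s) (a + 1) := fun a => by
    have := intervalIntegral.mul_integral_comp_mul_right (a := 0) (b := 1) (f := g) (1 + a)
    simp only
    rw [zero_mul, one_mul] at this
    rw [add_comm a 1, ← this]
    ring
  simp_rw [e1]
  rw [intervalIntegral.integral_comp_add_right
    (fun b : ℝ => 3 / 4 * (2 - b) * ∫ s in (0:ℝ)..b, g s)]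
  norm_num
  have hF : ∀ b ∈ Set.uIcc (0:ℝ) 2, HasDerivAt
      (fun b : ℝ => -(3 / 8 * (2 - b) ^ 2) * ∫ s in (0:ℝ)..b, g s)
      (3 / 4 * (2 - b) * (∫ s in (0:ℝ)..b, g s) - 3 / 8 * (2 - b) ^ 2 * g b) b := fun b _ => by
    have h1 : HasDerivAt (fun b : ℝ => -(3 / 8 * (2 - b) ^ 2)) (3 / 4 * (2 - b)) b :=
      (((((hasDerivAt_id b).const_sub 2).fun_pow 2).const_mul (3 / 8)).fun_neg).congr_deriv
        (by simp; ring)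
    exact (h1.fun_mul (hg.integral_hasStrictDerivAt 0 b).hasDerivAt).congr_deriv (by ring)
  have hc : Continuous fun b : ℝ => ∫ s in (0:ℝ)..b, g s :=
    intervalIntegral.continuous_primitive (fun a b => hg.intervalIntegrable a b) 0
  have hi := intervalIntegral.integral_eq_sub_of_hasDerivAt hF
    (Continuous.intervalIntegrable (by fun_prop) _ _)
  rw [intervalIntegral.integral_sub (Continuous.intervalIntegrable (by fun_prop) _ _)
    (Continuous.intervalIntegrable (by fun_prop) _ _)] at hi
  simp at hi
  linarith

lemma integral_ballFst_contract {g : ℝ → ℝ} (hg : Continuous g) :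
    ∫ r in (0:ℝ)..1, (∫ a, g (r * (1 + a)) ∂ballFst)
      = ∫ b in (0:ℝ)..2, 3 / 8 * (2 - b) ^ 2 * g b := by
  rw [← integral_ballFst_dilate hg]
  simp_rw [integral_ballFst, smul_eq_mul]
  rw [intervalIntegral_intervalIntegral_swap]
  · simp_rw [intervalIntegral.integral_const_mul]
  · refine IntegrableOn.mono_set (t := Set.uIcc (0:ℝ) 1 ×ˢ Set.uIcc (-1:ℝ) 1)
      ((Continuous.continuousOn ?_).integrableOn_compact (isCompact_uIcc.prod isCompact_uIcc))
      (Set.prod_mono Set.uIoc_subset_uIcc Set.uIoc_subset_uIcc)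
    simp only [Function.uncurry_def]
    fun_prop

lemma measurePreserving_unifMixture :
    MeasurePreserving (fun z : (ℝ × ℝ) × ℝ => z.1.1 + z.1.2 * z.2)
      (unifMixture.prod ballFst) unifMeasure := by
  have hm : Measurable fun z : (ℝ × ℝ) × ℝ => z.1.1 + z.1.2 * z.2 := by fun_prop
  refine ⟨hm, ?_⟩
  have := Measure.isProbabilityMeasure_map (μ := unifMixture.prod ballFst) hm.aemeasurable
  refine ext_of_forall_integral_eq_of_IsFiniteMeasure fun h => ?_
  have hh := h.continuous
  have hb : ∀ x, ‖h x‖ ≤ ‖h‖ := h.norm_coe_le_norm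
  rw [integral_map hm.aemeasurable hh.aestronglyMeasurable]
  have hInt : Integrable (fun z : (ℝ × ℝ) × ℝ => h (z.1.1 + z.1.2 * z.2))
      (unifMixture.prod ballFst) :=
    Integrable.of_bound (hh.measurable.comp hm).aestronglyMeasurable ‖h‖ (.of_forall fun z => hb _)
  have hgm : StronglyMeasurable fun p : ℝ × ℝ => ∫ a, h (p.1 + p.2 * a) ∂ballFst :=
    StronglyMeasurable.integral_prod_right (f := fun (p : ℝ × ℝ) (a : ℝ) => h (p.1 + p.2 * a))
      (hh.measurable.comp hm).stronglyMeasurable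
  have hgb : ∀ p : ℝ × ℝ, ‖∫ a, h (p.1 + p.2 * a) ∂ballFst‖ ≤ ‖h‖ := fun p =>
    (norm_integral_le_of_norm_le_const (C := ‖h‖) (.of_forall fun a => hb _)).trans (by simp)
  rw [integral_prod _ hInt, integral_unifMixture hgm.measurable]
  · have c1 : ∫ r in (0:ℝ)..1, (∫ a, h (r - 1 + r * a) ∂ballFst)
        = ∫ x in (-1:ℝ)..1, 3 / 8 * (1 - x) ^ 2 * h x := by
      have := integral_ballFst_contract (g := fun b => h (b - 1)) (by fun_prop)
      have e : ∀ r a : ℝ, r * (1 + a) - 1 = r - 1 + r * a := fun r a => by ring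
      simp_rw [e] at this
      rw [this]
      have h2 := intervalIntegral.integral_comp_sub_right (a := 0) (b := 2)
        (fun x : ℝ => 3 / 8 * (1 - x) ^ 2 * h x) 1
      norm_num at h2
      rw [← h2]
      refine intervalIntegral.integral_congr fun b _ => ?_
      ring_nf
    have c2 : ∫ r in (0:ℝ)..1, (∫ a, h (1 - r + r * a) ∂ballFst)
        = ∫ x in (-1:ℝ)..1, 3 / 8 * (1 + x) ^ 2 * h x := by
      have := integral_ballFst_contract (g := fun b => h (1 - b)) (by fun_prop)
      have e : ∀ r : ℝ, ∫ a, h (1 - r * (1 + a)) ∂ballFst = ∫ a, h (1 - r + r * a) ∂ballFst := by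
        intro r
        have h3 := intervalIntegral.integral_comp_neg (a := -1) (b := 1)
          (fun a : ℝ => (3 / 4 * (1 - a ^ 2)) • h (1 - r + r * a))
        rw [neg_neg] at h3
        rw [integral_ballFst, integral_ballFst, ← h3]
        refine intervalIntegral.integral_congr fun a _ => ?_
        simp only [even_two.neg_pow]
        ring_nf
      simp_rw [e] at this
      rw [this]
      have h2 := intervalIntegral.integral_comp_sub_left (a := 0) (b := 2)
        (fun x : ℝ => 3 / 8 * (1 + x) ^ 2 * h x) 1
      norm_num at h2
      rw [← h2]
      refine intervalIntegral.integral_congr fun b _ => ?_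
      ring_nf
    simp only
    rw [c1, c2, integral_ballFst, integral_unifMeasure,
      ← intervalIntegral.integral_add (Continuous.intervalIntegrable (by fun_prop) _ _)
        (Continuous.intervalIntegrable (by fun_prop) _ _),
      ← intervalIntegral.integral_add (Continuous.intervalIntegrable (by fun_prop) _ _)
        (Continuous.intervalIntegrable (by fun_prop) _ _), smul_eq_mul,
      ← intervalIntegral.integral_const_mul, ← intervalIntegral.integral_const_mul]
    refine intervalIntegral.integral_congr fun b _ => ?_
    simp
    ring
  · exact Integrable.of_bound (hgm.measurable.comp (by fun_prop)).aestronglyMeasurable ‖h‖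
      (.of_forall fun r => hgb _)
  · exact Integrable.of_bound (hgm.measurable.comp (by fun_prop)).aestronglyMeasurable ‖h‖
      (.of_forall fun r => hgb _)

lemma unifMixture_snd_pos : ∀ᵐ p ∂unifMixture, 0 < p.2 := by
  refine Measure.ae_smul_measure ?_ _
  have h : ∀ᵐ r ∂(volume.restrict (Set.Ioc (0:ℝ) 1)), 0 < r := by
    filter_upwards [ae_restrict_mem measurableSet_Ioc] with r hr using hr.1
  have hm : MeasurableSet {p : ℝ × ℝ | 0 < p.2} := measurableSet_lt measurable_const measurable_snd
  rw [ae_add_measure_iff, ae_add_measure_iff, ae_map_iff (by fun_prop) hm,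
    ae_map_iff (by fun_prop) hm]
  exact ⟨(ae_dirac_iff hm).2 one_pos, h, h⟩

lemma integral_unifMixture_rpow {κ : ℝ} (hκ : κ < 1) :
    Integrable (fun p : ℝ × ℝ => p.2 ^ (-κ)) unifMixture ∧
      ∫ p, p.2 ^ (-κ) ∂unifMixture = 1 / 3 + 2 / 3 * (1 / (1 - κ)) := by
  have hm : Measurable fun p : ℝ × ℝ => p.2 ^ (-κ) := by fun_prop
  have hi : IntegrableOn (fun r : ℝ => r ^ (-κ)) (Set.Ioc 0 1) :=
    (intervalIntegrable_iff_integrableOn_Ioc_of_le zero_le_one).1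
      (intervalIntegral.intervalIntegrable_rpow' (by linarith))
  refine ⟨integrable_unifMixture hm hi hi, ?_⟩
  rw [integral_unifMixture hm hi hi]
  simp only
  rw [integral_rpow (Or.inl (by linarith)), Real.one_rpow, Real.one_rpow,
    Real.zero_rpow (by linarith)]
  rw [show -κ + 1 = 1 - κ by ring]
  ring

lemma integral_unifMixture_rpow_le {d : ℕ} (hd : 1 ≤ d) {k : ℕ} (hk : k < 2 * d) :
    Integrable (fun p : ℝ × ℝ => p.2 ^ (-(k / (2 * d) : ℝ))) unifMixture ∧
      ∫ p, p.2 ^ (-(k / (2 * d) : ℝ)) ∂unifMixture ≤ Real.exp k := by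
  have hd0 : (0:ℝ) < d := by exact_mod_cast hd
  have hk' : (k:ℝ) + 1 ≤ 2 * d := by exact_mod_cast hk
  have hκ : (k / (2 * d) : ℝ) < 1 := by rw [div_lt_one (by positivity)]; linarith
  obtain ⟨h1, h2⟩ := integral_unifMixture_rpow hκ
  refine ⟨h1, ?_⟩
  rw [h2]
  refine le_trans ?_ (Real.add_one_le_exp _)
  have e : 1 / (1 - (k / (2 * d) : ℝ)) = 2 * d / (2 * d - k) := by
    field_simp
  have h3 : 2 * d / (2 * d - k) ≤ (k + 1 : ℝ) := by
    rw [div_le_iff₀ (by linarith)]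
    nlinarith [mul_nonneg (Nat.cast_nonneg (α := ℝ) k) (by linarith : (0:ℝ) ≤ 2 * d - k - 1)]
  rw [e]
  have : (0:ℝ) ≤ k := Nat.cast_nonneg k
  linarith

/-- A product of negative powers is integrable for the product mixture, with a dimension-free
bound. -/
lemma integral_pi_unifMixture_rpow_le {d : ℕ} (hd : 1 ≤ d) {n : ℕ} {k : Fin n → ℕ}
    (hk : ∀ i, k i < 2 * d) :
    Integrable (fun ω : Fin n → ℝ × ℝ => ∏ i, (ω i).2 ^ (-(k i / (2 * d) : ℝ)))
        (Measure.pi fun _ => unifMixture) ∧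
      ∫ ω, (∏ i, (ω i).2 ^ (-(k i / (2 * d) : ℝ))) ∂(Measure.pi fun _ : Fin n => unifMixture)
        ≤ Real.exp (∑ i, (k i : ℝ)) := by
  refine ⟨Integrable.fintype_prod (f := fun i (p : ℝ × ℝ) => p.2 ^ (-(k i / (2 * d) : ℝ)))
    fun i => (integral_unifMixture_rpow_le hd (hk i)).1, ?_⟩
  rw [integral_fintype_prod_eq_prod (f := fun i (p : ℝ × ℝ) => p.2 ^ (-(k i / (2 * d) : ℝ))),
    Real.exp_sum]
  refine Finset.prod_le_prod (fun i _ => integral_nonneg_of_ae ?_) fun i _ =>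
    (integral_unifMixture_rpow_le hd (hk i)).2
  filter_upwards [unifMixture_snd_pos] with p hp using Real.rpow_nonneg hp.le _

/-! ### From the ball marginal to the uniform measure -/

section slice

variable {n : ℕ}

/-- The restriction of `f` to the line through `x` parallel to the `i`-th coordinate axis. -/
def linePoly (f : MvPolynomial (Fin n) ℝ) (x : Fin n → ℝ) (i : Fin n) : Polynomial ℝ :=
  ∑ I ∈ f.support, Polynomial.C (MvPolynomial.coeff I f * ∏ j ∈ Finset.univ.erase i, x j ^ I j)
    * Polynomial.X ^ I i

lemma eval_linePoly (f : MvPolynomial (Fin n) ℝ) (x : Fin n → ℝ) (i : Fin n) (y : ℝ) :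
    (linePoly f x i).eval y = MvPolynomial.eval (Function.update x i y) f := by
  rw [linePoly, Polynomial.eval_finsetSum, MvPolynomial.eval_eq']
  refine Finset.sum_congr rfl fun I _ => ?_
  have h : ∏ j ∈ Finset.univ.erase i, Function.update x i y j ^ I j
      = ∏ j ∈ Finset.univ.erase i, x j ^ I j := Finset.prod_congr rfl fun j hj => by
    rw [Function.update_of_ne (Finset.ne_of_mem_erase hj)]
  rw [← Finset.prod_erase_mul _ _ (Finset.mem_univ i), Function.update_self, h]
  rw [Polynomial.eval_mul, Polynomial.eval_C, Polynomial.eval_pow, Polynomial.eval_X]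
  ring

lemma apply_le_of_totalDegree_le {d : ℕ} {f : MvPolynomial (Fin n) ℝ} (hf : f.totalDegree ≤ d)
    {I : Fin n →₀ ℕ} (hI : I ∈ f.support) (i : Fin n) : I i ≤ d := by
  refine le_trans ?_ ((MvPolynomial.le_totalDegree hI).trans hf)
  exact Finsupp.le_degree i I

lemma eq_single_of_apply_eq_degree {I : Fin n →₀ ℕ} {i : Fin n} (h : I.degree ≤ I i) :
    I = Finsupp.single i (I i) := by
  have h1 : I = Finsupp.single i (I i) + (I - Finsupp.single i (I i)) := by
    rw [add_tsub_cancel_of_le]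
    simp
  have h2 := congrArg Finsupp.degree h1
  rw [map_add, Finsupp.degree_single] at h2
  have h3 : I - Finsupp.single i (I i) = 0 := by
    rw [← Finsupp.degree_eq_zero_iff]
    omega
  rwa [h3, add_zero] at h1

lemma natDegree_linePoly_le {d : ℕ} {f : MvPolynomial (Fin n) ℝ} (hf : f.totalDegree ≤ d)
    (x : Fin n → ℝ) (i : Fin n) : (linePoly f x i).natDegree ≤ d :=
  Polynomial.natDegree_sum_le_of_forall_le _ _ fun _ hI =>
    (Polynomial.natDegree_C_mul_X_pow_le _ _).trans (apply_le_of_totalDegree_le hf hI i)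

lemma coeff_linePoly {d : ℕ} {f : MvPolynomial (Fin n) ℝ} (hf : f.totalDegree ≤ d)
    (x : Fin n → ℝ) (i : Fin n) :
    (linePoly f x i).coeff d = MvPolynomial.coeff (Finsupp.single i d) f := by
  rw [linePoly, Polynomial.finsetSum_coeff]
  simp_rw [Polynomial.coeff_C_mul_X_pow]
  rw [Finset.sum_eq_single (Finsupp.single i d)]
  · rw [Finsupp.single_eq_same, if_pos rfl, Finset.prod_eq_one, mul_one]
    intro j hj
    rw [Finsupp.single_eq_of_ne (Finset.ne_of_mem_erase hj), pow_zero]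
  · intro _ hI hne
    rw [if_neg]
    rintro rfl
    exact hne (eq_single_of_apply_eq_degree ((MvPolynomial.le_totalDegree hI).trans hf))
  · intro h
    rw [MvPolynomial.notMem_support_iff.1 h]
    simp

end slice

lemma VanDerCorput.norm_integral_pi_le {d : ℕ} {K : ℝ}
    (hK : ∀ p : Polynomial ℝ, p.natDegree ≤ d → p.coeff d ≠ 0 →
      ‖∫ y, Complex.exp (Complex.I * (p.eval y : ℝ)) ∂unifMeasure‖
        ≤ K * |p.coeff d| ^ (-(1 / d : ℝ)))
    {n : ℕ} {f : MvPolynomial (Fin n) ℝ} (hf : f.totalDegree ≤ d) (i : Fin n)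
    (hi : MvPolynomial.coeff (Finsupp.single i d) f ≠ 0) :
    ‖∫ x, Complex.exp (Complex.I * (MvPolynomial.eval x f : ℝ)) ∂Measure.pi (fun _ => unifMeasure)‖
      ≤ K * |MvPolynomial.coeff (Finsupp.single i d) f| ^ (-(1 / d : ℝ)) := by
  refine norm_integral_pi_le_of_slice unifMeasure i
    (integrable_cexp_I_mul _ (measurable_eval_mvPolynomial f)) fun x => ?_
  have h := hK (linePoly f x i) (natDegree_linePoly_le hf x i) (by rwa [coeff_linePoly hf])
  rw [coeff_linePoly hf] at h
  simpa only [eval_linePoly] using h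

section pairs

variable {n : ℕ}

/-- The pairs of exponents of degree `d` that are not twice the same pure power. -/
def mixedPairs (n d : ℕ) : Finset ((Fin n →₀ ℕ) × (Fin n →₀ ℕ)) :=
  (topExp n d ×ˢ topExp n d).filter fun q => ¬∃ i, q = (Finsupp.single i d, Finsupp.single i d)

lemma add_lt_of_mem_mixedPairs {d : ℕ} {q : (Fin n →₀ ℕ) × (Fin n →₀ ℕ)}
    (hq : q ∈ mixedPairs n d) (i : Fin n) : q.1 i + q.2 i < 2 * d := by
  rw [mixedPairs, Finset.mem_filter, Finset.mem_product, mem_topExp, mem_topExp] at hq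
  obtain ⟨⟨h1, h2⟩, h3⟩ := hq
  by_contra h
  have h4 : q.1 i ≤ d := h1 ▸ Finsupp.le_degree i q.1
  have h5 : q.2 i ≤ d := h2 ▸ Finsupp.le_degree i q.2
  have h6 : q.1 i = d := by omega
  have h7 : q.2 i = d := by omega
  refine h3 ⟨i, Prod.ext ?_ ?_⟩
  · rw [eq_single_of_apply_eq_degree (I := q.1) (i := i) (by omega), h6]
  · rw [eq_single_of_apply_eq_degree (I := q.2) (i := i) (by omega), h7]

lemma sum_mixedPairs_ge {d : ℕ} (f : MvPolynomial (Fin n) ℝ)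
    (h : ∀ i, MvPolynomial.coeff (Finsupp.single i d) f ^ 2 ≤ topSq d f / 2) :
    topSq d f ^ 2 / 2 ≤ ∑ q ∈ mixedPairs n d,
      MvPolynomial.coeff q.1 f ^ 2 * MvPolynomial.coeff q.2 f ^ 2 := by
  have h1 : topSq d f ^ 2 = ∑ q ∈ topExp n d ×ˢ topExp n d,
      MvPolynomial.coeff q.1 f ^ 2 * MvPolynomial.coeff q.2 f ^ 2 := by
    rw [sq, topSq, Finset.sum_mul_sum, Finset.sum_product]
  have h2 := Finset.sum_filter_add_sum_filter_not (topExp n d ×ˢ topExp n d)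
    (fun q => ∃ i, q = (Finsupp.single i d, Finsupp.single i d))
    (fun q => MvPolynomial.coeff q.1 f ^ 2 * MvPolynomial.coeff q.2 f ^ 2)
  have h3 : ∑ q ∈ (topExp n d ×ˢ topExp n d).filter
      (fun q => ∃ i, q = (Finsupp.single i d, Finsupp.single i d)),
      MvPolynomial.coeff q.1 f ^ 2 * MvPolynomial.coeff q.2 f ^ 2
      ≤ ∑ I ∈ topExp n d, topSq d f / 2 * MvPolynomial.coeff I f ^ 2 := by
    calc _ ≤ ∑ q ∈ (topExp n d).image (fun I => (I, I)),
          topSq d f / 2 * MvPolynomial.coeff q.2 f ^ 2 := by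
          refine (Finset.sum_le_sum (g := fun q => topSq d f / 2 * MvPolynomial.coeff q.2 f ^ 2)
            fun q hq => ?_).trans (Finset.sum_le_sum_of_subset_of_nonneg ?_ fun q _ _ => ?_)
          · obtain ⟨i, rfl⟩ := (Finset.mem_filter.1 hq).2
            exact mul_le_mul_of_nonneg_right (h i) (sq_nonneg _)
          · intro q hq
            obtain ⟨hq, i, rfl⟩ := Finset.mem_filter.1 hq
            exact Finset.mem_image_of_mem _ (Finset.mem_product.1 hq).1
          · exact mul_nonneg (by linarith [topSq_nonneg d f]) (sq_nonneg _)
      _ = _ := Finset.sum_image fun I _ J _ hIJ => (Prod.ext_iff.1 hIJ).1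
  rw [← Finset.mul_sum] at h3
  change _ ≤ topSq d f / 2 * topSq d f at h3
  rw [mixedPairs]
  nlinarith

/-- The sum of negative moments controlling the coefficients of random affine images. -/
def pairBound (f : MvPolynomial (Fin n) ℝ) (d : ℕ) (ω : Fin n → ℝ × ℝ) : ℝ :=
  ∑ q ∈ mixedPairs n d, MvPolynomial.coeff q.1 f ^ 2 * MvPolynomial.coeff q.2 f ^ 2 /
      (∑ q ∈ mixedPairs n d, MvPolynomial.coeff q.1 f ^ 2 * MvPolynomial.coeff q.2 f ^ 2) *
    ∏ i, (ω i).2 ^ (-((q.1 i + q.2 i : ℕ) / (2 * d) : ℝ))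

lemma integral_pairBound_le {d : ℕ} (hd : 1 ≤ d) (f : MvPolynomial (Fin n) ℝ)
    (hA : 0 < ∑ q ∈ mixedPairs n d, MvPolynomial.coeff q.1 f ^ 2 * MvPolynomial.coeff q.2 f ^ 2) :
    Integrable (pairBound f d) (Measure.pi fun _ => unifMixture) ∧
      ∫ ω, pairBound f d ω ∂(Measure.pi fun _ => unifMixture) ≤ Real.exp (2 * d) := by
  have hq : ∀ q ∈ mixedPairs n d,
      Integrable (fun ω : Fin n → ℝ × ℝ => ∏ i, (ω i).2 ^ (-((q.1 i + q.2 i : ℕ) / (2 * d) : ℝ)))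
        (Measure.pi fun _ => unifMixture) ∧
      ∫ ω, (∏ i, (ω i).2 ^ (-((q.1 i + q.2 i : ℕ) / (2 * d) : ℝ)))
        ∂(Measure.pi fun _ : Fin n => unifMixture) ≤ Real.exp (2 * d) := fun q hq => by
    have h := integral_pi_unifMixture_rpow_le hd fun i => add_lt_of_mem_mixedPairs hq i
    refine ⟨h.1, h.2.trans (le_of_eq ?_)⟩
    rw [mixedPairs, Finset.mem_filter, Finset.mem_product, mem_topExp, mem_topExp] at hq
    rw [← Nat.cast_sum, Finset.sum_add_distrib, ← Finsupp.degree_eq_sum, ← Finsupp.degree_eq_sum,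
      hq.1.1, hq.1.2]
    push_cast
    ring_nf
  unfold pairBound
  refine ⟨integrable_finsetSum _ fun q h => (hq q h).1.const_mul _, ?_⟩
  rw [integral_finsetSum _ fun q h => (hq q h).1.const_mul _]
  simp_rw [integral_const_mul]
  refine (Finset.sum_le_sum fun q h => mul_le_mul_of_nonneg_left (hq q h).2
    (div_nonneg (by positivity) hA.le)).trans ?_
  rw [← Finset.sum_mul, ← Finset.sum_div, div_self hA.ne', one_mul]

set_option maxHeartbeats 1000000 in
lemma topSq_affSubst_rpow_le_pairBound {d : ℕ} {f : MvPolynomial (Fin n) ℝ}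
    (hf : f.totalDegree ≤ d) (hT : 0 < topSq d f)
    (h : ∀ i, MvPolynomial.coeff (Finsupp.single i d) f ^ 2 ≤ topSq d f / 2)
    {ω : Fin n → ℝ × ℝ} (hω : ∀ i, 0 < (ω i).2) :
    topSq d (affSubst (fun i => (ω i).1) (fun i => (ω i).2) f) ^ (-(1 / (2 * d) : ℝ))
      ≤ (topSq d f ^ 2 / 2) ^ (-(1 / (4 * d) : ℝ)) * pairBound f d ω := by
  have hx : -(1 / (4 * d) : ℝ) ≤ 0 := neg_nonpos.2 (by positivity)
  set Y := topSq d (affSubst (fun i => (ω i).1) (fun i => (ω i).2) f) with hY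
  have hge := sum_mixedPairs_ge f h
  have hA : 0 < ∑ q ∈ mixedPairs n d,
      MvPolynomial.coeff q.1 f ^ 2 * MvPolynomial.coeff q.2 f ^ 2 :=
    lt_of_lt_of_le (by positivity) hge
  have hX : ∀ q ∈ mixedPairs n d, 0 < (∏ i, (ω i).2 ^ (q.1 i + q.2 i)) ^ 2 := fun q _ =>
    pow_pos (Finset.prod_pos fun i _ => pow_pos (hω i) _) 2
  have hle : ∑ q ∈ mixedPairs n d, MvPolynomial.coeff q.1 f ^ 2 * MvPolynomial.coeff q.2 f ^ 2 *
      (∏ i, (ω i).2 ^ (q.1 i + q.2 i)) ^ 2 ≤ Y ^ 2 := by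
    rw [hY, topSq_affSubst _ _ hf, sq (∑ I ∈ topExp n d, _), Finset.sum_mul_sum,
      ← Finset.sum_product']
    refine (Finset.sum_le_sum_of_subset_of_nonneg (Finset.filter_subset _ _)
      fun q _ _ => by positivity).trans (le_of_eq (Finset.sum_congr rfl fun q _ => ?_))
    simp_rw [pow_add, Finset.prod_mul_distrib]
    ring
  have hpos : 0 < ∑ q ∈ mixedPairs n d, MvPolynomial.coeff q.1 f ^ 2 *
      MvPolynomial.coeff q.2 f ^ 2 * (∏ i, (ω i).2 ^ (q.1 i + q.2 i)) ^ 2 := by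
    obtain ⟨q, hq, hq0⟩ := Finset.exists_lt_of_sum_lt (s := mixedPairs n d) (f := fun _ => (0:ℝ))
      (by simpa using hA)
    exact Finset.sum_pos' (fun q hq => mul_nonneg (by positivity) (hX q hq).le)
      ⟨q, hq, mul_pos hq0 (hX q hq)⟩
  calc Y ^ (-(1 / (2 * d) : ℝ)) = (Y ^ 2) ^ (-(1 / (4 * d) : ℝ)) := by
        rw [← Real.rpow_natCast, ← Real.rpow_mul (topSq_nonneg _ _)]
        congr 1
        push_cast
        ring
    _ ≤ (∑ q ∈ mixedPairs n d, MvPolynomial.coeff q.1 f ^ 2 * MvPolynomial.coeff q.2 f ^ 2 *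
          (∏ i, (ω i).2 ^ (q.1 i + q.2 i)) ^ 2) ^ (-(1 / (4 * d) : ℝ)) :=
        Real.rpow_le_rpow_of_nonpos hpos hle hx
    _ ≤ _ := rpow_neg_sum_le_of_pos (mixedPairs n d)
        (a := fun q => MvPolynomial.coeff q.1 f ^ 2 * MvPolynomial.coeff q.2 f ^ 2)
        (X := fun q => (∏ i, (ω i).2 ^ (q.1 i + q.2 i)) ^ 2) (by positivity)
        (fun q _ => by positivity) hA hX
    _ ≤ _ := by
        refine mul_le_mul (Real.rpow_le_rpow_of_nonpos (by positivity) hge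
          hx) (le_of_eq ?_) (Finset.sum_nonneg fun q hq =>
            mul_nonneg (div_nonneg (by positivity) hA.le) (Real.rpow_nonneg (hX q hq).le _))
          (by positivity)
        refine Finset.sum_congr rfl fun q _ => ?_
        rw [prod_pow_sq_rpow_neg hω (fun i => q.1 i + q.2 i)]
        congr 1
        refine Finset.prod_congr rfl fun i _ => ?_
        congr 2
        rcases eq_or_ne (d:ℝ) 0 with h0 | h0
        · simp [h0]
        · field_simp
          ring

end pairs

theorem FourierDecay.unifMeasure_of_ballFst {d : ℕ} (hd : 1 ≤ d) (h : FourierDecay ballFst d) :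
    FourierDecay unifMeasure d := by
  obtain ⟨K, hK, hb⟩ := h
  obtain ⟨L, hL, hv⟩ := vanDerCorput hd
  have hd0 : (0:ℝ) < d := by exact_mod_cast hd
  refine ⟨L * (1 / 2) ^ (-(1 / (2 * d) : ℝ))
    + K * (1 / 2) ^ (-(1 / (4 * d) : ℝ)) * Real.exp (2 * d), by positivity, fun n f hf hT => ?_⟩
  have hT' := Real.rpow_nonneg hT.le (-(1 / (2 * d) : ℝ))
  by_cases hc : ∀ i, MvPolynomial.coeff (Finsupp.single i d) f ^ 2 ≤ topSq d f / 2
  · have hA := lt_of_lt_of_le (by positivity) (sum_mixedPairs_ge f hc)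
    obtain ⟨h1, h2⟩ := integral_pairBound_le hd f hA
    have hae : ∀ᵐ ω ∂(Measure.pi fun _ : Fin n => unifMixture), ∀ i, 0 < (ω i).2 :=
      ae_all_iff.2 fun i => (measurePreserving_eval (fun _ : Fin n => unifMixture)
        i).quasiMeasurePreserving.ae unifMixture_snd_pos
    refine (norm_integral_cexp_mixture_le (fun _ => unifMixture) ballFst (fun _ => unifMeasure)
      (fun _ => measurePreserving_unifMixture) f
      (h1.const_mul (K * (topSq d f ^ 2 / 2) ^ (-(1 / (4 * d) : ℝ)))) ?_).trans ?_
    · filter_upwards [hae] with ω hω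
      have hpos : 0 < topSq d (affSubst (fun i => (ω i).1) (fun i => (ω i).2) f) := by
        rw [topSq_affSubst _ _ hf]
        obtain ⟨I, hI, hI0⟩ := Finset.exists_lt_of_sum_lt (s := topExp n d) (f := fun _ => (0:ℝ))
          (g := fun I => MvPolynomial.coeff I f ^ 2) (by simpa [topSq] using hT)
        have hP : 0 < (∏ i, (ω i).2 ^ I i) ^ 2 :=
          pow_pos (Finset.prod_pos fun i _ => pow_pos (hω i) _) 2
        exact Finset.sum_pos' (fun I _ => by positivity) ⟨I, hI, mul_pos hP hI0⟩
      refine (hb n _ (totalDegree_affSubst_le _ _ hf) hpos).trans ?_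
      rw [mul_assoc]
      exact mul_le_mul_of_nonneg_left (topSq_affSubst_rpow_le_pairBound hf hT hc hω) hK.le
    · rw [integral_const_mul, add_mul]
      have e : (topSq d f ^ 2 / 2) ^ (-(1 / (4 * d) : ℝ))
          = (1 / 2) ^ (-(1 / (4 * d) : ℝ)) * topSq d f ^ (-(1 / (2 * d) : ℝ)) := by
        rw [div_eq_mul_one_div, Real.mul_rpow (by positivity) (by norm_num), mul_comm,
          ← Real.rpow_natCast, ← Real.rpow_mul hT.le]
        congr 2
        push_cast
        field_simp
        ring
      rw [e]
      calc _ ≤ K * ((1 / 2) ^ (-(1 / (4 * d) : ℝ)) * topSq d f ^ (-(1 / (2 * d) : ℝ)))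
            * Real.exp (2 * d) := mul_le_mul_of_nonneg_left h2 (by positivity)
        _ = 0 + K * (1 / 2) ^ (-(1 / (4 * d) : ℝ)) * Real.exp (2 * d)
            * topSq d f ^ (-(1 / (2 * d) : ℝ)) := by ring
        _ ≤ _ := by gcongr; positivity
  · push Not at hc
    obtain ⟨i, hi⟩ := hc
    have hne : MvPolynomial.coeff (Finsupp.single i d) f ≠ 0 := fun h0 => by
      rw [h0] at hi; norm_num at hi; linarith
    refine (VanDerCorput.norm_integral_pi_le hv hf i hne).trans ?_
    have e : |MvPolynomial.coeff (Finsupp.single i d) f| ^ (-(1 / d : ℝ))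
        = (MvPolynomial.coeff (Finsupp.single i d) f ^ 2) ^ (-(1 / (2 * d) : ℝ)) := by
      rw [← sq_abs, ← Real.rpow_natCast, ← Real.rpow_mul (abs_nonneg _)]
      congr 1
      push_cast
      field_simp
    rw [e, add_mul]
    calc _ ≤ L * (1 / 2 * topSq d f) ^ (-(1 / (2 * d) : ℝ)) := by
          refine mul_le_mul_of_nonneg_left (Real.rpow_le_rpow_of_nonpos (by positivity)
            (by linarith) (neg_nonpos.2 (by positivity))) hL.le
      _ = L * (1 / 2) ^ (-(1 / (2 * d) : ℝ)) * topSq d f ^ (-(1 / (2 * d) : ℝ)) + 0 := by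
          rw [Real.mul_rpow (by norm_num) hT.le]; ring
      _ ≤ _ := by gcongr; positivity

/-- The uniform measure has dimension-free Fourier decay in every degree. -/
theorem fourierDecay_unifMeasure {d : ℕ} (hd : 1 ≤ d) : FourierDecay unifMeasure d := by
  suffices FourierDecay unifMeasure d ∧ SmallBall unifMeasure d from this.1
  induction d, hd using Nat.le_induction with
  | base => exact ⟨fourierDecay_unifMeasure_one, smallBall_unifMeasure_one⟩
  | succ d hd ih =>
    have h := (ih.2.fourierDecay_ballFst hd).unifMeasure_of_ballFst (by omega)
    exact ⟨h, h.smallBall (by omega)⟩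

/-! ### Log-concave densities -/

section density

variable {ρ : ℝ → ℝ}

/-- Superlevel sets of log-concave functions are intervals. -/
lemma ordConnected_superlevel
    (hl : ∀ x y l : ℝ, 0 ≤ l → l ≤ 1 → ρ x ^ l * ρ y ^ (1 - l) ≤ ρ (l * x + (1 - l) * y))
    {s : ℝ} (hs : 0 ≤ s) : Set.OrdConnected {x | s < ρ x} := by
  refine Convex.ordConnected fun x hx y hy a b ha hb hab => ?_
  obtain rfl : b = 1 - a := by linarith
  have hm : s < min (ρ x) (ρ y) := lt_min hx hy
  have hm0 : 0 < min (ρ x) (ρ y) := hs.trans_lt hm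
  refine hm.trans_le (le_trans ?_ (hl x y a ha (by linarith)))
  calc min (ρ x) (ρ y) = min (ρ x) (ρ y) ^ a * min (ρ x) (ρ y) ^ (1 - a) := by
        rw [← Real.rpow_add hm0]; simp
    _ ≤ _ := by
        have h1 := Real.rpow_le_rpow hm0.le (min_le_left (ρ x) (ρ y)) ha
        have h2 := Real.rpow_le_rpow hm0.le (min_le_right (ρ x) (ρ y)) hb
        exact mul_le_mul h1 h2 (Real.rpow_nonneg hm0.le _)
          ((Real.rpow_nonneg hm0.le _).trans h1)

lemma measurable_of_logConcave (h0 : ∀ x, 0 ≤ ρ x)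
    (hl : ∀ x y l : ℝ, 0 ≤ l → l ≤ 1 → ρ x ^ l * ρ y ^ (1 - l) ≤ ρ (l * x + (1 - l) * y)) :
    Measurable ρ := by
  refine measurable_of_Ioi fun s => ?_
  rcases le_or_gt 0 s with hs | hs
  · exact (ordConnected_superlevel hl hs).measurableSet
  · have : ρ ⁻¹' Set.Ioi s = Set.univ := Set.eq_univ_of_forall fun x => hs.trans_le (h0 x)
    rw [this]
    exact MeasurableSet.univ

lemma volume_superlevel_le (hm : Measurable ρ) (h1 : ∫⁻ x, ENNReal.ofReal (ρ x) = 1)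
    {s : ℝ} (hs : 0 < s) : volume {x | s < ρ x} ≤ ENNReal.ofReal s⁻¹ := by
  have h := mul_meas_ge_le_lintegral (μ := volume) (f := fun x => ENNReal.ofReal (ρ x))
    (by fun_prop) (ENNReal.ofReal s)
  rw [h1] at h
  rw [ENNReal.ofReal_inv_of_pos hs, ← one_div, ENNReal.le_div_iff_mul_le (by simp [hs]) (by simp),
    mul_comm]
  refine le_trans (mul_le_mul_right (measure_mono fun x hx => ?_) _) h
  exact ENNReal.ofReal_le_ofReal (le_of_lt hx)

/-- Points of a superlevel set are close to each other. -/
lemma sub_le_of_superlevel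
    (hl : ∀ x y l : ℝ, 0 ≤ l → l ≤ 1 → ρ x ^ l * ρ y ^ (1 - l) ≤ ρ (l * x + (1 - l) * y))
    (hm : Measurable ρ) (h1 : ∫⁻ x, ENNReal.ofReal (ρ x) = 1) {s : ℝ} (hs : 0 < s) {x y : ℝ}
    (hx : s < ρ x) (hy : s < ρ y) : y - x ≤ s⁻¹ := by
  have h := (measure_mono ((ordConnected_superlevel hl hs.le).out hx hy)).trans
    (volume_superlevel_le hm h1 hs)
  rw [Real.volume_Icc] at h
  exact (ENNReal.ofReal_le_ofReal_iff (by positivity)).1 h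

lemma logConcave_tail_le (h0 : ∀ x, 0 ≤ ρ x)
    (hl : ∀ x y l : ℝ, 0 ≤ l → l ≤ 1 → ρ x ^ l * ρ y ^ (1 - l) ≤ ρ (l * x + (1 - l) * y))
    (hm : Measurable ρ) (h1 : ∫⁻ x, ENNReal.ofReal (ρ x) = 1) {x₀ : ℝ} (hx₀ : 0 < ρ x₀) {y t : ℝ}
    (ht : 1 ≤ t) (hy : |y - x₀| = t * (3 / ρ x₀)) : ρ y ≤ ρ x₀ * (1 / 2) ^ t := by
  set h := ρ x₀
  have ht0 : 0 < t := by linarith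
  set x₁ := t⁻¹ * y + (1 - t⁻¹) * x₀ with hx₁
  have hd : |x₁ - x₀| = 3 / h := by
    rw [show x₁ - x₀ = t⁻¹ * (y - x₀) by rw [hx₁]; ring, abs_mul, hy, abs_of_pos (by positivity)]
    field_simp
  have hsmall : ρ x₁ ≤ h / 2 := by
    by_contra! hlt
    have a1 := sub_le_of_superlevel hl hm h1 (half_pos hx₀) hlt (half_lt_self hx₀)
    have a2 := sub_le_of_superlevel hl hm h1 (half_pos hx₀) (half_lt_self hx₀) hlt
    have a3 : |x₁ - x₀| ≤ (h / 2)⁻¹ := abs_le.2 ⟨by linarith, by linarith⟩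
    rw [hd, inv_div, div_le_div_iff_of_pos_right hx₀] at a3
    norm_num at a3
  have hlog := (hl y x₀ t⁻¹ (by positivity) (inv_le_one_of_one_le₀ ht)).trans hsmall
  have h2 : ρ y ^ t⁻¹ ≤ h ^ t⁻¹ / 2 := by
    have hp : 0 < h ^ (1 - t⁻¹) := Real.rpow_pos_of_pos hx₀ _
    refine le_of_mul_le_mul_right (hlog.trans (le_of_eq ?_)) hp
    rw [div_mul_eq_mul_div, ← Real.rpow_add hx₀]
    simp
  have h3 := Real.rpow_le_rpow (Real.rpow_nonneg (h0 y) _) h2 ht0.le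
  rw [← Real.rpow_mul (h0 y), inv_mul_cancel₀ ht0.ne', Real.rpow_one, div_eq_mul_one_div,
    Real.mul_rpow (by positivity) (by norm_num), ← Real.rpow_mul hx₀.le,
    inv_mul_cancel₀ ht0.ne', Real.rpow_one] at h3
  exact h3

lemma half_rpow_mul_sq_le {t : ℝ} (ht : 1 ≤ t) : t ^ 2 * (1 / 2 : ℝ) ^ t ≤ 768 / (1 + t ^ 2) := by
  have h1 : (1 / 2 : ℝ) ^ t ≤ Real.exp (-(t / 2)) := by
    rw [Real.rpow_def_of_pos (by norm_num)]
    refine Real.exp_le_exp.2 ?_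
    rw [one_div, Real.log_inv]
    nlinarith [Real.log_two_gt_d9]
  have h2 := Real.pow_div_factorial_le_exp (t / 2) (by linarith) 4
  have h3 : (1 / 2 : ℝ) ^ t * (t ^ 4 / 384) ≤ 1 := by
    calc _ ≤ Real.exp (-(t / 2)) * Real.exp (t / 2) := by
          refine mul_le_mul h1 (le_trans (le_of_eq ?_) h2) (by positivity) (Real.exp_pos _).le
          norm_num [Nat.factorial]
          ring
      _ = 1 := by rw [← Real.exp_add]; simp
  have h4 : 0 < (1 / 2 : ℝ) ^ t := by positivity
  rw [le_div_iff₀ (by positivity)]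
  have : 1 + t ^ 2 ≤ 2 * t ^ 2 := by nlinarith
  nlinarith [mul_le_mul_of_nonneg_left this (by positivity : 0 ≤ t ^ 2 * (1 / 2 : ℝ) ^ t)]

lemma logConcave_sq_mul_le (h0 : ∀ x, 0 ≤ ρ x)
    (hl : ∀ x y l : ℝ, 0 ≤ l → l ≤ 1 → ρ x ^ l * ρ y ^ (1 - l) ≤ ρ (l * x + (1 - l) * y))
    (hm : Measurable ρ) (h1 : ∫⁻ x, ENNReal.ofReal (ρ x) = 1) {x₀ : ℝ} (hx₀ : 0 < ρ x₀) (y : ℝ) :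
    ρ y * ((y - x₀) / (3 / ρ x₀)) ^ 2
      ≤ ρ y + 768 * ρ x₀ * (1 + ((y - x₀) / (3 / ρ x₀)) ^ 2)⁻¹ := by
  have hD : 0 < 3 / ρ x₀ := by positivity
  set u := (y - x₀) / (3 / ρ x₀) with hu
  rcases le_or_gt |u| 1 with h | h
  · have h2 : u ^ 2 ≤ 1 := (sq_le_one_iff_abs_le_one u).2 h
    have h3 : ρ y * u ^ 2 ≤ ρ y := mul_le_of_le_one_right (h0 y) h2
    have : 0 ≤ 768 * ρ x₀ * (1 + u ^ 2)⁻¹ := by positivity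
    linarith
  · have h2 := logConcave_tail_le h0 hl hm h1 hx₀ (y := y) h.le (by
      rw [hu, abs_div, abs_of_pos hD]; field_simp)
    have h3 := half_rpow_mul_sq_le h.le
    rw [sq_abs] at h3
    calc ρ y * u ^ 2 ≤ ρ x₀ * (1 / 2) ^ |u| * u ^ 2 := mul_le_mul_of_nonneg_right h2 (sq_nonneg _)
      _ = ρ x₀ * (u ^ 2 * (1 / 2) ^ |u|) := by ring
      _ ≤ ρ x₀ * (768 / (1 + u ^ 2)) := mul_le_mul_of_nonneg_left h3 hx₀.le
      _ = 768 * ρ x₀ * (1 + u ^ 2)⁻¹ := by ring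
      _ ≤ _ := by linarith [h0 y]

/-- An isotropic log-concave density is bounded by an absolute constant. -/
lemma logConcave_density_le (h0 : ∀ x, 0 ≤ ρ x)
    (hl : ∀ x y l : ℝ, 0 ≤ l → l ≤ 1 → ρ x ^ l * ρ y ^ (1 - l) ≤ ρ (l * x + (1 - l) * y))
    {ν : Measure ℝ} [IsProbabilityMeasure ν]
    (hν : ν = volume.withDensity fun x => ENNReal.ofReal (ρ x))
    (hmean : ∫ x, x ∂ν = 0) (hvar : ∫ x, x ^ 2 ∂ν = 1) (x₀ : ℝ) :
    ρ x₀ ≤ 3 * (1 + 2304 * Real.pi) := by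
  have hπ := Real.pi_pos
  rcases (h0 x₀).eq_or_lt with hz | hx₀
  · rw [← hz]; positivity
  have hm := measurable_of_logConcave h0 hl
  have h1 : ∫⁻ x, ENNReal.ofReal (ρ x) = 1 := by
    have := measure_univ (μ := ν)
    rwa [hν, withDensity_apply _ MeasurableSet.univ, Measure.restrict_univ] at this
  have hInt : Integrable ρ := by
    refine ⟨hm.aestronglyMeasurable, ?_⟩
    rw [hasFiniteIntegral_iff_ofReal (.of_forall h0), h1]
    exact ENNReal.one_lt_top
  have hone : ∫ x, ρ x = 1 := by
    rw [integral_eq_lintegral_of_nonneg_ae (.of_forall h0) hm.aestronglyMeasurable, h1]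
    simp
  have hi2 : Integrable (fun x : ℝ => x ^ 2) ν := .of_integral_ne_zero (by rw [hvar]; norm_num)
  have hi1 : Integrable (fun x : ℝ => x) ν := by
    refine Integrable.mono' (hi2.add (integrable_const 1)) measurable_id.aestronglyMeasurable
      (.of_forall fun x => ?_)
    simp only [Pi.add_apply, Real.norm_eq_abs]
    exact abs_le.2 ⟨by nlinarith [sq_nonneg (x + 1)], by nlinarith [sq_nonneg (x - 1)]⟩
  have hshift : ∫ x, (x - x₀) ^ 2 ∂ν = 1 + x₀ ^ 2 := by
    have e : ∀ x : ℝ, (x - x₀) ^ 2 = x ^ 2 - 2 * x₀ * x + x₀ ^ 2 := fun x => by ring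
    have hi3 : Integrable (fun x : ℝ => x ^ 2 - 2 * x₀ * x) ν := hi2.sub (hi1.const_mul _)
    simp_rw [e]
    rw [integral_add hi3 (integrable_const _),
      integral_sub hi2 (hi1.const_mul _), integral_const_mul, hmean, hvar]
    simp
  set D := 3 / ρ x₀ with hD
  have hD0 : 0 < D := by positivity
  have hcauchy : Integrable fun y : ℝ => (1 + ((y - x₀) / D) ^ 2)⁻¹ :=
    (integrable_inv_one_add_sq.comp_div hD0.ne').comp_sub_right x₀
  have hcI : ∫ y : ℝ, (1 + ((y - x₀) / D) ^ 2)⁻¹ = D * Real.pi := by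
    rw [integral_sub_right_eq_self (fun y : ℝ => (1 + (y / D) ^ 2)⁻¹) x₀,
      Measure.integral_comp_div (fun y : ℝ => (1 + y ^ 2)⁻¹), integral_univ_inv_one_add_sq,
      abs_of_pos hD0, smul_eq_mul]
  have hle : ∫ y, ρ y * ((y - x₀) / D) ^ 2 ≤ 1 + 768 * ρ x₀ * (D * Real.pi) := by
    rw [← hone, ← hcI, ← integral_const_mul, ← integral_add hInt (hcauchy.const_mul _)]
    exact integral_mono_of_nonneg (.of_forall fun y => mul_nonneg (h0 y) (sq_nonneg _))
      (hInt.add (hcauchy.const_mul _))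
      (.of_forall fun y => logConcave_sq_mul_le h0 hl hm h1 hx₀ y)
  have hconv : ∫ y, ρ y * ((y - x₀) / D) ^ 2 = (1 + x₀ ^ 2) / D ^ 2 := by
    rw [← hshift, hν, integral_withDensity_eq_integral_toReal_smul (by fun_prop) (by simp),
      ← integral_div]
    refine integral_congr_ae (.of_forall fun y => ?_)
    simp only [ENNReal.toReal_ofReal (h0 y), smul_eq_mul, div_pow]
    ring
  have hk : 768 * ρ x₀ * (D * Real.pi) = 2304 * Real.pi := by
    rw [hD]; field_simp; ring
  rw [hconv, hk, div_le_iff₀ (by positivity)] at hle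
  have h9 : ρ x₀ ^ 2 ≤ (1 + 2304 * Real.pi) * 9 := by
    have : D ^ 2 * ρ x₀ ^ 2 = 9 := by rw [hD]; field_simp; norm_num
    nlinarith [sq_nonneg (ρ x₀), mul_nonneg (sq_nonneg x₀) (sq_nonneg (ρ x₀))]
  nlinarith

end density

/-! ### Log-concave measures as mixtures of uniform measures -/

section mixture

variable {ρ : ℝ → ℝ}

lemma bddBelow_superlevel
    (hl : ∀ x y l : ℝ, 0 ≤ l → l ≤ 1 → ρ x ^ l * ρ y ^ (1 - l) ≤ ρ (l * x + (1 - l) * y))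
    (hm : Measurable ρ) (h1 : ∫⁻ x, ENNReal.ofReal (ρ x) = 1) {s : ℝ} (hs : 0 < s) :
    BddBelow {x | s < ρ x} := by
  rcases Set.eq_empty_or_nonempty {x | s < ρ x} with h | ⟨y, hy⟩
  · rw [h]; exact bddBelow_empty
  · exact ⟨y - s⁻¹, fun x hx => by linarith [sub_le_of_superlevel hl hm h1 hs hx hy]⟩

lemma bddAbove_superlevel
    (hl : ∀ x y l : ℝ, 0 ≤ l → l ≤ 1 → ρ x ^ l * ρ y ^ (1 - l) ≤ ρ (l * x + (1 - l) * y))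
    (hm : Measurable ρ) (h1 : ∫⁻ x, ENNReal.ofReal (ρ x) = 1) {s : ℝ} (hs : 0 < s) :
    BddAbove {x | s < ρ x} := by
  rcases Set.eq_empty_or_nonempty {x | s < ρ x} with h | ⟨y, hy⟩
  · rw [h]; exact bddAbove_empty
  · exact ⟨y + s⁻¹, fun x hx => by linarith [sub_le_of_superlevel hl hm h1 hs hy hx]⟩

/-- Up to a null set, a superlevel set is the open interval between its extremities. -/
lemma volume_inter_superlevel
    (hl : ∀ x y l : ℝ, 0 ≤ l → l ≤ 1 → ρ x ^ l * ρ y ^ (1 - l) ≤ ρ (l * x + (1 - l) * y))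
    (hm : Measurable ρ) (h1 : ∫⁻ x, ENNReal.ofReal (ρ x) = 1) {s : ℝ} (hs : 0 < s) (A : Set ℝ) :
    volume (A ∩ Set.Ioo (sInf {x | s < ρ x}) (sSup {x | s < ρ x}))
      = volume (A ∩ {x | s < ρ x}) := by
  rcases Set.eq_empty_or_nonempty {x | s < ρ x} with hE | hE
  · rw [hE]; simp
  have hsub := IsConnected.Ioo_csInf_csSup_subset
    ⟨hE, (ordConnected_superlevel hl hs.le).isPreconnected⟩
    (bddBelow_superlevel hl hm h1 hs) (bddAbove_superlevel hl hm h1 hs)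
  have hsup := subset_Icc_csInf_csSup
    (bddBelow_superlevel hl hm h1 hs) (bddAbove_superlevel hl hm h1 hs)
  refine le_antisymm (measure_mono (Set.inter_subset_inter_right _ hsub))
    ((measure_mono (Set.inter_subset_inter_right _ hsup)).trans (le_of_eq ?_))
  exact measure_congr (Filter.EventuallyEq.rfl.inter Ioo_ae_eq_Icc.symm)

/-- The layer-cake identity expressed through uniform measures on the superlevel sets. -/
lemma ofReal_mul_unifMeasure_superlevel
    (hl : ∀ x y l : ℝ, 0 ≤ l → l ≤ 1 → ρ x ^ l * ρ y ^ (1 - l) ≤ ρ (l * x + (1 - l) * y))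
    (hm : Measurable ρ) (h1 : ∫⁻ x, ENNReal.ofReal (ρ x) = 1) {s : ℝ} (hs : 0 < s)
    {A : Set ℝ} (hA : MeasurableSet A) {a b : ℝ}
    (ha : a = sInf {x | s < ρ x}) (hb : b = sSup {x | s < ρ x}) (hab : a ≤ b) :
    ENNReal.ofReal (b - a) * unifMeasure {y | (a + b) / 2 + (b - a) / 2 * y ∈ A}
      = volume (A ∩ {x | s < ρ x}) := by
  have hA' : MeasurableSet ((fun x => (a + b) / 2 + x) ⁻¹' A) :=
    measurable_const_add _ hA
  have h := ofReal_mul_unifMeasure_preimage (σ := (b - a) / 2) (by linarith) hA'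
  rw [mul_div_cancel₀ _ (two_ne_zero' ℝ)] at h
  rw [← volume_inter_superlevel hl hm h1 hs A, ← ha, ← hb,
    ← measure_preimage_add volume ((a + b) / 2) (A ∩ Set.Ioo a b), Set.preimage_inter,
    Set.preimage_const_add_Ioo]
  refine h.trans ?_
  congr 3 <;> ring

/-- An isotropic log-concave measure is a mixture of uniform measures on intervals, the inverse
lengths of which have bounded expectation. -/
lemma IsLogConcave1.exists_mixture {ν : Measure ℝ} [IsProbabilityMeasure ν]
    (h : IsLogConcave1 ν) (hmean : ∫ x, x ∂ν = 0) (hvar : ∫ x, x ^ 2 ∂ν = 1) :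
    ∃ P : Measure (ℝ × ℝ), IsProbabilityMeasure P ∧
      MeasurePreserving (fun z : (ℝ × ℝ) × ℝ => z.1.1 + z.1.2 * z.2) (P.prod unifMeasure) ν ∧
      (∀ᵐ p ∂P, 0 < p.2) ∧ Integrable (fun p : ℝ × ℝ => p.2⁻¹) P ∧
      ∫ p, p.2⁻¹ ∂P ≤ 6 * (1 + 2304 * Real.pi) := by
  obtain ⟨ρ, h0, hν, hl⟩ := h
  have hπ := Real.pi_pos
  have hm := measurable_of_logConcave h0 hl
  have h1 : ∫⁻ x, ENNReal.ofReal (ρ x) = 1 := by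
    have := measure_univ (μ := ν)
    rwa [hν, withDensity_apply _ MeasurableSet.univ, Measure.restrict_univ] at this
  set H : ℝ := 3 * (1 + 2304 * Real.pi) with hH
  have hbd : ∀ x, ρ x ≤ H := logConcave_density_le h0 hl hν hmean hvar
  set S : Set ℝ := {s | 0 < s ∧ ({x | s < ρ x}).Nonempty} with hS
  have hSH : S ⊆ Set.Ioo 0 H := fun s hs => ⟨hs.1, hs.2.some_mem.out.trans_le (hbd _)⟩
  have hSo : S.OrdConnected := ⟨fun s hs u hu r hr =>
    ⟨hs.1.trans_le hr.1, hu.2.mono fun x hx => lt_of_le_of_lt hr.2 hx⟩⟩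
  have hSm : MeasurableSet S := hSo.measurableSet
  set a : ℝ → ℝ := fun s => sInf {x | s < ρ x} with ha
  set b : ℝ → ℝ := fun s => sSup {x | s < ρ x} with hb
  have hab : ∀ s ∈ S, a s ≤ b s := fun s hs => csInf_le_csSup hs.2
    (bddBelow_superlevel hl hm h1 hs.1) (bddAbove_superlevel hl hm h1 hs.1)
  have ham : AEMeasurable a (volume.restrict S) := by
    refine aemeasurable_restrict_of_monotoneOn hSm fun s hs u hu hsu => ?_
    exact csInf_le_csInf (bddBelow_superlevel hl hm h1 hs.1) hu.2 fun x hx => hsu.trans_lt hx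
  have hbm : AEMeasurable b (volume.restrict S) := by
    refine aemeasurable_restrict_of_antitoneOn hSm fun s hs u hu hsu => ?_
    exact csSup_le_csSup (bddAbove_superlevel hl hm h1 hs.1) hu.2 fun x hx => hsu.trans_lt hx
  have hdm : AEMeasurable (fun s => ENNReal.ofReal (b s - a s)) (volume.restrict S) :=
    (hbm.sub ham).ennreal_ofReal
  set L := (volume.restrict S).withDensity fun s => ENNReal.ofReal (b s - a s) with hL
  have hLac : L ≪ volume.restrict S := withDensity_absolutelyContinuous _ _
  set φ : ℝ → ℝ × ℝ := fun s => ((a s + b s) / 2, (b s - a s) / 2) with hφ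
  have hφm₀ : AEMeasurable φ (volume.restrict S) :=
    ((ham.add hbm).div_const 2).prodMk ((hbm.sub ham).div_const 2)
  have hφm : AEMeasurable φ L := hφm₀.mono_ac hLac
  have hmap : ∀ g : ℝ × ℝ → ENNReal, Measurable g → ∫⁻ p, g p ∂(L.map φ)
      = ∫⁻ s in S, ENNReal.ofReal (b s - a s) * g (φ s) := fun g hg => by
    rw [lintegral_map' hg.aemeasurable hφm, hL,
      lintegral_withDensity_eq_lintegral_mul₀ hdm (g := fun s => g (φ s))
        (hg.comp_aemeasurable hφm₀)]
    rfl
  have hFm : Measurable fun z : (ℝ × ℝ) × ℝ => z.1.1 + z.1.2 * z.2 := by fun_prop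
  have : SFinite L := by rw [hL]; infer_instance
  have hpres : MeasurePreserving (fun z : (ℝ × ℝ) × ℝ => z.1.1 + z.1.2 * z.2)
      ((L.map φ).prod unifMeasure) ν := by
    refine ⟨hFm, Measure.ext fun A hA => ?_⟩
    rw [Measure.map_apply hFm hA, Measure.prod_apply (hFm hA),
      hmap _ (measurable_measure_prodMk_left (hFm hA))]
    have e1 : ∀ s ∈ S, ENNReal.ofReal (b s - a s) *
        unifMeasure (Prod.mk (φ s) ⁻¹' ((fun z : (ℝ × ℝ) × ℝ => z.1.1 + z.1.2 * z.2) ⁻¹' A))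
        = volume.restrict A {x | s < ρ x} := fun s hs => by
      rw [Measure.restrict_apply (measurableSet_lt measurable_const hm), Set.inter_comm]
      exact ofReal_mul_unifMeasure_superlevel hl hm h1 hs.1 hA rfl rfl (hab s hs)
    rw [setLIntegral_congr_fun hSm e1, hν, withDensity_apply _ hA,
      lintegral_eq_lintegral_meas_lt _ (.of_forall h0) hm.aemeasurable]
    rw [← lintegral_indicator hSm, ← lintegral_indicator measurableSet_Ioi]
    refine lintegral_congr fun s => ?_
    by_cases hs : s ∈ S
    · rw [Set.indicator_of_mem hs, Set.indicator_of_mem (s := Set.Ioi 0) hs.1]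
    rw [Set.indicator_of_notMem hs]
    by_cases hs0 : s ∈ Set.Ioi (0 : ℝ)
    · have : {x | s < ρ x} = ∅ := Set.not_nonempty_iff_eq_empty.1 fun hne => hs ⟨hs0, hne⟩
      rw [Set.indicator_of_mem hs0, this, measure_empty]
    · rw [Set.indicator_of_notMem hs0]
  have hprob : IsProbabilityMeasure (L.map φ) := by
    refine ⟨?_⟩
    have := hpres.measure_preimage MeasurableSet.univ.nullMeasurableSet
    rwa [Set.preimage_univ, ← Set.univ_prod_univ, Measure.prod_prod,
      measure_univ (μ := unifMeasure), measure_univ (μ := ν), mul_one] at this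
  have hpos : ∀ᵐ p ∂(L.map φ), 0 < p.2 := by
    rw [ae_map_iff hφm (measurableSet_lt measurable_const measurable_snd), hL,
      ae_withDensity_iff' hdm]
    refine .of_forall fun s hs => ?_
    have : 0 < b s - a s := by
      by_contra hc
      exact hs (ENNReal.ofReal_eq_zero.2 (not_lt.1 hc))
    simp only [hφ]
    linarith
  have hlint : ∫⁻ p : ℝ × ℝ, ENNReal.ofReal p.2⁻¹ ∂(L.map φ) ≤ ENNReal.ofReal (2 * H) := by
    rw [hmap _ (by fun_prop)]
    calc ∫⁻ s in S, ENNReal.ofReal (b s - a s) * ENNReal.ofReal (φ s).2⁻¹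
        ≤ ∫⁻ s in S, ENNReal.ofReal 2 := by
          refine setLIntegral_mono measurable_const fun s hs => ?_
          have hs0 : 0 ≤ b s - a s := sub_nonneg.2 (hab s hs)
          rw [← ENNReal.ofReal_mul hs0]
          refine ENNReal.ofReal_le_ofReal ?_
          simp only [hφ, inv_div]
          rcases hs0.eq_or_lt with h | h
          · rw [← h]; norm_num
          · rw [mul_div_cancel₀ _ h.ne']
      _ = ENNReal.ofReal 2 * volume S := by rw [setLIntegral_const]
      _ ≤ ENNReal.ofReal 2 * volume (Set.Ioo 0 H) := by gcongr
      _ = ENNReal.ofReal (2 * H) := by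
          rw [Real.volume_Ioo, sub_zero, ENNReal.ofReal_mul (p := 2) (by norm_num)]
  have hnn : 0 ≤ᵐ[L.map φ] fun p : ℝ × ℝ => p.2⁻¹ :=
    hpos.mono fun p hp => (inv_pos.2 hp).le
  refine ⟨L.map φ, hprob, hpres, hpos, ⟨Measurable.aestronglyMeasurable (by fun_prop), ?_⟩, ?_⟩
  · rw [hasFiniteIntegral_iff_ofReal hnn]
    exact hlint.trans_lt ENNReal.ofReal_lt_top
  · rw [integral_eq_lintegral_of_nonneg_ae hnn (Measurable.aestronglyMeasurable (by fun_prop))]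
    refine (ENNReal.toReal_mono ENNReal.ofReal_ne_top hlint).trans (le_of_eq ?_)
    rw [ENNReal.toReal_ofReal (by positivity), hH]
    ring

end mixture

/-! ### From uniform measures to log-concave measures -/

lemma prod_pow_sq_rpow_neg_le_sum_inv {n d : ℕ} (hd : 1 ≤ d) {I : Fin n →₀ ℕ}
    (hI : I.degree = d) {w : Fin n → ℝ} (hw : ∀ i, 0 < w i) :
    ((∏ i, w i ^ I i) ^ 2) ^ (-(1 / (2 * d) : ℝ)) ≤ ∑ i, (I i / d : ℝ) * (w i)⁻¹ := by
  have hd0 : (0 : ℝ) < d := by exact_mod_cast hd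
  rw [prod_pow_sq_rpow_neg hw]
  have h := Real.geom_mean_le_arith_mean_weighted Finset.univ (fun i => (I i / d : ℝ))
    (fun i => (w i)⁻¹) (fun i _ => by positivity) (by
      rw [← Finset.sum_div, ← Nat.cast_sum, ← Finsupp.degree_eq_sum, hI, div_self hd0.ne'])
    (fun i _ => (inv_pos.2 (hw i)).le)
  refine le_trans (le_of_eq (Finset.prod_congr rfl fun i _ => ?_)) h
  rw [Real.inv_rpow (hw i).le, ← Real.rpow_neg (hw i).le]
  congr 1
  field_simp

lemma topSq_affSubst_pos {n d : ℕ} {m w : Fin n → ℝ} (hw : ∀ i, 0 < w i)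
    {f : MvPolynomial (Fin n) ℝ} (hf : f.totalDegree ≤ d) (hT : 0 < topSq d f) :
    0 < topSq d (affSubst m w f) := by
  rw [topSq_affSubst m w hf]
  have hX : ∀ I : Fin n →₀ ℕ, 0 < (∏ i, w i ^ I i) ^ 2 := fun I =>
    pow_pos (Finset.prod_pos fun i _ => pow_pos (hw i) _) 2
  obtain ⟨I, hI, hne⟩ := Finset.exists_ne_zero_of_sum_ne_zero hT.ne'
  exact Finset.sum_pos' (fun J _ => mul_nonneg (hX J).le (sq_nonneg _))
    ⟨I, hI, mul_pos (hX I) (lt_of_le_of_ne (sq_nonneg _) (Ne.symm hne))⟩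

lemma topSq_affSubst_rpow_neg_le {n d : ℕ} (hd : 1 ≤ d) {m w : Fin n → ℝ} (hw : ∀ i, 0 < w i)
    {f : MvPolynomial (Fin n) ℝ} (hf : f.totalDegree ≤ d) (hT : 0 < topSq d f) :
    topSq d (affSubst m w f) ^ (-(1 / (2 * d) : ℝ))
      ≤ topSq d f ^ (-(1 / (2 * d) : ℝ)) * ∑ I ∈ topExp n d,
        MvPolynomial.coeff I f ^ 2 / topSq d f * ∑ i, (I i / d : ℝ) * (w i)⁻¹ := by
  have hX : ∀ I : Fin n →₀ ℕ, 0 < (∏ i, w i ^ I i) ^ 2 := fun I =>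
    pow_pos (Finset.prod_pos fun i _ => pow_pos (hw i) _) 2
  have h := rpow_neg_sum_le_of_pos (topExp n d) (a := fun I => MvPolynomial.coeff I f ^ 2)
    (X := fun I => (∏ i, w i ^ I i) ^ 2) (x := 1 / (2 * d)) (by positivity)
    (fun _ _ => sq_nonneg _) hT (fun I _ => hX I)
  rw [topSq_affSubst m w hf]
  simp_rw [mul_comm ((∏ i, w i ^ _) ^ 2)]
  refine h.trans ?_
  refine mul_le_mul_of_nonneg_left ?_ (Real.rpow_nonneg hT.le _)
  refine Finset.sum_le_sum fun I hI => ?_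
  exact mul_le_mul_of_nonneg_left (prod_pow_sq_rpow_neg_le_sum_inv hd (mem_topExp.1 hI) hw)
    (div_nonneg (sq_nonneg _) hT.le)

/-- Fourier decay passes to products of mixtures of affine images. -/
lemma norm_integral_cexp_le_of_mixture {n d : ℕ} (hd : 1 ≤ d) {ν : Measure ℝ}
    [IsProbabilityMeasure ν] {K : ℝ} (hK : 0 < K)
    (hν : ∀ f : MvPolynomial (Fin n) ℝ, f.totalDegree ≤ d → 0 < topSq d f →
      ‖∫ x, Complex.exp (Complex.I * (MvPolynomial.eval x f : ℝ)) ∂Measure.pi (fun _ => ν)‖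
        ≤ K * topSq d f ^ (-(1 / (2 * d) : ℝ)))
    {P : Fin n → Measure (ℝ × ℝ)} {μ : Fin n → Measure ℝ} [∀ i, IsProbabilityMeasure (P i)]
    [∀ i, IsProbabilityMeasure (μ i)]
    (hP : ∀ i, MeasurePreserving (fun z : (ℝ × ℝ) × ℝ => z.1.1 + z.1.2 * z.2)
      ((P i).prod ν) (μ i))
    (hpos : ∀ i, ∀ᵐ p ∂P i, 0 < p.2) (hInt : ∀ i, Integrable (fun p : ℝ × ℝ => p.2⁻¹) (P i))
    {M : ℝ} (hM : ∀ i, ∫ p, p.2⁻¹ ∂P i ≤ M)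
    {f : MvPolynomial (Fin n) ℝ} (hf : f.totalDegree ≤ d) (hT : 0 < topSq d f) :
    ‖∫ x, Complex.exp (Complex.I * (MvPolynomial.eval x f : ℝ)) ∂Measure.pi μ‖
      ≤ K * M * topSq d f ^ (-(1 / (2 * d) : ℝ)) := by
  have hd0 : (0 : ℝ) < d := by exact_mod_cast hd
  have hTne : topSq d f ≠ 0 := hT.ne'
  set r := topSq d f ^ (-(1 / (2 * d) : ℝ)) with hr
  have hr0 : 0 ≤ r := Real.rpow_nonneg hT.le _
  have hinv : ∀ i, Integrable (fun ω : Fin n → ℝ × ℝ => (ω i).2⁻¹) (Measure.pi P) := fun i =>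
    (measurePreserving_eval P i).integrable_comp_of_integrable (hInt i)
  have hinvI : ∀ i, ∫ ω : Fin n → ℝ × ℝ, (ω i).2⁻¹ ∂Measure.pi P ≤ M := fun i => by
    refine le_trans (le_of_eq ?_) (hM i)
    conv_rhs => rw [← (measurePreserving_eval P i).map_eq]
    rw [integral_map (measurable_pi_apply i).aemeasurable
      (Measurable.aestronglyMeasurable (by fun_prop))]
  have hin : ∀ I : Fin n →₀ ℕ, Integrable (fun ω : Fin n → ℝ × ℝ =>
      ∑ i, (I i / d : ℝ) * (ω i).2⁻¹) (Measure.pi P) := fun I =>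
    integrable_finsetSum _ fun i _ => (hinv i).const_mul _
  have hsum : Integrable (fun ω : Fin n → ℝ × ℝ => ∑ I ∈ topExp n d,
      MvPolynomial.coeff I f ^ 2 / topSq d f * ∑ i, (I i / d : ℝ) * (ω i).2⁻¹) (Measure.pi P) :=
    integrable_finsetSum _ fun I _ => (hin I).const_mul _
  have hall : ∀ᵐ ω ∂Measure.pi P, ∀ i, 0 < (ω i).2 := ae_all_iff.2 fun i =>
    (measurePreserving_eval P i).quasiMeasurePreserving.ae (hpos i)
  refine (norm_integral_cexp_mixture_le P ν μ hP f ((hsum.const_mul r).const_mul K)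
    (hall.mono fun ω hω => ?_)).trans ?_
  · refine (hν _ (totalDegree_affSubst_le _ _ hf) (topSq_affSubst_pos hω hf hT)).trans ?_
    exact mul_le_mul_of_nonneg_left (topSq_affSubst_rpow_neg_le hd hω hf hT) hK.le
  · rw [integral_const_mul, integral_const_mul, mul_assoc, mul_comm M]
    refine mul_le_mul_of_nonneg_left (mul_le_mul_of_nonneg_left ?_ hr0) hK.le
    rw [integral_finsetSum _ fun I _ => (hin I).const_mul _]
    calc ∑ I ∈ topExp n d, ∫ ω, MvPolynomial.coeff I f ^ 2 / topSq d f
            * ∑ i, (I i / d : ℝ) * (ω i).2⁻¹ ∂Measure.pi P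
        ≤ ∑ I ∈ topExp n d, MvPolynomial.coeff I f ^ 2 / topSq d f * M := by
          refine Finset.sum_le_sum fun I hI => ?_
          rw [integral_const_mul]
          refine mul_le_mul_of_nonneg_left ?_ (div_nonneg (sq_nonneg _) hT.le)
          rw [integral_finsetSum _ fun i _ => (hinv i).const_mul _]
          calc ∑ i, ∫ ω : Fin n → ℝ × ℝ, (I i / d : ℝ) * (ω i).2⁻¹ ∂Measure.pi P
              ≤ ∑ i, (I i / d : ℝ) * M := by
                refine Finset.sum_le_sum fun i _ => ?_
                rw [integral_const_mul]
                exact mul_le_mul_of_nonneg_left (hinvI i) (by positivity)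
            _ = M := by
                rw [← Finset.sum_mul, ← Finset.sum_div, ← Nat.cast_sum, ← Finsupp.degree_eq_sum,
                  mem_topExp.1 hI, div_self hd0.ne', one_mul]
      _ = M := by
          rw [← Finset.sum_mul, ← Finset.sum_div]
          change topSq d f / topSq d f * M = M
          rw [div_self hTne, one_mul]

lemma topSq_eq_one_of_coeffNorm {n d : ℕ} {f : MvPolynomial (Fin n) ℝ}
    (h : coeffNorm d f = 1) : topSq d f = 1 := by
  have h1 : topSq d f = ∑ I ∈ f.support.filter (fun I => (I.sum fun _ e => e) = d),
      (MvPolynomial.coeff I f) ^ 2 := by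
    refine (Finset.sum_subset (fun I hI => ?_) fun I hI hI' => ?_).symm
    · exact mem_topExp.2 (Finset.mem_filter.1 hI).2
    · by_contra hne
      refine hI' (Finset.mem_filter.2 ⟨MvPolynomial.mem_support_iff.2 fun h0 => hne ?_, ?_⟩)
      · rw [h0]; ring
      · exact mem_topExp.1 hI
  rw [h1]
  exact Real.sqrt_eq_one.1 h

/-- Proposition 1.3: for an isotropic log-concave product probability measure on ℝ^n and a
degree-`d` polynomial `f` with `coeff_d(f) = 1`, the Fourier coefficients of the pushforward
decay like `|t|^{-1/d}`, with a constant depending only on `d`. -/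
theorem fourier_decay_product_log_concave (d : ℕ) :
    ∃ C : ℝ, 0 < C ∧
      ∀ (n : ℕ) (ν : Fin n → Measure ℝ),
        (∀ i, IsProbabilityMeasure (ν i)) →
        (∀ i, IsLogConcave1 (ν i)) →
        (∀ i, ∫ x, x ∂(ν i) = 0) →
        (∀ i, ∫ x, x ^ 2 ∂(ν i) = 1) →
        ∀ f : MvPolynomial (Fin n) ℝ, f.totalDegree = d → coeffNorm d f = 1 →
        ∀ t : ℝ, t ≠ 0 →
          ‖∫ x, Complex.exp (Complex.I * (t : ℂ) * (MvPolynomial.eval x f : ℂ))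
              ∂(Measure.pi ν)‖
            ≤ C * |t| ^ (-(1 / (d : ℝ))) := by
  have hrw : ∀ (n : ℕ) (f : MvPolynomial (Fin n) ℝ) (t : ℝ) (x : Fin n → ℝ),
      Complex.exp (Complex.I * (t : ℂ) * (MvPolynomial.eval x f : ℂ))
        = Complex.exp (Complex.I * (MvPolynomial.eval x (MvPolynomial.C t * f) : ℝ)) :=
    fun n f t x => by
      rw [map_mul, MvPolynomial.eval_C, Complex.ofReal_mul, mul_assoc]
  rcases Nat.eq_zero_or_pos d with rfl | hd
  · refine ⟨1, one_pos, fun n ν hp _ _ _ f _ _ t _ => ?_⟩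
    simp_rw [hrw]
    refine (norm_integral_cexp_le_one (Measure.pi ν) fun x =>
      MvPolynomial.eval x (MvPolynomial.C t * f)).trans (le_of_eq ?_)
    simp
  obtain ⟨K, hK, hdecay⟩ := fourierDecay_unifMeasure hd
  have hπ := Real.pi_pos
  refine ⟨K * (6 * (1 + 2304 * Real.pi)), by positivity,
    fun n ν hp hlc hmean hvar f hf hc t ht => ?_⟩
  have hmix := fun i => (hlc i).exists_mixture (hmean i) (hvar i)
  choose P hPp hP hpos hInt hM using hmix
  have hT : topSq d (MvPolynomial.C t * f) = t ^ 2 := by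
    rw [topSq_C_mul, topSq_eq_one_of_coeffNorm hc, mul_one]
  have h := norm_integral_cexp_le_of_mixture hd hK (hdecay n) hP hpos hInt hM
    ((totalDegree_C_mul_le t f).trans hf.le) (by rw [hT]; positivity)
  simp_rw [hrw]
  refine h.trans (le_of_eq ?_)
  rw [hT, ← sq_abs, ← Real.rpow_natCast, ← Real.rpow_mul (abs_nonneg t)]
  congr 2
  push_cast
  field_simp
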